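/- (Jacobi's ratio theorem for quantum Berezinians) Let I = \{i_1 < ... < i_k\} \subseteq [m+n] with complement I^c, and suppose either I \subseteq [m] or [m] \subseteq I. Then Ber_q(M) = Ber_q(M_I) \cdot Ber_{q^{-1}}(((M^{-1})_{I^c})^{\Pi \circ st}). -/

import Mathlib

open scoped BigOperators Classical
open Finset

namespace QSM

/-- Parity of a basis index of `ℂ^{m|n}`: `0` (even) for indices `< m`, `1` (odd) otherwise. -/
def pa (m : ℕ) {N : ℕ} (i : Fin N) : ℕ := if (i : ℕ) < m then 0 else 1

/-- The sign `ε(i - j)`: `1` if `i > j`, `0` if `i = j`, `-1` if `i < j`. -/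
def eps {N : ℕ} (i j : Fin N) : ℤ :=
  if (j : ℕ) < (i : ℕ) then 1 else if (i : ℕ) < (j : ℕ) then -1 else 0

variable {B : Type*} [Ring B] [Algebra ℂ B]

/-- Map a complex matrix into a matrix over the `ℂ`-algebra `B`. -/
noncomputable def cmap {I : Type*} (X : Matrix I I ℂ) : Matrix I I B :=
  X.map (algebraMap ℂ B)

/-- The super tensor product `E_{ij} ⊗ E_{kl}` of matrix units, as an operator on the
graded tensor square of `ℂ^{m|n}` (super sign conventions). -/
noncomputable def stu (m : ℕ) {N : ℕ} (i j k l : Fin N) :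
    Matrix (Fin N × Fin N) (Fin N × Fin N) ℂ :=
  Matrix.of fun p r =>
    ((-1 : ℂ) ^ ((pa m k + pa m l) * pa m r.1)) *
      (if p.1 = i ∧ r.1 = j then 1 else 0) * (if p.2 = k ∧ r.2 = l then 1 else 0)

/-- The operator `P^q = ∑_{i,j} q^{ε(i-j)} (-1)^{\bar j} E_{ij} ⊗ E_{ji}` on
`(ℂ^{m|n})^{⊗2}`. -/
noncomputable def Pq (q : ℂ) (m : ℕ) {N : ℕ} : Matrix (Fin N × Fin N) (Fin N × Fin N) ℂ :=
  ∑ i : Fin N, ∑ j : Fin N, (q ^ eps i j * (-1 : ℂ) ^ pa m j) • stu m i j j i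

/-- `M₁ = ∑ (-1)^{\bar i\bar j+\bar j} M_{ij} ⊗ E_{ij} ⊗ 1` on the tensor square. -/
noncomputable def Mone (m : ℕ) {N : ℕ} (M : Matrix (Fin N) (Fin N) B) :
    Matrix (Fin N × Fin N) (Fin N × Fin N) B :=
  Matrix.of fun p r =>
    if p.2 = r.2 then
      ((-1 : ℂ) ^ (pa m p.1 * pa m r.1 + pa m r.1)) • M p.1 r.1
    else 0

/-- `M₂ = ∑ (-1)^{\bar i\bar j+\bar j} M_{ij} ⊗ 1 ⊗ E_{ij}` on the tensor square
(with the super sign of `1 ⊗ E_{ij}`). -/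
noncomputable def Mtwo (m : ℕ) {N : ℕ} (M : Matrix (Fin N) (Fin N) B) :
    Matrix (Fin N × Fin N) (Fin N × Fin N) B :=
  Matrix.of fun p r =>
    if p.1 = r.1 then
      ((-1 : ℂ) ^ (pa m p.2 * pa m r.2 + pa m r.2 + (pa m p.2 + pa m r.2) * pa m r.1)) •
        M p.2 r.2
    else 0

/-- The `q`-super Manin matrix condition in matrix form:
`(1 - P^q) M₁ M₂ (1 + P^q) = 0`. -/
def IsManin (q : ℂ) (m : ℕ) {N : ℕ} (M : Matrix (Fin N) (Fin N) B) : Prop :=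
  (1 - cmap (Pq q m)) * Mone m M * Mtwo m M * (1 + cmap (Pq q m)) = 0

/-- The entrywise relations of the right quantum superalgebra `𝓜_{m|n}`. -/
def ManinRel (q : ℂ) (m : ℕ) {N : ℕ} (M : Matrix (Fin N) (Fin N) B) : Prop :=
  (∀ i j, pa m i = 1 → pa m j = 0 → M i j * M i j = 0) ∧
  (∀ i k l, pa m i = 1 →
    M i k * M i l = (q ^ eps l k * (-1 : ℂ) ^ ((pa m k + 1) * (pa m l + 1))) • (M i l * M i k)) ∧
  (∀ i j k, pa m k = 0 →
    M i k * M j k = (q ^ eps i j * (-1 : ℂ) ^ (pa m i * pa m j)) • (M j k * M i k)) ∧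
  (∀ i j k l,
    M i j * M k l -
        (q ^ (eps i k + eps l j) * (-1 : ℂ) ^ ((pa m i + pa m j) * (pa m k + pa m l))) •
          (M k l * M i j)
      = (q ^ eps i k * (-1 : ℂ) ^ (pa m i * pa m k + pa m j * pa m k + pa m i * pa m j)) •
            (M k j * M i l)
        - (q ^ eps l j * (-1 : ℂ) ^ (pa m j * pa m k + pa m j * pa m l + pa m k * pa m l)) •
            (M i l * M k j))

/-- The operator `P^q_σ` on `(ℂ^{m|n})^{⊗k}` (defined via reduced decompositions of `σ`;
equivalently, by the explicit inversion formula used here). -/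
noncomputable def Pperm (q : ℂ) (m : ℕ) {N k : ℕ} (σ : Equiv.Perm (Fin k)) :
    Matrix (Fin k → Fin N) (Fin k → Fin N) ℂ :=
  Matrix.of fun f g =>
    if f = g ∘ ⇑σ⁻¹ then
      ∏ p ∈ Finset.univ.filter (fun p : Fin k × Fin k => p.1 < p.2 ∧ σ p.2 < σ p.1),
        (q ^ eps (g p.1) (g p.2) * (-1 : ℂ) ^ (pa m (g p.1) * pa m (g p.2)))
    else 0

/-- The `q`-antisymmetrizer over the tensor positions in `S`. -/
noncomputable def AqS (q : ℂ) (m : ℕ) {N k : ℕ} (S : Finset (Fin k)) :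
    Matrix (Fin k → Fin N) (Fin k → Fin N) ℂ :=
  (S.card.factorial : ℂ)⁻¹ •
    ∑ σ ∈ Finset.univ.filter (fun σ : Equiv.Perm (Fin k) => ∀ t ∉ S, σ t = t),
      (((Equiv.Perm.sign σ : ℤ) : ℂ)) • Pperm q m (N := N) σ

/-- The `q`-symmetrizer over the tensor positions in `S`. -/
noncomputable def HqS (q : ℂ) (m : ℕ) {N k : ℕ} (S : Finset (Fin k)) :
    Matrix (Fin k → Fin N) (Fin k → Fin N) ℂ :=
  (S.card.factorial : ℂ)⁻¹ •
    ∑ σ ∈ Finset.univ.filter (fun σ : Equiv.Perm (Fin k) => ∀ t ∉ S, σ t = t),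
      Pperm q m (N := N) σ

/-- `M_a`: the copy of `M` in the `a`-th slot of `B ⊗ End(ℂ^{m|n})^{⊗k}`, with the super
sign factors `(-1)^{\bar i\bar j+\bar j}` and the super signs of `1⊗⋯⊗E_{ij}⊗⋯⊗1`. -/
noncomputable def Mslot (m : ℕ) {N k : ℕ} (M : Matrix (Fin N) (Fin N) B) (a : Fin k) :
    Matrix (Fin k → Fin N) (Fin k → Fin N) B :=
  Matrix.of fun f g =>
    if ∀ b, b ≠ a → f b = g b then
      ((-1 : ℂ) ^ (pa m (f a) * pa m (g a) + pa m (g a)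
          + (pa m (f a) + pa m (g a)) *
              ∑ b ∈ Finset.univ.filter (fun b => b < a), pa m (g b))) •
        M (f a) (g a)
    else 0

/-- The product `M₁ M₂ ⋯ M_k`. -/
noncomputable def MProd (m : ℕ) {N : ℕ} (M : Matrix (Fin N) (Fin N) B) (k : ℕ) :
    Matrix (Fin k → Fin N) (Fin k → Fin N) B :=
  (List.ofFn fun a : Fin k => Mslot m M a).prod

/-- The `q`-super Manin condition in the form `𝒜₂^q M₁ M₂ ℋ₂^q = 0`. -/
def IsManin2 (q : ℂ) (m : ℕ) {N : ℕ} (M : Matrix (Fin N) (Fin N) B) : Prop :=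
  cmap (AqS q m (Finset.univ : Finset (Fin 2))) * Mslot m M (0 : Fin 2) *
      Mslot m M (1 : Fin 2) * cmap (HqS q m (Finset.univ : Finset (Fin 2))) = 0

/-- The supertrace `str_{1,…,k}` over all `k` tensor slots. -/
noncomputable def strAll (m : ℕ) {N k : ℕ}
    (X : Matrix (Fin k → Fin N) (Fin k → Fin N) B) : B :=
  ∑ f : Fin k → Fin N, ((-1 : ℂ) ^ (∑ t, pa m (f t))) • X f f

/-- The supertrace of an `N × N` matrix. -/
noncomputable def strM (m : ℕ) {N : ℕ} (X : Matrix (Fin N) (Fin N) B) : B :=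
  ∑ i, ((-1 : ℂ) ^ pa m i) • X i i

/-- The star product `B * C = str₁ (P^q_{12} B₁ C₂)`. -/
noncomputable def starMul (q : ℂ) (m : ℕ) {N : ℕ} (X Y : Matrix (Fin N) (Fin N) B) :
    Matrix (Fin N) (Fin N) B :=
  Matrix.of fun i j =>
    ((-1 : ℂ) ^ (pa m i * pa m j + pa m j)) •
      ∑ a : Fin N, ((-1 : ℂ) ^ (pa m a * (1 + pa m i + pa m j))) •
        ((cmap (Pperm q m (Equiv.swap (0 : Fin 2) 1)) * Mslot m X (0 : Fin 2) *
            Mslot m Y (1 : Fin 2) :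
          Matrix (Fin 2 → Fin N) (Fin 2 → Fin N) B) ![a, i] ![a, j])

/-- The powers `M^{[k]}` of `M` with respect to the star product. -/
noncomputable def Mpow (q : ℂ) (m : ℕ) {N : ℕ} (M : Matrix (Fin N) (Fin N) B) :
    ℕ → Matrix (Fin N) (Fin N) B
  | 0 => 1
  | 1 => M
  | (j + 2) => starMul q m (Mpow q m M (j + 1)) M

/-- Coefficient of `t^k` in `A(t) = ∑ (-t)^k str_{1,…,k}(𝒜_k^q M₁⋯M_k)`. -/
noncomputable def coefA (q : ℂ) (m : ℕ) {N : ℕ} (M : Matrix (Fin N) (Fin N) B) (k : ℕ) : B :=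
  ((-1 : ℂ) ^ k) •
    strAll m (cmap (AqS q m (Finset.univ : Finset (Fin k))) * MProd m M k)

/-- Coefficient of `t^k` in `S(t) = ∑ t^k str_{1,…,k}(ℋ_k^q M₁⋯M_k)`. -/
noncomputable def coefS (q : ℂ) (m : ℕ) {N : ℕ} (M : Matrix (Fin N) (Fin N) B) (k : ℕ) : B :=
  strAll m (cmap (HqS q m (Finset.univ : Finset (Fin k))) * MProd m M k)

/-- Coefficient of `t^k` in `T(t) = ∑ t^k str(M^{[k+1]})`. -/
noncomputable def coefT (q : ℂ) (m : ℕ) {N : ℕ} (M : Matrix (Fin N) (Fin N) B) (k : ℕ) : B :=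
  strM m (Mpow q m M (k + 1))

/-- Coefficients `M^{i_1…i_k}_{j_1…j_k}` of `𝒜_k^q M₁⋯M_k` in the basis
`E_{i_1j_1} ⊗ ⋯ ⊗ E_{i_kj_k}` (super sign conventions). -/
noncomputable def MIJ (q : ℂ) (m : ℕ) {N k : ℕ} (M : Matrix (Fin N) (Fin N) B)
    (f g : Fin k → Fin N) : B :=
  ((-1 : ℂ) ^ (∑ a : Fin k, (pa m (f a) + pa m (g a)) *
      ∑ b ∈ Finset.univ.filter (fun b => b < a), pa m (g b))) •
    ((cmap (AqS q m (Finset.univ : Finset (Fin k))) * MProd m M k :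
      Matrix (Fin k → Fin N) (Fin k → Fin N) B) f g)

/-- Number of inversions (the length `l(σ)`) of a permutation. -/
def invCount {r : ℕ} (σ : Equiv.Perm (Fin r)) : ℕ :=
  (Finset.univ.filter fun p : Fin r × Fin r => p.1 < p.2 ∧ σ p.2 < σ p.1).card

/-- The quantum determinant `det_q(A) = ∑_σ (-q)^{-l(σ)} A_{σ(1),1} ⋯ A_{σ(r),r}`. -/
noncomputable def detq (q : ℂ) {r : ℕ} (A : Matrix (Fin r) (Fin r) B) : B :=
  ∑ σ : Equiv.Perm (Fin r),
    ((-q) ^ (-(invCount σ : ℤ))) • (List.ofFn fun i : Fin r => A (σ i) i).prod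

/-- The quantum Berezinian of a type `(r|s)` matrix `A` with (two-sided) inverse `Ainv`. -/
noncomputable def Ber (q : ℂ) (r s : ℕ) (A Ainv : Matrix (Fin (r + s)) (Fin (r + s)) B) : B :=
  (∑ σ : Equiv.Perm (Fin r), ((-q) ^ (-(invCount σ : ℤ))) •
      (List.ofFn fun i : Fin r => A (Fin.castAdd s (σ i)) (Fin.castAdd s i)).prod) *
  (∑ ρ : Equiv.Perm (Fin s), ((-q) ^ (-(invCount ρ : ℤ))) •
      (List.ofFn fun j : Fin s => Ainv (Fin.natAdd r j) (Fin.natAdd r (ρ j))).prod)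

/-- The `Π ∘ st` transform of a type `(r'|s')` matrix: a type `(s'|r')` matrix. -/
noncomputable def PiSt (r' s' : ℕ) (A : Matrix (Fin (r' + s')) (Fin (r' + s')) B) :
    Matrix (Fin (s' + r')) (Fin (s' + r')) B :=
  Matrix.of fun i j =>
    ((-1 : ℂ) ^ (pa s' i * (pa s' i + pa s' j))) •
      A (Fin.rev (Fin.cast (Nat.add_comm s' r') j)) (Fin.rev (Fin.cast (Nat.add_comm s' r') i))

/-- Left corner embedding `Fin a → Fin b`. -/
def embL (a b : ℕ) (h : a ≤ b) : Fin a → Fin b :=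
  fun i => ⟨(i : ℕ), lt_of_lt_of_le i.isLt h⟩

/-- Embedding of `Fin a` into `Fin b` shifted by `c`. -/
def embR (c a b : ℕ) (h : c + a ≤ b) : Fin a → Fin b :=
  fun i => ⟨c + (i : ℕ), by have := i.isLt; omega⟩

/-- `P^q ⊗ 1` on the triple tensor space. -/
noncomputable def P12 (q : ℂ) (m : ℕ) {N : ℕ} :
    Matrix (Fin N × Fin N × Fin N) (Fin N × Fin N × Fin N) ℂ :=
  Matrix.of fun p r =>
    Pq q m (p.1, p.2.1) (r.1, r.2.1) * (if p.2.2 = r.2.2 then 1 else 0)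

/-- `1 ⊗ P^q` on the triple tensor space (no extra super sign: `P^q` is even). -/
noncomputable def P23 (q : ℂ) (m : ℕ) {N : ℕ} :
    Matrix (Fin N × Fin N × Fin N) (Fin N × Fin N × Fin N) ℂ :=
  Matrix.of fun p r =>
    (if p.1 = r.1 then 1 else 0) * Pq q m (p.2.1, p.2.2) (r.2.1, r.2.2)

section
variable {B : Type*} [Ring B] [Algebra ℂ B]

/-- The defining quadratic relations of a `q`-super Manin matrix for an arbitrary parity `p`. -/
def Rel {N : ℕ} (p : Fin N → ℕ) (q : ℂ) (M : Matrix (Fin N) (Fin N) B) : Prop :=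
  ∀ i j k l,
    M i j * M k l - (q ^ (eps i k + eps l j) * (-1 : ℂ) ^ ((p i + p j) * (p k + p l))) •
        (M k l * M i j)
      = (q ^ eps i k * (-1 : ℂ) ^ (p i * p k + p j * p k + p i * p j)) • (M k j * M i l)
        - (q ^ eps l j * (-1 : ℂ) ^ (p j * p k + p j * p l + p k * p l)) • (M i l * M k j)

/-- Structure constants of the quantum superspace: `x i * x j = cst p q i j • (x j * x i)`. -/
noncomputable def cst {N : ℕ} (p : Fin N → ℕ) (q : ℂ) (i j : Fin N) : ℂ :=
  -((-1 : ℂ) ^ (p i * p j) * q ^ eps j i)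

lemma eps_neg {N : ℕ} (i j : Fin N) : eps i j = -eps j i := by
  unfold eps; split_ifs <;> first | rfl | omega

lemma eps_self {N : ℕ} (i : Fin N) : eps i i = 0 := by simp [eps]

lemma eps_of_lt {N : ℕ} {i j : Fin N} (h : i < j) : eps i j = -1 := by
  have : (i : ℕ) < j := h
  simp [eps, this, h.le]

lemma eps_of_gt {N : ℕ} {i j : Fin N} (h : j < i) : eps i j = 1 := by
  have : (j : ℕ) < i := h
  simp [eps, this]

lemma cst_mul_cst {N : ℕ} (p : Fin N → ℕ) {q : ℂ} (hq : q ≠ 0) (i j : Fin N) :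
    cst p q i j * cst p q j i = 1 := by
  unfold cst
  rw [eps_neg i j, zpow_neg, mul_comm (p j) (p i)]
  have h1 : ((-1 : ℂ) ^ (p i * p j)) * ((-1 : ℂ) ^ (p i * p j)) = 1 := by
    rw [← mul_pow]; simp
  field_simp
  linear_combination h1

lemma cst_ne_zero {N : ℕ} (p : Fin N → ℕ) {q : ℂ} (hq : q ≠ 0) (i j : Fin N) :
    cst p q i j ≠ 0 := left_ne_zero_of_mul (by rw [cst_mul_cst p hq i j]; exact one_ne_zero)

lemma cst_inv {N : ℕ} (p : Fin N → ℕ) (q : ℂ) (i j : Fin N) :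
    cst p q⁻¹ i j = cst p q j i := by
  unfold cst
  rw [eps_neg j i, inv_zpow, zpow_neg, inv_inv, mul_comm (p j) (p i)]

lemma rel_symm_aux {N : ℕ} {p : Fin N → ℕ} (hp : ∀ i, p i = 0 ∨ p i = 1) {q : ℂ} (hq : q ≠ 0)
    {M : Matrix (Fin N) (Fin N) B} (hM : Rel p q M) (i k j l : Fin N) :
    ((-1 : ℂ) ^ ((p i + p j) * p k) • (M i j * M k l)
        - (cst p q j l * (-1 : ℂ) ^ ((p i + p l) * p k)) • (M i l * M k j))
      + cst p q k i • ((-1 : ℂ) ^ ((p k + p j) * p i) • (M k j * M i l)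
        - (cst p q j l * (-1 : ℂ) ^ ((p k + p l) * p i)) • (M k l * M i j)) = 0 := by
  have h := hM i j k l
  unfold cst
  rw [zpow_add₀ hq] at h
  rcases hp i with hi | hi <;> rcases hp j with hj | hj <;> rcases hp k with hk | hk <;>
    rcases hp l with hl | hl <;>
    · simp only [hi, hj, hk, hl] at h ⊢
      norm_num at h ⊢
      first
        | exact h
        | (have h' := sub_eq_zero.2 h
           first
             | (refine Eq.trans ?_ h'; module)
             | (refine Eq.trans ?_ (neg_eq_zero.2 h'); module))

end

/-- Exponents of ordered monomials: the even directions are fermionic, the odd ones bosonic. -/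
def Mi {N : ℕ} (p : Fin N → ℕ) : Type := {α : Fin N → ℕ // ∀ i, p i = 0 → α i ≤ 1}

section Fock
variable {N : ℕ} {p : Fin N → ℕ} {A : Type*} [Ring A] [Algebra ℂ A]

/-- Whether the exponent in direction `i` may be raised. -/
def Ok (i : Fin N) (α : Mi p) : Prop := p i = 0 → α.1 i = 0

lemma ok_upd {i : Fin N} {α : Mi p} (h : Ok i α) :
    ∀ j, p j = 0 → (Function.update α.1 i (α.1 i + 1)) j ≤ 1 := by
  intro j hj
  by_cases hij : j = i
  · subst hij; simp [h hj]
  · simp [hij, α.2 j hj]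

/-- Raise the exponent in direction `i`, if possible. -/
noncomputable def inc (i : Fin N) (α : Mi p) : Mi p :=
  if h : Ok i α then ⟨Function.update α.1 i (α.1 i + 1), ok_upd h⟩ else α

/-- Lower the exponent in direction `i`. -/
def dec (i : Fin N) (α : Mi p) : Mi p :=
  ⟨Function.update α.1 i (α.1 i - 1), by
    intro j hj
    by_cases hij : j = i
    · subst hij; have := α.2 j hj; simp; omega
    · simp [hij, α.2 j hj]⟩

lemma inc_self {i : Fin N} {α : Mi p} (h : Ok i α) : (inc i α).1 i = α.1 i + 1 := by
  simp [inc, h]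

lemma inc_ne {i j : Fin N} {α : Mi p} (h : j ≠ i) : (inc i α).1 j = α.1 j := by
  by_cases hh : Ok i α <;> simp [inc, hh, h]

lemma ok_inc_ne {i j : Fin N} {α : Mi p} (h : i ≠ j) : Ok i (inc j α) ↔ Ok i α := by
  unfold Ok; rw [inc_ne h]

lemma inc_comm {i j : Fin N} {α : Mi p} (hi : Ok i α) (hj : Ok j α) :
    inc i (inc j α) = inc j (inc i α) := by
  by_cases h : i = j
  · rw [h]
  · apply Subtype.ext; funext t
    by_cases h1 : t = i
    · subst h1
      rw [inc_self ((ok_inc_ne h).2 hi), inc_ne h, inc_ne h, inc_self hi]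
    · rw [inc_ne h1]
      by_cases h2 : t = j
      · subst h2
        rw [inc_self hj, inc_self ((ok_inc_ne h1).2 hj), inc_ne h1]
      · rw [inc_ne h2, inc_ne h2, inc_ne h1]

lemma ok_dec {i : Fin N} (α : Mi p) : Ok i (dec i α) := by
  intro h
  have := α.2 i h
  simp [dec]; omega

lemma inc_dec {i : Fin N} {α : Mi p} (h : α.1 i ≠ 0) : inc i (dec i α) = α := by
  apply Subtype.ext; funext t
  by_cases h1 : t = i
  · subst h1; rw [inc_self (ok_dec α)]; simp [dec]; omega
  · rw [inc_ne h1]; simp [dec, h1]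

lemma dec_inc {i : Fin N} {α : Mi p} (h : Ok i α) : dec i (inc i α) = α := by
  apply Subtype.ext; funext t
  by_cases h1 : t = i
  · subst h1; simp [dec, inc_self h]
  · simp [dec, h1, inc_ne h1]

lemma inc_inj {i : Fin N} {α β : Mi p} (h1 : Ok i α) (h2 : Ok i β) (h : inc i α = inc i β) :
    α = β := by rw [← dec_inc h1, h, dec_inc h2]

/-- Total degree. -/
def deg (α : Mi p) : ℕ := ∑ i, α.1 i

lemma deg_inc {i : Fin N} {α : Mi p} (h : Ok i α) : deg (inc i α) = deg α + 1 := by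
  unfold deg
  rw [← Finset.add_sum_erase _ _ (mem_univ i), ← Finset.add_sum_erase univ α.1 (mem_univ i),
    inc_self h, Finset.sum_congr rfl (fun j hj => inc_ne (α := α) (Finset.ne_of_mem_erase hj))]
  omega

lemma deg_dec {i : Fin N} {α : Mi p} (h : α.1 i ≠ 0) : deg (dec i α) + 1 = deg α := by
  rw [← deg_inc (ok_dec α), inc_dec h]

/-- The zero exponent. -/
def zer : Mi p := ⟨fun _ => 0, fun _ _ => Nat.zero_le _⟩

lemma eq_zer {α : Mi p} (h : ∀ i, α.1 i = 0) : α = zer := Subtype.ext (funext h)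

lemma ok_zer (i : Fin N) : Ok i (zer : Mi p) := fun _ => rfl

/-- Evaluation of the monomial with exponent `α` at a commuting family of scalars. -/
noncomputable def mon (g : Fin N → ℂ) (α : Mi p) : ℂ := ∏ j, g j ^ α.1 j

lemma mon_inc (g : Fin N → ℂ) {i : Fin N} {α : Mi p} (h : Ok i α) :
    mon g (inc i α) = g i * mon g α := by
  unfold mon
  rw [← Finset.mul_prod_erase _ _ (mem_univ i),
    ← Finset.mul_prod_erase univ (fun j => g j ^ α.1 j) (mem_univ i), inc_self h,
    Finset.prod_congr rfl (fun j hj => by rw [inc_ne (α := α) (Finset.ne_of_mem_erase hj)])]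
  ring

lemma mon_zer (g : Fin N → ℂ) : mon g (zer : Mi p) = 1 := by simp [mon, zer]

lemma mon_ne_zero {g : Fin N → ℂ} (hg : ∀ j, g j ≠ 0) (α : Mi p) : mon g α ≠ 0 :=
  Finset.prod_ne_zero_iff.2 fun j _ => pow_ne_zero _ (hg j)

/-- The weight of a raising operator. -/
noncomputable def wt (g : Fin N → ℂ) (i : Fin N) (α : Mi p) : ℂ := if Ok i α then mon g α else 0

/-- The Fock space with coefficients in `A`. -/
abbrev Fk (p : Fin N → ℕ) (A : Type*) [Ring A] : Type _ := Mi p →₀ A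

/-- The weighted raising operator in direction `i`. -/
noncomputable def Tp (A : Type*) [Ring A] [Algebra ℂ A] (g : Fin N → ℂ) (i : Fin N) :
    Module.End ℂ (Fk p A) :=
  Finsupp.lsum ℂ fun α => wt g i α • Finsupp.lsingle (inc i α)

lemma Tp_single (g : Fin N → ℂ) (i : Fin N) (α : Mi p) (a : A) :
    Tp A g i (Finsupp.single α a) = wt g i α • Finsupp.single (inc i α) a := by
  simp [Tp]

/-- The diagonal operator with eigenvalues `mon g`. -/
noncomputable def Dg (A : Type*) [Ring A] [Algebra ℂ A] (g : Fin N → ℂ) :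
    Module.End ℂ (Fk p A) :=
  Finsupp.lsum ℂ fun α => mon g α • Finsupp.lsingle α

lemma Dg_single (g : Fin N → ℂ) (α : Mi p) (a : A) :
    Dg A g (Finsupp.single α a) = mon g α • Finsupp.single α a := by
  simp [Dg]

/-- Left multiplication of the coefficients. -/
noncomputable def lam (p : Fin N → ℕ) (A : Type*) [Ring A] [Algebra ℂ A] :
    A →ₐ[ℂ] Module.End ℂ (Fk p A) := Algebra.lsmul ℂ ℂ (Fk p A)

lemma lam_apply (a : A) (f : Fk p A) (α : Mi p) : lam p A a f α = a * f α := by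
  simp [lam]

lemma lam_single (a b : A) (α : Mi p) :
    lam p A a (Finsupp.single α b) = Finsupp.single α (a * b) := by
  simp [lam]

lemma end_ext {X : Type*} [AddCommGroup X] [Module ℂ X] {S T : Fk p A →ₗ[ℂ] X}
    (h : ∀ α a, S (Finsupp.single α a) = T (Finsupp.single α a)) : S = T := by
  apply Finsupp.lhom_ext; exact h

lemma Tp_comm {g h : Fin N → ℂ} {i j : Fin N} {d : ℂ}
    (H : (i = j → p i ≠ 0) → g j = d * h i) :
    (Tp A g i : Module.End ℂ (Fk p A)) * Tp A h j = d • (Tp A h j * Tp A g i) := by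
  apply end_ext; intro α a
  simp only [Module.End.mul_apply, LinearMap.smul_apply, Tp_single, map_smul, smul_smul, wt]
  by_cases hi : Ok i α <;> by_cases hj : Ok j α
  · by_cases hc : i = j ∧ p i = 0
    · obtain ⟨rfl, h0⟩ := hc
      have : ¬ Ok i (inc i α) := fun hh => by
        have := hh h0; rw [inc_self hi] at this; omega
      simp [this]
    · have hH := H (fun e h0 => hc ⟨e, h0⟩)
      have h1 : Ok i (inc j α) := by
        by_cases e : i = j
        · intro h0; exact absurd ⟨e, h0⟩ hc
        · exact (ok_inc_ne e).2 hi
      have h2 : Ok j (inc i α) := by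
        by_cases e : i = j
        · intro h0; exact absurd ⟨e, e ▸ h0⟩ hc
        · exact (ok_inc_ne (Ne.symm e)).2 hj
      simp only [hi, hj, h1, h2, if_true, mon_inc, hH, inc_comm hi hj]
      congr 1; ring
  · have : ¬ Ok j (inc i α) := by
      by_cases e : i = j
      · subst e; exact absurd hi hj
      · rwa [ok_inc_ne (Ne.symm e)]
    simp [hj, this]
  · have : ¬ Ok i (inc j α) := by
      by_cases e : i = j
      · subst e; exact absurd hj hi
      · rwa [ok_inc_ne e]
    simp [hi, this]
  · simp [hi, hj]

lemma Dg_Tp (k g : Fin N → ℂ) (i : Fin N) :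
    (Dg A k : Module.End ℂ (Fk p A)) * Tp A g i = k i • (Tp A g i * Dg A k) := by
  apply end_ext; intro α a
  simp only [Module.End.mul_apply, LinearMap.smul_apply, Tp_single, Dg_single, map_smul, smul_smul,
    wt]
  by_cases hi : Ok i α
  · simp only [hi, if_true, mon_inc]; congr 1; ring
  · simp [hi]

lemma Dg_sq {k : Fin N → ℂ} (hk : ∀ i, k i * k i = 1) :
    (Dg A k : Module.End ℂ (Fk p A)) * Dg A k = 1 := by
  apply end_ext; intro α a
  have : mon k α * mon k α = 1 := by
    unfold mon; rw [← Finset.prod_mul_distrib]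
    exact Finset.prod_eq_one fun j _ => by rw [← mul_pow, hk, one_pow]
  simp [Dg_single, smul_smul, this]

lemma lam_Tp (a : A) (g : Fin N → ℂ) (i : Fin N) :
    lam p A a * Tp A g i = Tp A g i * lam p A a := by
  apply end_ext; intro α b
  simp only [Module.End.mul_apply, Tp_single, lam_single, map_smul]

lemma lam_Dg (a : A) (k : Fin N → ℂ) :
    lam p A a * Dg A k = Dg A k * lam p A a := by
  apply end_ext; intro α b
  simp only [Module.End.mul_apply, Dg_single, lam_single, map_smul]

lemma Tp_apply_inc (g : Fin N → ℂ) {i : Fin N} {β : Mi p} (h : Ok i β) (f : Fk p A) :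
    Tp A g i f (inc i β) = mon g β • f β := by
  induction f using Finsupp.induction_linear with
  | zero => simp
  | add f₁ f₂ h₁ h₂ => rw [map_add, Finsupp.add_apply, h₁, h₂, Finsupp.add_apply, smul_add]
  | single α a =>
    rw [Tp_single, Finsupp.smul_apply, Finsupp.single_apply, Finsupp.single_apply, wt]
    by_cases e : α = β
    · subst e; simp [h]
    · by_cases h' : Ok i α
      · have : inc i α ≠ inc i β := fun hh => e (inc_inj h' h hh)
        simp [e, this]
      · simp [h', e]

lemma Tp_apply_zero (g : Fin N → ℂ) {i : Fin N} {β : Mi p} (h : β.1 i = 0) (f : Fk p A) :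
    Tp A g i f β = 0 := by
  induction f using Finsupp.induction_linear with
  | zero => simp
  | add f₁ f₂ h₁ h₂ => rw [map_add, Finsupp.add_apply, h₁, h₂, zero_add]
  | single α a =>
    rw [Tp_single, Finsupp.smul_apply, Finsupp.single_apply, wt]
    by_cases h' : Ok i α
    · have : inc i α ≠ β := fun hh => by rw [← hh, inc_self h'] at h; omega
      simp [this]
    · simp [h']

lemma Dg_apply (k : Fin N → ℂ) (f : Fk p A) (β : Mi p) : Dg A k f β = mon k β • f β := by
  induction f using Finsupp.induction_linear with
  | zero => simp
  | add f₁ f₂ h₁ h₂ => rw [map_add, Finsupp.add_apply, h₁, h₂, Finsupp.add_apply, smul_add]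
  | single α a =>
    rw [Dg_single, Finsupp.smul_apply, Finsupp.single_apply]
    by_cases e : α = β
    · subst e; simp
    · simp [e]

lemma single_eq_Tp {g : Fin N → ℂ} (hg : ∀ j, g j ≠ 0) {i : Fin N} {α : Mi p} (h : α.1 i ≠ 0)
    (a : A) : Finsupp.single α a = Tp A g i ((mon g (dec i α))⁻¹ • Finsupp.single (dec i α) a) := by
  rw [map_smul, Tp_single, wt, if_pos (ok_dec α), smul_smul,
    inv_mul_cancel₀ (mon_ne_zero hg _), one_smul, inc_dec h]

/-- Elements supported away from the monomials free of the directions in `T` are exactly the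
combinations of elements in the ranges of the raising operators in directions `T`. -/
lemma mem_iSup_range {g : Fin N → Fin N → ℂ} (hg : ∀ i j, g i j ≠ 0) (T : Set (Fin N))
    (f : Fk p A) :
    f ∈ (⨆ i ∈ T, LinearMap.range (Tp A (g i) i : Module.End ℂ (Fk p A))) ↔
      ∀ β : Mi p, (∀ i ∈ T, β.1 i = 0) → f β = 0 := by
  constructor
  · intro hf β hβ
    have : (⨆ i ∈ T, LinearMap.range (Tp A (g i) i : Module.End ℂ (Fk p A))) ≤
        LinearMap.ker (Finsupp.lapply (R := ℂ) β) := by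
      refine iSup₂_le fun i hi => ?_
      rintro _ ⟨e, rfl⟩
      simpa using Tp_apply_zero (g i) (hβ i hi) e
    simpa using this hf
  · intro h
    rw [← Finsupp.sum_single f]
    refine Submodule.sum_mem _ fun β hβ => ?_
    have : ∃ i ∈ T, β.1 i ≠ 0 := by
      by_contra hc
      push Not at hc
      exact (Finsupp.mem_support_iff.1 hβ) (h β hc)
    obtain ⟨i, hi, hi0⟩ := this
    refine Submodule.mem_iSup_of_mem i (Submodule.mem_iSup_of_mem hi ?_)
    rw [single_eq_Tp (hg i) hi0]
    exact ⟨_, rfl⟩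

end Fock

section Coaction
variable {N : ℕ} {p : Fin N → ℕ} {A : Type*} [Ring A] [Algebra ℂ A]
  {E : Type*} [Ring E] [Algebra ℂ E]

/-- The coaction of a matrix `Z` on the generators `t` (`κ` is the parity operator). -/
noncomputable def psi (p : Fin N → ℕ) (L : A →ₐ[ℂ] E) (t : Fin N → E) (κ : E)
    (Z : Matrix (Fin N) (Fin N) A) (j : Fin N) : E :=
  ∑ i, t i * (L (Z i j) * κ ^ (p i + p j))

lemma kpow_comm {L : A →ₐ[ℂ] E} {κ : E} (h : ∀ a, L a * κ = κ * L a) (a : A) (n : ℕ) :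
    L a * κ ^ n = κ ^ n * L a := by
  exact (show Commute (L a) κ from h a).pow_right n

lemma kpow_t {t : E} {κ : E} {r : ℕ} (h : κ * t = (-1 : ℂ) ^ r • (t * κ)) (n : ℕ) :
    κ ^ n * t = (-1 : ℂ) ^ (n * r) • (t * κ ^ n) := by
  induction n with
  | zero => simp
  | succ n ih =>
    rw [pow_succ, mul_assoc, h, mul_smul_comm, ← mul_assoc, ih, smul_mul_assoc, smul_smul,
      mul_assoc]
    congr 1; ring

lemma hat_comm {L : A →ₐ[ℂ] E} {t : E} {κ : E} {r : ℕ}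
    (ht : ∀ a, L a * t = t * L a)
    (h : κ * t = (-1 : ℂ) ^ r • (t * κ)) (a : A) (n : ℕ) :
    (L a * κ ^ n) * t = (-1 : ℂ) ^ (n * r) • (t * (L a * κ ^ n)) := by
  rw [mul_assoc, kpow_t h, mul_smul_comm, ← mul_assoc, ht, mul_assoc]

/-- The coaction preserves the quantum superspace relations. -/
lemma psi_rel (hp : ∀ i, p i = 0 ∨ p i = 1) {q : ℂ} (hq : q ≠ 0)
    {L : A →ₐ[ℂ] E} {t : Fin N → E} {κ : E}
    (ht : ∀ i j, t i * t j = cst p q i j • (t j * t i))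
    (hL : ∀ a i, L a * t i = t i * L a) (hκL : ∀ a, L a * κ = κ * L a)
    (hκ : ∀ i, κ * t i = (-1 : ℂ) ^ p i • (t i * κ))
    {Z : Matrix (Fin N) (Fin N) A} (hZ : Rel p q Z) (j l : Fin N) :
    psi p L t κ Z j * psi p L t κ Z l = cst p q j l • (psi p L t κ Z l * psi p L t κ Z j) := by
  have key : ∀ j l, psi p L t κ Z j * psi p L t κ Z l = ∑ i, ∑ k,
      t i * t k * (L ((-1 : ℂ) ^ ((p i + p j) * p k) • (Z i j * Z k l)) *
        κ ^ (p i + p j + p k + p l)) := by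
    intro j l
    unfold psi
    rw [Finset.sum_mul_sum]
    refine Finset.sum_congr rfl fun i _ => Finset.sum_congr rfl fun k _ => ?_
    have h1 := hat_comm (fun a => hL a k) (hκ k) (Z i j) (p i + p j)
    calc t i * (L (Z i j) * κ ^ (p i + p j)) * (t k * (L (Z k l) * κ ^ (p k + p l)))
        = t i * ((L (Z i j) * κ ^ (p i + p j)) * t k) * (L (Z k l) * κ ^ (p k + p l)) := by
          simp only [mul_assoc]
      _ = (-1 : ℂ) ^ ((p i + p j) * p k) • (t i * (t k * (L (Z i j) * κ ^ (p i + p j)))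
            * (L (Z k l) * κ ^ (p k + p l))) := by
          rw [h1, mul_smul_comm, smul_mul_assoc]
      _ = _ := by
          rw [map_smul, map_mul, smul_mul_assoc, mul_smul_comm]
          congr 1
          have h2 := kpow_comm hκL (Z k l) (p i + p j)
          rw [show p i + p j + p k + p l = (p i + p j) + (p k + p l) by ring, pow_add κ (p i + p j)]
          simp only [mul_assoc]
          rw [← mul_assoc (κ ^ (p i + p j)) (L _), ← h2]
          simp only [mul_assoc]
  rw [← sub_eq_zero, key, key, Finset.smul_sum, ← Finset.sum_sub_distrib]
  set F : Fin N → Fin N → E := fun i k => t i * t k *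
    (L ((-1 : ℂ) ^ ((p i + p j) * p k) • (Z i j * Z k l)
        - (cst p q j l * (-1 : ℂ) ^ ((p i + p l) * p k)) • (Z i l * Z k j)) *
        κ ^ (p i + p j + p k + p l)) with hF
  have h1 : ∀ i k, F i k + F k i = 0 := by
    intro i k
    have h := rel_symm_aux hp hq hZ k i j l
    simp only [hF]
    rw [ht i k, show p k + p j + p i + p l = p i + p j + p k + p l by ring, smul_mul_assoc,
      ← mul_smul_comm, ← smul_mul_assoc, ← map_smul, ← mul_add, ← add_mul, ← map_add, add_comm,
      h]
    simp
  have h2 : ∑ i, ∑ k, F i k = 0 := by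
    have h3 : ∑ i, ∑ k, F i k + ∑ i, ∑ k, F i k = 0 := by
      nth_rw 2 [Finset.sum_comm]
      rw [← Finset.sum_add_distrib]
      refine Finset.sum_eq_zero fun i _ => ?_
      rw [← Finset.sum_add_distrib]
      exact Finset.sum_eq_zero fun k _ => h1 i k
    rw [← two_smul ℂ] at h3
    exact (smul_eq_zero.1 h3).resolve_left two_ne_zero
  rw [← h2]
  refine Finset.sum_congr rfl fun i _ => ?_
  rw [Finset.smul_sum, ← Finset.sum_sub_distrib]
  refine Finset.sum_congr rfl fun k _ => ?_
  simp only [hF]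
  rw [map_sub, sub_mul, mul_sub, show p i + p l + p k + p j = p i + p j + p k + p l by ring,
    mul_smul (cst p q j l), map_smul L (cst p q j l), smul_mul_assoc, mul_smul_comm (cst p q j l)]

/-- Composition of hatted matrices. -/
lemma hat_mul_sum {L : A →ₐ[ℂ] E} {κ : E} (hκL : ∀ a, L a * κ = κ * L a) (hκ2 : κ * κ = 1)
    {X Y : Matrix (Fin N) (Fin N) A} (hXY : X * Y = 1) (i b : Fin N) :
    ∑ j, (L (X i j) * κ ^ (p i + p j)) * (L (Y j b) * κ ^ (p j + p b)) = if i = b then 1 else 0 := by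
  have hev : ∀ n, κ ^ (n + n) = 1 := fun n => by rw [← two_mul, pow_mul, pow_two, hκ2, one_pow]
  have : ∀ j, (L (X i j) * κ ^ (p i + p j)) * (L (Y j b) * κ ^ (p j + p b))
      = L (X i j * Y j b) * κ ^ (p i + p b) := by
    intro j
    have h2 := kpow_comm hκL (Y j b) (p i + p j)
    calc _ = L (X i j) * (κ ^ (p i + p j) * L (Y j b)) * κ ^ (p j + p b) := by
          simp only [mul_assoc]
      _ = L (X i j * Y j b) * (κ ^ (p i + p j) * κ ^ (p j + p b)) := by
          rw [← h2, map_mul]; simp only [mul_assoc]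
      _ = _ := by
          rw [← pow_add, show p i + p j + (p j + p b) = (p i + p b) + (p j + p j) by ring,
            pow_add κ (p i + p b), hev, mul_one]
  simp only [this, ← Finset.sum_mul, ← map_sum]
  have h := congrFun (congrFun hXY i) b
  rw [Matrix.mul_apply] at h
  rw [h, Matrix.one_apply]
  by_cases e : i = b
  · subst e; simp [hev]
  · simp [e]

end Coaction

section FockOps
variable {N : ℕ} {p : Fin N → ℕ} {A : Type*} [Ring A] [Algebra ℂ A]

/-- Weights of left multiplication. -/
noncomputable def gL (p : Fin N → ℕ) (q : ℂ) (i j : Fin N) : ℂ := if j < i then cst p q i j else 1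

/-- Weights of (signed) right multiplication. -/
noncomputable def gR (p : Fin N → ℕ) (q : ℂ) (i j : Fin N) : ℂ :=
  (if i < j then cst p q j i else 1) * (-1) ^ (p i * p j)

lemma gL_ne {q : ℂ} (hq : q ≠ 0) (i j : Fin N) : gL p q i j ≠ 0 := by
  unfold gL; split_ifs
  · exact cst_ne_zero p hq i j
  · exact one_ne_zero

lemma gR_ne {q : ℂ} (hq : q ≠ 0) (i j : Fin N) : gR p q i j ≠ 0 := by
  unfold gR; refine mul_ne_zero ?_ (pow_ne_zero _ (by norm_num))
  split_ifs
  · exact cst_ne_zero p hq _ _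
  · exact one_ne_zero

/-- Left multiplication by a generator. -/
noncomputable def Lo (p : Fin N → ℕ) (q : ℂ) (A : Type*) [Ring A] [Algebra ℂ A] (i : Fin N) :
    Module.End ℂ (Fk p A) := Tp A (gL p q i) i

/-- Signed right multiplication by a generator. -/
noncomputable def Ro (p : Fin N → ℕ) (q : ℂ) (A : Type*) [Ring A] [Algebra ℂ A] (i : Fin N) :
    Module.End ℂ (Fk p A) := Tp A (gR p q i) i

/-- The parity operator. -/
noncomputable def Ka (p : Fin N → ℕ) (A : Type*) [Ring A] [Algebra ℂ A] :
    Module.End ℂ (Fk p A) := Dg A fun i => (-1) ^ p i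

lemma cst_self_odd {q : ℂ} {i : Fin N} (h : p i = 1) : cst p q i i = 1 := by
  simp [cst, h, eps_self]

lemma cst_self_even {q : ℂ} {i : Fin N} (h : p i = 0) : cst p q i i = -1 := by
  simp [cst, h, eps_self]

variable (hp : ∀ i, p i = 0 ∨ p i = 1) {q : ℂ} (hq : q ≠ 0)
include hp hq

lemma Lo_Lo (i j : Fin N) : Lo p q A i * Lo p q A j = cst p q i j • (Lo p q A j * Lo p q A i) := by
  apply Tp_comm; intro H
  unfold gL
  rcases lt_trichotomy i j with h | h | h
  · rw [if_neg h.not_gt, if_pos h, cst_mul_cst p hq]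
  · subst h; rw [if_neg (lt_irrefl _), cst_self_odd ((hp i).resolve_left (H rfl)), one_mul]
  · rw [if_pos h, if_neg h.not_gt, mul_one]

lemma Ro_Ro (i j : Fin N) : Ro p q A i * Ro p q A j = cst p q j i • (Ro p q A j * Ro p q A i) := by
  apply Tp_comm; intro H
  unfold gR
  rw [mul_comm (p j)]
  rcases lt_trichotomy i j with h | h | h
  · rw [if_pos h, if_neg h.not_gt]; ring
  · subst h; rw [if_neg (lt_irrefl _), cst_self_odd ((hp i).resolve_left (H rfl)), one_mul, one_mul]
  · rw [if_pos h, if_neg h.not_gt, ← mul_assoc, cst_mul_cst p hq]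

omit hp hq in
lemma Lo_Ro (i j : Fin N) :
    Lo p q A i * Ro p q A j = (-1 : ℂ) ^ (p i * p j) • (Ro p q A j * Lo p q A i) := by
  apply Tp_comm; intro H
  unfold gR gL
  have hs : (-1 : ℂ) ^ (p i * p j) * (-1 : ℂ) ^ (p j * p i) = 1 := by
    rw [mul_comm (p j), ← mul_pow]; simp
  rcases lt_trichotomy i j with h | h | h
  · rw [if_neg h.not_gt]; linear_combination -hs
  · subst h; rw [if_neg (lt_irrefl _), one_mul, hs]
  · rw [if_pos h]; linear_combination (-cst p q i j) * hs

omit hp hq in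
lemma Ka_Lo (i : Fin N) : Ka p A * Lo p q A i = (-1 : ℂ) ^ p i • (Lo p q A i * Ka p A) := Dg_Tp _ _ _

omit hp hq in
lemma Ka_Ro (i : Fin N) : Ka p A * Ro p q A i = (-1 : ℂ) ^ p i • (Ro p q A i * Ka p A) := Dg_Tp _ _ _

omit hp hq in
lemma Ka_sq : (Ka p A) * Ka p A = 1 := Dg_sq fun i => by rw [← mul_pow]; simp

omit hp hq in
lemma lam_Lo (a : A) (i : Fin N) : lam p A a * Lo p q A i = Lo p q A i * lam p A a := lam_Tp _ _ _

omit hp hq in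
lemma lam_Ro (a : A) (i : Fin N) : lam p A a * Ro p q A i = Ro p q A i * lam p A a := lam_Tp _ _ _

omit hp hq in
lemma lam_Ka (a : A) : lam p A a * Ka p A = Ka p A * lam p A a := lam_Dg _ _

omit hp hq in
lemma Lo_zer (i : Fin N) (a : A) :
    Lo p q A i (Finsupp.single zer a) = Finsupp.single (inc i zer) a := by
  simp [Lo, Tp_single, wt, ok_zer, mon_zer]

omit hp hq in
lemma Ro_zer (i : Fin N) (a : A) :
    Ro p q A i (Finsupp.single zer a) = Finsupp.single (inc i zer) a := by
  simp [Ro, Tp_single, wt, ok_zer, mon_zer]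

end FockOps

section Universal
variable {N : ℕ} {p : Fin N → ℕ} {A : Type*} [Ring A] [Algebra ℂ A]
  {E : Type*} [Ring E] [Algebra ℂ E]

/-- The least direction with nonzero exponent. -/
noncomputable def mini (α : Mi p) (h : ∃ i, α.1 i ≠ 0) : Fin N :=
  (univ.filter fun i => α.1 i ≠ 0).min' (by
    obtain ⟨i, hi⟩ := h; exact ⟨i, by simpa using hi⟩)

lemma mini_ne (α : Mi p) (h : ∃ i, α.1 i ≠ 0) : α.1 (mini α h) ≠ 0 := by
  have := Finset.min'_mem (univ.filter fun i => α.1 i ≠ 0) (by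
    obtain ⟨i, hi⟩ := h; exact ⟨i, by simpa using hi⟩)
  exact (Finset.mem_filter.1 this).2

lemma mini_le (α : Mi p) (h : ∃ i, α.1 i ≠ 0) {j : Fin N} (hj : α.1 j ≠ 0) : mini α h ≤ j :=
  Finset.min'_le _ _ (by simpa using hj)

/-- Ordered monomials in a family `t`. -/
noncomputable def mono (t : Fin N → E) (α : Mi p) : E :=
  if h : ∃ i, α.1 i ≠ 0 then t (mini α h) * mono t (dec (mini α h) α) else 1
termination_by deg α
decreasing_by
  have := deg_dec (mini_ne α h)
  omega

omit [Algebra ℂ E] in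
lemma mono_zer (t : Fin N → E) : mono t (zer : Mi p) = 1 := by
  rw [mono, dif_neg]; simp [zer]

omit [Algebra ℂ E] in
lemma mono_min (t : Fin N → E) {α : Mi p} {i : Fin N} (hi : α.1 i ≠ 0)
    (h : ∀ j < i, α.1 j = 0) : mono t α = t i * mono t (dec i α) := by
  have hex : ∃ i, α.1 i ≠ 0 := ⟨i, hi⟩
  have : mini α hex = i := by
    refine le_antisymm (mini_le α hex hi) ?_
    by_contra hc
    exact mini_ne α hex (h _ (not_le.1 hc))
  conv_lhs => rw [mono, dif_pos hex, this]

lemma mul_mono {c : Fin N → Fin N → ℂ} {t : Fin N → E}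
    (ht : ∀ i j, t i * t j = c i j • (t j * t i)) (h0 : ∀ i, p i = 0 → t i * t i = 0)
    (d : Fin N) : ∀ (n : ℕ) (α : Mi p), deg α = n →
      t d * mono t α = wt (fun j => if j < d then c d j else 1) d α • mono t (inc d α) := by
  intro n
  induction n with
  | zero =>
    intro α hα
    have : α = zer := eq_zer fun i => by
      have := Finset.sum_eq_zero_iff.1 hα i (mem_univ i); exact this
    subst this
    rw [mono_zer, mono_min t (α := inc d zer) (i := d), dec_inc (ok_zer d), mono_zer, wt,
      if_pos (ok_zer d), mon_zer, one_smul]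
    · rw [inc_self (ok_zer d)]; omega
    · intro j hj; rw [inc_ne hj.ne]; rfl
  | succ n ih =>
    intro α hα
    by_cases hmin : ∀ j < d, α.1 j = 0
    · by_cases hok : Ok d α
      · rw [mono_min t (α := inc d α) (i := d), dec_inc hok, wt, if_pos hok]
        · have : mon (fun j => if j < d then c d j else 1) α = 1 := by
            refine Finset.prod_eq_one fun j _ => ?_
            by_cases hj : j < d
            · simp [hmin j hj]
            · simp [hj]
          rw [this, one_smul]
        · rw [inc_self hok]; omega
        · intro j hj; rw [inc_ne hj.ne]; exact hmin j hj
      · rw [wt, if_neg hok, zero_smul]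
        unfold Ok at hok; push Not at hok
        rw [mono_min t hok.2 hmin, ← mul_assoc, h0 d hok.1, zero_mul]
    · push Not at hmin
      obtain ⟨j, hjd, hj⟩ := hmin
      have hex : ∃ i, α.1 i ≠ 0 := ⟨j, hj⟩
      set e := mini α hex with he
      have he0 : α.1 e ≠ 0 := mini_ne α hex
      have hed : e < d := (mini_le α hex hj).trans_lt hjd
      have hemin : ∀ j < e, α.1 j = 0 := fun j hje => by
        by_contra hc; exact absurd (mini_le α hex hc) (not_le.2 hje)
      have hdeg := deg_dec he0
      obtain ⟨β, hβ⟩ : ∃ β, β = dec e α := ⟨_, rfl⟩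
      have hαβ : α = inc e β := by rw [hβ, inc_dec he0]
      have hoke : Ok e β := hβ ▸ ok_dec α
      have hokd : Ok d α ↔ Ok d β := by rw [hαβ, ok_inc_ne hed.ne']
      rw [mono_min t he0 hemin, ← hβ, ← mul_assoc, ht d e, smul_mul_assoc, mul_assoc,
        ih β (by rw [hβ]; omega), mul_smul_comm, smul_smul]
      by_cases hok : Ok d α
      · have hok' := hokd.1 hok
        rw [mono_min t (α := inc d α) (i := e)]
        · have : dec e (inc d α) = inc d β := by
            rw [hαβ, inc_comm ((ok_inc_ne hed.ne').1 ((ok_inc_ne hed.ne').2 hok')) hoke,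
              dec_inc ((ok_inc_ne hed.ne).2 hoke)]
          rw [this, wt, if_pos hok', wt, if_pos hok, hαβ, mon_inc _ hoke, if_pos hed]
        · rw [inc_ne hed.ne]; exact he0
        · intro j hj
          rw [inc_ne (hj.trans hed).ne]; exact hemin j hj
      · rw [wt, if_neg (hokd.not.1 hok), wt, if_neg hok]; simp

/-- Induction along raising operators. -/
lemma fock_induction {g : Fin N → Fin N → ℂ} (hg : ∀ i j, g i j ≠ 0) (W : Submodule ℂ (Fk p A))
    (h0 : ∀ a, Finsupp.single zer a ∈ W)
    (hs : ∀ i α, (∀ a, Finsupp.single α a ∈ W) → ∀ a, Tp A (g i) i (Finsupp.single α a) ∈ W)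
    (f : Fk p A) : f ∈ W := by
  have key : ∀ n, ∀ α : Mi p, deg α = n → ∀ a : A, Finsupp.single α a ∈ W := by
    intro n
    induction n with
    | zero =>
      intro α hα a
      have : α = zer := eq_zer fun i => by
        have := Finset.sum_eq_zero_iff.1 hα i (mem_univ i); exact this
      rw [this]; exact h0 a
    | succ n ih =>
      intro α hα a
      have hex : ∃ i, α.1 i ≠ 0 := by
        by_contra hc; push Not at hc
        have : deg α = 0 := Finset.sum_eq_zero fun i _ => hc i
        omega
      obtain ⟨i, hi⟩ := hex
      rw [single_eq_Tp (hg i) hi, map_smul]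
      refine W.smul_mem _ (hs i _ (ih _ ?_) a)
      have := deg_dec hi
      omega
  rw [← Finsupp.sum_single f]
  exact Submodule.sum_mem _ fun β _ => key _ β rfl _

/-- Universal property of the Fock space. -/
lemma exists_lift {g c : Fin N → Fin N → ℂ} (hg : ∀ i j, g i j ≠ 0)
    (hT : ∀ i j, (Tp ℂ (g i) i : Module.End ℂ (Fk p ℂ)) * Tp ℂ (g j) j =
      c i j • (Tp ℂ (g j) j * Tp ℂ (g i) i))
    {X : Type*} [AddCommGroup X] [Module ℂ X] {t : Fin N → Module.End ℂ X}
    (ht : ∀ i j, t i * t j = c i j • (t j * t i)) (h0 : ∀ i, p i = 0 → t i * t i = 0)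
    (v : A →ₗ[ℂ] X) :
    ∃ Θ : Fk p A →ₗ[ℂ] X, (∀ d f, Θ (Tp A (g d) d f) = t d (Θ f)) ∧
      ∀ a, Θ (Finsupp.single zer a) = v a := by
  have hT0 : ∀ i, p i = 0 →
      (Tp ℂ (g i) i : Module.End ℂ (Fk p ℂ)) * Tp ℂ (g i) i = 0 := by
    intro i hi
    apply end_ext; intro α a
    rw [Module.End.mul_apply, Tp_single, map_smul, Tp_single, wt, wt]
    by_cases h : Ok i α
    · have : ¬ Ok i (inc i α) := fun hh => by
        have := hh hi; rw [inc_self h] at this; omega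
      simp [this]
    · simp [h]
  set T : Fin N → Module.End ℂ (Fk p ℂ) := fun i => Tp ℂ (g i) i with hTdef
  have key : ∀ d (α : Mi p), T d (mono T α (Finsupp.single zer 1)) =
      wt (fun j => if j < d then c d j else 1) d α •
        mono T (inc d α) (Finsupp.single zer 1) := by
    intro d α
    have := mul_mono hT hT0 d _ α rfl
    rw [← Module.End.mul_apply, this, LinearMap.smul_apply]
  have hω : ∀ n, ∀ α : Mi p, deg α = n →
      ∃ ω : ℂ, ω ≠ 0 ∧ mono T α (Finsupp.single zer 1) = ω • Finsupp.single α 1 := by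
    intro n
    induction n with
    | zero =>
      intro α hα
      have : α = zer := eq_zer fun i => by
        have := Finset.sum_eq_zero_iff.1 hα i (mem_univ i); exact this
      subst this
      exact ⟨1, one_ne_zero, by simp [mono_zer]⟩
    | succ n ih =>
      intro α hα
      have hex : ∃ i, α.1 i ≠ 0 := by
        by_contra hc; push Not at hc
        have : deg α = 0 := Finset.sum_eq_zero fun i _ => hc i
        omega
      have hdeg := deg_dec (mini_ne α hex)
      obtain ⟨ω, h1, h2⟩ := ih (dec (mini α hex) α) (by omega)
      refine ⟨ω * mon (g (mini α hex)) (dec (mini α hex) α),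
        mul_ne_zero h1 (mon_ne_zero (hg _) _), ?_⟩
      rw [mono, dif_pos hex, Module.End.mul_apply, h2, map_smul, hTdef]
      simp only
      rw [Tp_single, wt, if_pos (ok_dec α), smul_smul, inc_dec (mini_ne α hex)]
  choose ω hω0 hω1 using fun α : Mi p => hω _ α rfl
  have hrec : ∀ d (α : Mi p), wt (g d) d α * ω α =
      wt (fun j => if j < d then c d j else 1) d α * ω (inc d α) := by
    intro d α
    have h := key d α
    rw [hω1, hω1, map_smul, hTdef] at h
    simp only at h
    rw [Tp_single, smul_smul, smul_smul] at h
    have h' := DFunLike.congr_fun h (inc d α)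
    simp only [Finsupp.smul_apply, Finsupp.single_eq_same, smul_eq_mul, mul_one] at h'
    rw [mul_comm, h']
  refine ⟨Finsupp.lsum ℂ fun α => (ω α)⁻¹ • (mono t α ∘ₗ v), ?_, ?_⟩
  · intro d f
    have : (Finsupp.lsum ℂ fun α => (ω α)⁻¹ • (mono t α ∘ₗ v)) ∘ₗ Tp A (g d) d
        = t d ∘ₗ (Finsupp.lsum ℂ fun α => (ω α)⁻¹ • (mono t α ∘ₗ v)) := by
      apply end_ext; intro α a
      simp only [LinearMap.comp_apply, Tp_single, map_smul, Finsupp.lsum_single,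
        LinearMap.smul_apply]
      rw [← Module.End.mul_apply (t d), mul_mono ht h0 d _ α rfl, LinearMap.smul_apply, smul_smul,
        smul_smul]
      congr 1
      have := hrec d α
      field_simp [hω0]
      linear_combination this
    exact LinearMap.congr_fun this f
  · intro a
    have : ω zer = 1 := by
      have h := hω1 zer
      rw [mono_zer] at h
      have h' := DFunLike.congr_fun h zer
      simpa using h'.symm
    simp [this, mono_zer]

end Universal

section Grid
variable {F : Type*} [AddCommGroup F] [Module ℂ F]

lemma grid_step {Q : Submodule ℂ F} {x y : Module.End ℂ F} (hxQ : ∀ e ∈ Q, x e ∈ Q)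
    (hyQ : ∀ e ∈ Q, y e ∈ Q) (hyy : ∀ e, y (y e) = 0) (hxy : ∀ e, y (x e) = x (y e))
    (X : ∀ e, y e ∈ Q → e ∈ Q ⊔ LinearMap.range y) (Y : ∀ e, x e ∈ Q → e ∈ Q) :
    (∀ e, x e ∈ Q ⊔ LinearMap.range y → e ∈ Q ⊔ LinearMap.range y) ∧
    (∀ e, y e ∈ Q ⊔ LinearMap.range x → e ∈ (Q ⊔ LinearMap.range x) ⊔ LinearMap.range y) := by
  constructor
  · intro e he
    obtain ⟨a, ha, _, ⟨g, rfl⟩, h⟩ := Submodule.mem_sup.1 he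
    refine X e (Y _ ?_)
    rw [← hxy, ← h, map_add, hyy, add_zero]
    exact hyQ a ha
  · intro e he
    obtain ⟨a, ha, _, ⟨g, rfl⟩, h⟩ := Submodule.mem_sup.1 he
    have h1 : x (y g) ∈ Q := by
      have h2 : y a + x (y g) = 0 := by rw [← hxy, ← map_add, h, hyy]
      rw [eq_neg_of_add_eq_zero_right h2]
      exact Q.neg_mem (hyQ a ha)
    obtain ⟨b, hb, _, ⟨u, rfl⟩, h3⟩ := Submodule.mem_sup.1 (X g (Y _ h1))
    have h4 : y (e - x u) ∈ Q := by
      have : y (e - x u) = a + x b := by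
        rw [map_sub, ← h, ← h3, map_add, hxy]; abel
      rw [this]; exact Q.add_mem ha (hxQ b hb)
    have h5 := X _ h4
    have h6 : e = (e - x u) + x u := by abel
    rw [h6]
    refine Submodule.add_mem _ ((sup_le_sup_right (le_sup_left (b := LinearMap.range x)) (LinearMap.range y)) h5) ?_
    exact Submodule.mem_sup_left (Submodule.mem_sup_right ⟨u, rfl⟩)

variable {N : ℕ} {p : Fin N → ℕ}

/-- Sum of the ranges of the operators of parity `r` and index below `i`. -/
noncomputable def VX (p : Fin N → ℕ) (r : ℕ) (x : Fin N → Module.End ℂ F) (i : ℕ) :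
    Submodule ℂ F := ⨆ o ∈ {o : Fin N | p o = r ∧ (o : ℕ) < i}, LinearMap.range (x o)

lemma VX_succ {r : ℕ} (x : Fin N → Module.End ℂ F) {i : ℕ} (o : Fin N) (ho : (o : ℕ) = i)
    (h : p o = r) : VX p r x (i + 1) = VX p r x i ⊔ LinearMap.range (x o) := by
  have : {o : Fin N | p o = r ∧ (o : ℕ) < i + 1} =
      insert o {o : Fin N | p o = r ∧ (o : ℕ) < i} := by
    ext t
    simp only [Set.mem_ofPred_eq, Set.mem_insert_iff]
    constructor
    · rintro ⟨h1, h2⟩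
      by_cases e : (t : ℕ) = i
      · left; exact Fin.ext (by omega)
      · right; exact ⟨h1, by omega⟩
    · rintro (rfl | ⟨h1, h2⟩)
      · exact ⟨h, by omega⟩
      · exact ⟨h1, by omega⟩
  unfold VX
  rw [this, _root_.iSup_insert, sup_comm]

lemma VX_succ' {r : ℕ} (x : Fin N → Module.End ℂ F) {i : ℕ}
    (h : ∀ o : Fin N, (o : ℕ) = i → p o ≠ r) : VX p r x (i + 1) = VX p r x i := by
  have : {o : Fin N | p o = r ∧ (o : ℕ) < i + 1} = {o : Fin N | p o = r ∧ (o : ℕ) < i} := by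
    ext t
    simp only [Set.mem_ofPred_eq]
    constructor
    · rintro ⟨h1, h2⟩
      exact ⟨h1, by have := h t; by_contra hc; exact this (by omega) h1⟩
    · rintro ⟨h1, h2⟩; exact ⟨h1, by omega⟩
  unfold VX; rw [this]

lemma VX_zero (r : ℕ) (x : Fin N → Module.End ℂ F) : VX p r x 0 = ⊥ := by simp [VX]

lemma VX_stable {r : ℕ} {x : Fin N → Module.End ℂ F} {i : ℕ} {T : Module.End ℂ F}
    {d : Fin N → ℂ} (h : ∀ o, p o = r → T * x o = d o • (x o * T)) :
    ∀ e ∈ VX p r x i, T e ∈ VX p r x i := by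
  have : VX p r x i ≤ (VX p r x i).comap T := by
    refine iSup₂_le fun o ho => ?_
    rintro _ ⟨e, rfl⟩
    rw [Submodule.mem_comap, ← Module.End.mul_apply, h o ho.1, LinearMap.smul_apply,
      Module.End.mul_apply]
    refine Submodule.smul_mem _ _ ?_
    exact Submodule.mem_iSup_of_mem o (Submodule.mem_iSup_of_mem ho ⟨_, rfl⟩)
  exact this

lemma grid {x y : Fin N → Module.End ℂ F} {c d : Fin N → Fin N → ℂ}
    (hx : ∀ i j, x i * x j = c i j • (x j * x i))
    (hy : ∀ i j, y i * y j = d i j • (y j * y i)) (hyy : ∀ i, p i = 0 → y i * y i = 0)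
    (hxy : ∀ i j, p i = 1 → p j = 0 → y j * x i = x i * y j)
    (hX : ∀ b, p b = 0 → ∀ e, y b e ∈ VX p 0 y b → e ∈ VX p 0 y (b + 1))
    (hY : ∀ o, p o = 1 → ∀ e, x o e ∈ VX p 1 x o → e ∈ VX p 1 x o) (i : ℕ) :
    ∀ b, p b = 0 → ∀ e, y b e ∈ VX p 1 x i ⊔ VX p 0 y b → e ∈ VX p 1 x i ⊔ VX p 0 y (b + 1) := by
  have hxQ : ∀ o, p o = 1 → ∀ i l, ∀ e ∈ VX p 1 x i ⊔ VX p 0 y l,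
      x o e ∈ VX p 1 x i ⊔ VX p 0 y l := by
    intro o ho i l e he
    obtain ⟨a, ha, b, hb, rfl⟩ := Submodule.mem_sup.1 he
    rw [map_add]
    exact Submodule.add_mem_sup (VX_stable (d := fun j => c o j) (fun j _ => hx o j) a ha)
      (VX_stable (d := fun _ => 1) (fun j hj => by rw [one_smul, hxy o j ho hj]) b hb)
  have hyQ : ∀ o, p o = 0 → ∀ i l, ∀ e ∈ VX p 1 x i ⊔ VX p 0 y l,
      y o e ∈ VX p 1 x i ⊔ VX p 0 y l := by
    intro o ho i l e he
    obtain ⟨a, ha, b, hb, rfl⟩ := Submodule.mem_sup.1 he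
    rw [map_add]
    exact Submodule.add_mem_sup
      (VX_stable (d := fun _ => 1) (fun j hj => by rw [one_smul, hxy j o hj ho]) a ha)
      (VX_stable (d := fun j => d o j) (fun j _ => hy o j) b hb)
  induction i with
  | zero =>
    intro b hb e he
    rw [VX_zero, bot_sup_eq] at he ⊢
    exact hX b hb e he
  | succ i ih =>
    by_cases hex : ∃ o : Fin N, (o : ℕ) = i ∧ p o = 1
    · obtain ⟨o, rfl, ho⟩ := hex
      have hYl : ∀ l, ∀ e, x o e ∈ VX p 1 x o ⊔ VX p 0 y l → e ∈ VX p 1 x o ⊔ VX p 0 y l := by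
        intro l
        induction l with
        | zero => rw [VX_zero, sup_bot_eq]; exact hY o ho
        | succ l ihl =>
          by_cases hex' : ∃ b : Fin N, (b : ℕ) = l ∧ p b = 0
          · obtain ⟨b, rfl, hb⟩ := hex'
            rw [VX_succ y b rfl hb, ← sup_assoc]
            refine (grid_step (hxQ o ho o b) (hyQ b hb o b) (fun e => ?_) (fun e => ?_) ?_ ihl).1
            · rw [← Module.End.mul_apply, hyy b hb]; rfl
            · rw [← Module.End.mul_apply, hxy o b ho hb]; rfl
            · intro e he
              have := ih b hb e he
              rwa [VX_succ y b rfl hb, ← sup_assoc] at this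
          · push Not at hex'
            rw [VX_succ' y hex']; exact ihl
      intro b hb e he
      have hs := (grid_step (hxQ o ho o b) (hyQ b hb o b) (fun e => ?_) (fun e => ?_) ?_
        (hYl b)).2 e
      · rw [VX_succ x o rfl ho, VX_succ y b rfl hb]
        rw [VX_succ x o rfl ho] at he
        have h1 := hs (by
          rw [sup_assoc, sup_comm (VX p 0 y _), ← sup_assoc]; exact he)
        have h2 : VX p 1 x o ⊔ LinearMap.range (x o) ⊔ (VX p 0 y b ⊔ LinearMap.range (y b))
          = VX p 1 x o ⊔ VX p 0 y b ⊔ LinearMap.range (x o) ⊔ LinearMap.range (y b) := by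
          rw [← sup_assoc, sup_assoc (VX p 1 x o), sup_comm (LinearMap.range (x o)), ← sup_assoc]
        rw [h2]; exact h1
      · rw [← Module.End.mul_apply, hyy b hb]; rfl
      · rw [← Module.End.mul_apply, hxy o b ho hb]; rfl
      · intro e he
        have := ih b hb e he
        rwa [VX_succ y b rfl hb, ← sup_assoc] at this
    · push Not at hex
      rw [VX_succ' x hex]; exact ih

end Grid

section Star
variable {N : ℕ} {p : Fin N → ℕ} {A : Type*} [Ring A] [Algebra ℂ A]

/-- `f` has no components of degree less than `d`. -/
def SD (d : ℕ) (f : Fk p A) : Prop := ∀ β, deg β < d → f β = 0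

lemma psi_apply {F : Type*} [AddCommGroup F] [Module ℂ F]
    (L : A →ₐ[ℂ] Module.End ℂ F) (t : Fin N → Module.End ℂ F) (κ : Module.End ℂ F)
    (Z : Matrix (Fin N) (Fin N) A) (j : Fin N) (f : F) :
    psi p L t κ Z j f = ∑ i, t i ((L (Z i j) * κ ^ (p i + p j)) f) := by
  simp [psi, LinearMap.sum_apply, Module.End.mul_apply]

lemma Ka_pow_single (n : ℕ) (α : Mi p) : ∃ c : ℂ, ∀ a : A,
    (Ka p A ^ n) (Finsupp.single α a) = c • Finsupp.single α a := by
  induction n with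
  | zero => exact ⟨1, fun a => by simp⟩
  | succ n ih =>
    obtain ⟨c, hc⟩ := ih
    refine ⟨mon (fun i => (-1) ^ p i) α * c, fun a => ?_⟩
    rw [pow_succ, Module.End.mul_apply, Ka, Dg_single, map_smul, ← Ka, hc, smul_smul]

lemma Ka_pow_apply (n : ℕ) (f : Fk p A) (β : Mi p) :
    (Ka p A ^ n) f β = (mon (fun i => (-1) ^ p i) β) ^ n • f β := by
  induction n generalizing f with
  | zero => simp
  | succ n ih =>
    rw [pow_succ, Module.End.mul_apply, ih, Ka, Dg_apply, smul_smul, pow_succ]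

lemma hat_apply (a : A) (n : ℕ) (f : Fk p A) (β : Mi p) :
    (lam p A a * Ka p A ^ n) f β = a * ((mon (fun i => (-1) ^ p i) β) ^ n • f β) := by
  rw [Module.End.mul_apply, lam_apply, Ka_pow_apply]

lemma hat_single (a : A) (n : ℕ) (α : Mi p) : ∃ c : ℂ, ∀ b : A,
    (lam p A a * Ka p A ^ n) (Finsupp.single α b) = Finsupp.single α (c • (a * b)) := by
  obtain ⟨c, hc⟩ := Ka_pow_single (A := A) n α
  refine ⟨c, fun b => ?_⟩
  rw [Module.End.mul_apply, hc, map_smul, lam_single, Finsupp.smul_single]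

lemma hat_zer (a : A) (n : ℕ) (b : A) :
    (lam p A a * Ka p A ^ n) (Finsupp.single zer b) = Finsupp.single zer (a * b) := by
  ext β
  rw [hat_apply]
  by_cases h : β = zer
  · subst h; simp [mon_zer]
  · rw [Finsupp.single_eq_of_ne h, Finsupp.single_eq_of_ne h]; simp

lemma Tp_SD {d : ℕ} {f : Fk p A} (h : SD d f) (g : Fin N → ℂ) (i : Fin N) :
    SD (d + 1) (Tp A g i f) := by
  intro β hβ
  by_cases hi : β.1 i = 0
  · exact Tp_apply_zero g hi f
  · rw [← inc_dec hi, Tp_apply_inc g (ok_dec β), h, smul_zero]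
    have := deg_dec hi; omega

lemma psi_SD {d : ℕ} {f : Fk p A} (h : SD d f) (g : Fin N → Fin N → ℂ)
    (Z : Matrix (Fin N) (Fin N) A) (j : Fin N) :
    SD (d + 1) (psi p (lam p A) (fun i => Tp A (g i) i) (Ka p A) Z j f) := by
  intro β hβ
  rw [psi_apply, Finsupp.finsetSum_apply]
  refine Finset.sum_eq_zero fun i _ => Tp_SD (fun γ hγ => ?_) _ _ β hβ
  rw [hat_apply, h γ hγ]; simp

variable (hp : ∀ i, p i = 0 ∨ p i = 1) {q : ℂ} (hq : q ≠ 0)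
include hp hq

/-- The coaction from the right. -/
noncomputable def chi (p : Fin N → ℕ) (q : ℂ) (U : Matrix (Fin N) (Fin N) A) (d : Fin N) :
    Module.End ℂ (Fk p A) := psi p (lam p A) (Ro p q⁻¹ A) (Ka p A) U d

lemma Ro_Ro' (i j : Fin N) :
    Ro p q⁻¹ A i * Ro p q⁻¹ A j = cst p q i j • (Ro p q⁻¹ A j * Ro p q⁻¹ A i) := by
  rw [← cst_inv p q j i]; exact Ro_Ro hp (inv_ne_zero hq) i j

lemma chi_rel {U : Matrix (Fin N) (Fin N) A} (hU : Rel p q U) (i j : Fin N) :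
    chi p q U i * chi p q U j = cst p q i j • (chi p q U j * chi p q U i) :=
  psi_rel hp hq (Ro_Ro' hp hq) lam_Ro lam_Ka Ka_Ro hU i j

omit hp hq in
lemma sq_of_rel {E : Type*} [Ring E] [Algebra ℂ E] {t : Fin N → E}
    (ht : ∀ i j, t i * t j = cst p q i j • (t j * t i)) (i : Fin N) (h : p i = 0) :
    t i * t i = 0 := by
  have h1 := ht i i
  rw [cst_self_even h, neg_smul, one_smul, eq_neg_iff_add_eq_zero, ← two_smul ℂ] at h1
  exact (smul_eq_zero.1 h1).resolve_left two_ne_zero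

omit hp hq in
lemma chi_Lo (U : Matrix (Fin N) (Fin N) A) (i d : Fin N) :
    chi p q U d * Lo p q⁻¹ A i = (-1 : ℂ) ^ (p i * p d) • (Lo p q⁻¹ A i * chi p q U d) := by
  unfold chi psi
  rw [Finset.sum_mul, Finset.mul_sum, Finset.smul_sum]
  refine Finset.sum_congr rfl fun k _ => ?_
  have h1 := hat_comm (L := lam p A) (t := Lo p q⁻¹ A i) (κ := Ka p A) (r := p i)
    (fun a => lam_Lo a i) (Ka_Lo i) (U k d) (p k + p d)
  have h2 := Lo_Ro (A := A) (p := p) (q := q⁻¹) i k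
  have h3 : Ro p q⁻¹ A k * Lo p q⁻¹ A i =
      (-1 : ℂ) ^ (p i * p k) • (Lo p q⁻¹ A i * Ro p q⁻¹ A k) := by
    rw [h2, smul_smul, ← mul_pow]; simp
  rw [mul_assoc, h1, mul_smul_comm, ← mul_assoc, h3, smul_mul_assoc, smul_smul, mul_assoc]
  congr 1
  rw [add_mul, pow_add, mul_comm (p k) (p i), mul_right_comm, ← mul_pow, mul_comm (p d)]
  simp

lemma exists_theta {Nm U : Matrix (Fin N) (Fin N) A} (hN : Rel p q⁻¹ Nm) (hU : Rel p q U)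
    (h1 : Nm * U = 1) (h2 : U * Nm = 1) :
    ∃ Θ : Fk p A →ₗ[ℂ] Fk p A, Function.Bijective Θ ∧
      ∀ d f, Θ (Ro p q⁻¹ A d f) = chi p q U d (Θ f) := by
  have hq' := inv_ne_zero hq
  obtain ⟨Θ, hΘ, hΘ0⟩ := exists_lift (A := A) (g := gR p q⁻¹) (c := cst p q)
    (fun i j => gR_ne hq' i j) (Ro_Ro' hp hq (A := ℂ)) (chi_rel hp hq hU)
    (fun i h => sq_of_rel (p := p) (q := q) (t := chi p q U) (chi_rel hp hq hU) i h) (Finsupp.lsingle zer)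
  have hψ := psi_rel (L := lam p A) (t := Lo p q⁻¹ A) (κ := Ka p A) hp hq' (Lo_Lo hp hq')
    (fun a i => lam_Lo a i) lam_Ka Ka_Lo hN
  obtain ⟨Θ', hΘ', hΘ'0⟩ := exists_lift (A := A) (g := gL p q⁻¹) (c := cst p q⁻¹)
    (fun i j => gL_ne hq' i j) (Lo_Lo hp hq' (A := ℂ)) hψ
    (fun i h => sq_of_rel (p := p) (q := q⁻¹) hψ i h) (Finsupp.lsingle zer)
  have hΘR : ∀ d f, Θ (Ro p q⁻¹ A d f) = chi p q U d (Θ f) := hΘ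
  have hΘ'L : ∀ d f, Θ' (Lo p q⁻¹ A d f) =
    psi p (lam p A) (Lo p q⁻¹ A) (Ka p A) Nm d (Θ' f) := hΘ'
  have hΘL : ∀ f b, Θ (Lo p q⁻¹ A b f) =
      ∑ i, Lo p q⁻¹ A i (Θ ((lam p A (U i b) * Ka p A ^ (p i + p b)) f)) := by
    intro f
    let W : Submodule ℂ (Fk p A) := ⨅ b, LinearMap.ker (Θ ∘ₗ Lo p q⁻¹ A b -
      ∑ i, Lo p q⁻¹ A i ∘ₗ Θ ∘ₗ (lam p A (U i b) * Ka p A ^ (p i + p b)))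
    have hW : ∀ f, f ∈ W ↔ ∀ b, Θ (Lo p q⁻¹ A b f) =
        ∑ i, Lo p q⁻¹ A i (Θ ((lam p A (U i b) * Ka p A ^ (p i + p b)) f)) := by
      intro f
      simp only [W, Submodule.mem_iInf, LinearMap.mem_ker, LinearMap.sub_apply, sub_eq_zero,
        LinearMap.comp_apply, LinearMap.sum_apply]
    rw [← hW]
    refine fock_induction (fun i j => gR_ne (p := p) hq' i j) W ?_ ?_ f
    · intro a
      rw [hW]
      intro b
      rw [Lo_zer, ← Ro_zer (q := q⁻¹), hΘR, hΘ0, chi, psi_apply]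
      refine Finset.sum_congr rfl fun i _ => ?_
      rw [Finsupp.lsingle_apply, hat_zer, hΘ0, Finsupp.lsingle_apply, Ro_zer, Lo_zer]
    · intro d α hα a
      have hf := (hW _).1 (hα a)
      rw [hW]
      intro b
      set f := Finsupp.single α a
      change Θ (Lo p q⁻¹ A b (Ro p q⁻¹ A d f)) = ∑ i, Lo p q⁻¹ A i (Θ
        ((lam p A (U i b) * Ka p A ^ (p i + p b)) (Ro p q⁻¹ A d f)))
      have e1 : Lo p q⁻¹ A b (Ro p q⁻¹ A d f) =
          (-1 : ℂ) ^ (p b * p d) • Ro p q⁻¹ A d (Lo p q⁻¹ A b f) := by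
        have := LinearMap.congr_fun (Lo_Ro (A := A) (p := p) (q := q⁻¹) b d) f
        exact this
      have e2 : ∀ i g, chi p q U d (Lo p q⁻¹ A i g) =
          (-1 : ℂ) ^ (p i * p d) • Lo p q⁻¹ A i (chi p q U d g) := by
        intro i g
        have := LinearMap.congr_fun (chi_Lo (A := A) (p := p) (q := q) U i d) g
        exact this
      have e3 : ∀ i, (lam p A (U i b) * Ka p A ^ (p i + p b)) (Ro p q⁻¹ A d f) =
          (-1 : ℂ) ^ ((p i + p b) * p d) •
            Ro p q⁻¹ A d ((lam p A (U i b) * Ka p A ^ (p i + p b)) f) := by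
        intro i
        have := LinearMap.congr_fun (hat_comm (L := lam p A) (t := Ro p q⁻¹ A d) (κ := Ka p A)
          (r := p d) (fun a => lam_Ro a d) (Ka_Ro d) (U i b) (p i + p b)) f
        exact this
      rw [e1, map_smul, hΘR, hf, map_sum, Finset.smul_sum]
      refine Finset.sum_congr rfl fun i _ => ?_
      rw [e2, e3, map_smul, map_smul, hΘR, smul_smul]
      congr 1
      rw [← pow_add]; congr 1; ring
  have hΘΘ' : ∀ f, Θ (Θ' f) = f := by
    intro f
    let W : Submodule ℂ (Fk p A) := LinearMap.ker (Θ ∘ₗ Θ' - LinearMap.id)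
    have hW : ∀ f, f ∈ W ↔ Θ (Θ' f) = f := by
      intro f
      simp only [W, LinearMap.mem_ker, LinearMap.sub_apply, sub_eq_zero,
        LinearMap.comp_apply, LinearMap.id_apply]
    rw [← hW]
    refine fock_induction (fun i j => gL_ne (p := p) hq' i j) W ?_ ?_ f
    · intro a
      rw [hW, hΘ'0, Finsupp.lsingle_apply, hΘ0, Finsupp.lsingle_apply]
    · intro b α hα a
      have hf := (hW _).1 (hα a)
      rw [hW]
      change Θ (Θ' (Lo p q⁻¹ A b _)) = Lo p q⁻¹ A b _
      rw [hΘ'L, psi_apply, map_sum]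
      simp only [hΘL]
      rw [Finset.sum_comm]
      have := hat_mul_sum (p := p) (L := lam p A) (κ := Ka p A) lam_Ka Ka_sq h2
      have e : ∀ j, ∑ i, Lo p q⁻¹ A j (Θ ((lam p A (U j i) * Ka p A ^ (p j + p i))
          ((lam p A (Nm i b) * Ka p A ^ (p i + p b)) (Θ' (Finsupp.single α a))))) =
          Lo p q⁻¹ A j (Θ ((if j = b then (1 : Module.End ℂ (Fk p A)) else 0)
            (Θ' (Finsupp.single α a)))) := by
        intro j
        rw [← this j b, LinearMap.sum_apply, map_sum, map_sum]
        rfl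
      simp only [e]
      rw [Finset.sum_eq_single b]
      · rw [if_pos rfl, Module.End.one_apply, hf]
      · intro j _ hj; rw [if_neg hj]; simp
      · simp
  have hΘ'Θ : ∀ f, Θ' (Θ f) = f := by
    intro f
    let W : Submodule ℂ (Fk p A) := LinearMap.ker (Θ' ∘ₗ Θ - LinearMap.id)
    have hW : ∀ f, f ∈ W ↔ Θ' (Θ f) = f := by
      intro f
      simp only [W, LinearMap.mem_ker, LinearMap.sub_apply, sub_eq_zero,
        LinearMap.comp_apply, LinearMap.id_apply]
    rw [← hW]
    refine fock_induction (fun i j => gL_ne (p := p) hq' i j) W ?_ ?_ f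
    · intro a
      rw [hW, hΘ0, Finsupp.lsingle_apply, hΘ'0, Finsupp.lsingle_apply]
    · intro b α hα a
      rw [hW]
      change Θ' (Θ (Lo p q⁻¹ A b _)) = Lo p q⁻¹ A b _
      rw [hΘL, map_sum]
      have e0 : ∀ i, Θ' (Θ ((lam p A (U i b) * Ka p A ^ (p i + p b)) (Finsupp.single α a))) =
          (lam p A (U i b) * Ka p A ^ (p i + p b)) (Finsupp.single α a) := by
        intro i
        obtain ⟨c, hc⟩ := hat_single (p := p) (U i b) (p i + p b) α
        rw [hc]; exact (hW _).1 (hα _)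
      simp only [hΘ'L, e0, psi_apply]
      rw [Finset.sum_comm]
      have := hat_mul_sum (p := p) (L := lam p A) (κ := Ka p A) lam_Ka Ka_sq h1
      have e : ∀ j, ∑ i, Lo p q⁻¹ A j ((lam p A (Nm j i) * Ka p A ^ (p j + p i))
          ((lam p A (U i b) * Ka p A ^ (p i + p b)) ((Finsupp.single α a)))) =
          Lo p q⁻¹ A j ((if j = b then (1 : Module.End ℂ (Fk p A)) else 0)
            ((Finsupp.single α a))) := by
        intro j
        rw [← this j b, LinearMap.sum_apply, map_sum]
        rfl
      simp only [e]
      rw [Finset.sum_eq_single b]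
      · rw [if_pos rfl, Module.End.one_apply]
      · intro j _ hj; rw [if_neg hj]; simp
      · simp
  exact ⟨Θ, ⟨fun x y h => by rw [← hΘ'Θ x, h, hΘ'Θ], fun x => ⟨Θ' x, hΘΘ' x⟩⟩, hΘR⟩

lemma star_grid {Nm U : Matrix (Fin N) (Fin N) A} (hN : Rel p q⁻¹ Nm) (hU : Rel p q U)
    (h1 : Nm * U = 1) (h2 : U * Nm = 1) (b : Fin N) (hb : p b = 0) (e : Fk p A)
    (he : chi p q U b e ∈ VX p 1 (Lo p q⁻¹ A) N ⊔ VX p 0 (chi p q U) b) :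
    e ∈ VX p 1 (Lo p q⁻¹ A) N ⊔ VX p 0 (chi p q U) (b + 1) := by
  have hq' := inv_ne_zero hq
  obtain ⟨Θ, ⟨hinj, hsurj⟩, hΘ⟩ := exists_theta hp hq hN hU h1 h2
  refine grid (p := p) (Lo_Lo hp hq') (chi_rel hp hq hU) (fun i h => sq_of_rel (p := p) (q := q) (t := chi p q U) (chi_rel hp hq hU) i h) ?_ ?_ ?_
    N b hb e he
  · intro i j hi hj
    rw [chi_Lo, hj]; simp
  · have hmap : ∀ l, VX p 0 (chi p q U) l = (VX p 0 (Ro p q⁻¹ A) l).map Θ := by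
      intro l
      unfold VX
      simp only [Submodule.map_iSup]
      refine iSup_congr fun d => iSup_congr fun _ => ?_
      have : chi p q U d ∘ₗ Θ = Θ ∘ₗ Ro p q⁻¹ A d := LinearMap.ext fun f => (hΘ d f).symm
      rw [← LinearMap.range_comp, ← this, LinearMap.range_comp, LinearMap.range_eq_top.2 hsurj,
        Submodule.map_top]
    intro b hb e he
    obtain ⟨e, rfl⟩ := hsurj e
    rw [← hΘ, hmap] at he
    obtain ⟨f, hf, hfe⟩ := he
    have := hinj hfe
    subst this
    rw [hmap]
    refine ⟨e, ?_, rfl⟩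
    refine (mem_iSup_range (fun i j => gR_ne hq' i j) _ e).2 fun β hβ => ?_
    have hβb : β.1 b = 0 := hβ b ⟨hb, Nat.lt_succ_self _⟩
    have hok : Ok b β := fun _ => hβb
    have hf' := (mem_iSup_range (fun i j => gR_ne hq' i j) _ _).1 hf (inc b β) ?_
    · rw [Ro, Tp_apply_inc _ hok] at hf'
      exact (smul_eq_zero.1 hf').resolve_left (mon_ne_zero (gR_ne hq' b) β)
    · rintro i ⟨hi1, hi2⟩
      have hne : i ≠ b := fun h => by rw [h] at hi2; exact lt_irrefl _ hi2
      rw [inc_ne hne]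
      exact hβ i ⟨hi1, hi2.trans (Nat.lt_succ_self _)⟩
  · intro o ho e he
    refine (mem_iSup_range (fun i j => gL_ne hq' i j) _ e).2 fun β hβ => ?_
    have hok : Ok o β := fun h => by omega
    have hf' := (mem_iSup_range (fun i j => gL_ne hq' i j) _ _).1 he (inc o β) ?_
    · rw [Lo, Tp_apply_inc _ hok] at hf'
      exact (smul_eq_zero.1 hf').resolve_left (mon_ne_zero (gL_ne hq' o) β)
    · rintro i ⟨hi1, hi2⟩
      have hne : i ≠ o := fun h => by rw [h] at hi2; exact lt_irrefl _ hi2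
      rw [inc_ne hne]
      exact hβ i ⟨hi1, hi2⟩

lemma star_degree {Nm U : Matrix (Fin N) (Fin N) A} (hN : Rel p q⁻¹ Nm) (hU : Rel p q U)
    (h1 : Nm * U = 1) (h2 : U * Nm = 1) (l : ℕ) : ∀ f : Fk p A,
    SD ((univ.filter fun b : Fin N => p b = 0 ∧ l ≤ (b : ℕ)).card + 1) f →
      f ∈ VX p 1 (Lo p q⁻¹ A) N ⊔ VX p 0 (chi p q U) l := by
  have hq' := inv_ne_zero hq
  induction l with
  | zero =>
    intro f hf
    rw [VX_zero, sup_bot_eq]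
    refine (mem_iSup_range (fun i j => gL_ne hq' i j) _ f).2 fun β hβ => hf β ?_
    rw [Nat.lt_succ_iff, Finset.card_filter]
    refine Finset.sum_le_sum fun i _ => ?_
    rcases hp i with h | h
    · simpa [h] using β.2 i h
    · simp [h, hβ i ⟨h, i.2⟩]
  | succ l ih =>
    intro f hf
    by_cases hex : ∃ b : Fin N, (b : ℕ) = l ∧ p b = 0
    · obtain ⟨b, rfl, hb⟩ := hex
      refine star_grid hp hq hN hU h1 h2 b hb f (ih _ ?_)
      have : (univ.filter fun c : Fin N => p c = 0 ∧ (b : ℕ) ≤ (c : ℕ)) =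
          insert b (univ.filter fun c : Fin N => p c = 0 ∧ (b : ℕ) + 1 ≤ (c : ℕ)) := by
        ext c
        simp only [Finset.mem_filter, Finset.mem_univ, true_and, Finset.mem_insert]
        constructor
        · rintro ⟨hc1, hc2⟩
          by_cases h : c = b
          · exact Or.inl h
          · right; refine ⟨hc1, ?_⟩
            have : (c : ℕ) ≠ b := fun h' => h (Fin.ext h')
            omega
        · rintro (rfl | ⟨hc1, hc2⟩)
          · exact ⟨hb, le_rfl⟩
          · exact ⟨hc1, by omega⟩
      rw [this, Finset.card_insert_of_notMem (by simp)]
      exact psi_SD hf _ U b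
    · push Not at hex
      rw [VX_succ' _ hex]
      refine ih f ?_
      have : (univ.filter fun c : Fin N => p c = 0 ∧ l ≤ (c : ℕ)) =
          (univ.filter fun c : Fin N => p c = 0 ∧ l + 1 ≤ (c : ℕ)) := by
        ext c
        simp only [Finset.mem_filter, Finset.mem_univ, true_and]
        constructor
        · rintro ⟨hc1, hc2⟩
          refine ⟨hc1, ?_⟩
          by_contra h
          exact hex c (by omega) hc1
        · rintro ⟨hc1, hc2⟩; exact ⟨hc1, by omega⟩
      rw [this]; exact hf

/-- The even-even block has a right inverse. -/
lemma star_right_inv {Nm U : Matrix (Fin N) (Fin N) A} (hN : Rel p q⁻¹ Nm) (hU : Rel p q U)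
    (h1 : Nm * U = 1) (h2 : U * Nm = 1) {k : ℕ} (u : Fin k → Fin N) (hu : Function.Injective u)
    (hup : ∀ i, p i = 0 ↔ ∃ a, u a = i) :
    ∃ P : Matrix (Fin k) (Fin k) A, U.submatrix u u * P = 1 := by
  have hu0 : ∀ a, p (u a) = 0 := fun a => (hup _).2 ⟨a, rfl⟩
  have key : ∀ f ∈ VX p 1 (Lo p q⁻¹ A) N ⊔ VX p 0 (chi p q U) N,
      ∃ v : Fin k → A, ∀ i, f (inc (u i) zer) = ∑ j, U (u i) (u j) * v j := by
    let W : Submodule ℂ (Fk p A) :=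
      { carrier := {f | ∃ v : Fin k → A, ∀ i, f (inc (u i) zer) = ∑ j, U (u i) (u j) * v j}
        zero_mem' := ⟨0, by simp⟩
        add_mem' := by
          rintro f g ⟨v, hv⟩ ⟨w, hw⟩
          exact ⟨v + w, fun i => by
            rw [Finsupp.add_apply, hv, hw, ← Finset.sum_add_distrib]
            simp [mul_add]⟩
        smul_mem' := by
          rintro c f ⟨v, hv⟩
          exact ⟨c • v, fun i => by
            rw [Finsupp.smul_apply, hv, Finset.smul_sum]
            simp⟩ }
    have : VX p 1 (Lo p q⁻¹ A) N ⊔ VX p 0 (chi p q U) N ≤ W := by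
      refine sup_le (iSup₂_le fun o ho => ?_) (iSup₂_le fun b hb => ?_)
      · rintro _ ⟨e, rfl⟩
        refine ⟨0, fun i => ?_⟩
        have hne : o ≠ u i := fun h => by
          have h1 := ho.1; rw [h, hu0] at h1; omega
        rw [Lo, Tp_apply_zero]
        · simp
        · rw [inc_ne hne]; rfl
      · rintro _ ⟨e, rfl⟩
        obtain ⟨a, rfl⟩ := (hup b).1 hb.1
        refine ⟨Pi.single a (e zer), fun i => ?_⟩
        rw [chi, psi_apply, Finsupp.finsetSum_apply, Finset.sum_eq_single (u i)]
        · rw [Ro, Tp_apply_inc _ (ok_zer _), hat_apply]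
          simp [mon_zer, Pi.single_apply]
        · intro j _ hj
          rw [Ro, Tp_apply_zero]
          rw [inc_ne hj]; rfl
        · simp
    exact this
  have hmem : ∀ i, ∃ v : Fin k → A, ∀ i',
      (Finsupp.single (inc (u i) zer) (1 : A)) (inc (u i') zer : Mi p) =
        ∑ j, U (u i') (u j) * v j := by
    intro i
    refine key _ (star_degree hp hq hN hU h1 h2 N _ ?_)
    intro β hβ
    have hz : (univ.filter fun b : Fin N => p b = 0 ∧ N ≤ (b : ℕ)) = ∅ :=
      Finset.filter_eq_empty_iff.2 fun b _ h => by have := b.2; omega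
    rw [hz, Finset.card_empty] at hβ
    refine Finsupp.single_eq_of_ne fun h => ?_
    rw [h, deg_inc (ok_zer _)] at hβ; omega
  choose v hv using hmem
  refine ⟨Matrix.of fun j i => v i j, ?_⟩
  ext i' i
  rw [Matrix.mul_apply, Matrix.one_apply]
  simp only [Matrix.submatrix_apply, Matrix.of_apply]
  rw [← hv i i', Finsupp.single_apply]
  by_cases h : i' = i
  · subst h; simp
  · have : inc (u i) (zer : Mi p) ≠ inc (u i') zer := fun e => by
      have := congrArg (fun α : Mi p => α.1 (u i)) e
      rw [inc_self (ok_zer _), inc_ne (fun h' => h (hu h'.symm))] at this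
      change 0 + 1 = 0 at this
      omega
    simp [h, this]

end Star

section Sorting
variable {k : ℕ} {E : Type*} [Ring E] [Algebra ℂ E]

/-- The `q`-exterior relations. -/
def QRel (q : ℂ) (t : Fin k → E) : Prop :=
  (∀ i j, i < j → t j * t i = (-q⁻¹) • (t i * t j)) ∧ ∀ i, t i * t i = 0

lemma QRel.comp {q : ℂ} {t : Fin k → E} (ht : QRel q t) {r : ℕ} {u : Fin r → Fin k}
    (hu : StrictMono u) : QRel q (t ∘ u) :=
  ⟨fun _ _ h => ht.1 _ _ (hu h), fun _ => ht.2 _⟩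

lemma QRel.of_cst {p : Fin k → ℕ} {q : ℂ} {t : Fin k → E}
    (ht : ∀ i j, t i * t j = cst p q i j • (t j * t i)) {r : ℕ} {u : Fin r → Fin k}
    (hu : StrictMono u) (hp : ∀ a, p (u a) = 0) : QRel q (t ∘ u) := by
  refine ⟨fun i j h => ?_, fun i => sq_of_rel ht _ (hp i)⟩
  simp only [Function.comp]
  rw [ht, cst, hp, hp, eps_of_lt (hu h)]
  simp

/-- Number of inversions of a list. -/
def linv : List (Fin k) → ℕ
  | [] => 0
  | a :: l => l.countP (· < a) + linv l

lemma mul_prod_mem {q : ℂ} (hq : q ≠ 0) {t : Fin k → E} (ht : QRel q t) (a : Fin k)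
    (l : List (Fin k)) (h : a ∈ l) : t a * (l.map t).prod = 0 := by
  induction l with
  | nil => simp at h
  | cons b l ih =>
    rw [List.map_cons, List.prod_cons, ← mul_assoc]
    by_cases hab : a = b
    · subst hab; rw [ht.2, zero_mul]
    · have hl : a ∈ l := (List.mem_cons.1 h).resolve_left hab
      rcases lt_or_gt_of_ne hab with h' | h'
      · have h1 := ht.1 _ _ h'
        have h2 : t a * t b = (-q) • (t b * t a) := by
          rw [h1, smul_smul]; field_simp; simp
        rw [h2, smul_mul_assoc, mul_assoc, ih hl, mul_zero, smul_zero]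
      · rw [ht.1 _ _ h', smul_mul_assoc, mul_assoc, ih hl, mul_zero, smul_zero]

lemma prod_not_nodup {q : ℂ} (hq : q ≠ 0) {t : Fin k → E} (ht : QRel q t) (l : List (Fin k))
    (h : ¬ l.Nodup) : (l.map t).prod = 0 := by
  induction l with
  | nil => simp at h
  | cons b l ih =>
    rw [List.map_cons, List.prod_cons]
    by_cases hb : b ∈ l
    · exact mul_prod_mem hq ht b l hb
    · rw [ih (fun h' => h (List.nodup_cons.2 ⟨hb, h'⟩)), mul_zero]

lemma mul_prod_sorted {q : ℂ} {t : Fin k → E} (ht : QRel q t) (a : Fin k)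
    (l : List (Fin k)) (h : a ∉ l) (hl : l.Pairwise (· ≤ ·)) :
    t a * (l.map t).prod =
      (-q⁻¹) ^ l.countP (· < a) • ((l.orderedInsert (· ≤ ·) a).map t).prod := by
  induction l with
  | nil => simp
  | cons b l ih =>
    rw [List.mem_cons, not_or] at h
    rw [List.pairwise_cons] at hl
    rcases lt_or_gt_of_ne h.1 with h' | h'
    · rw [List.orderedInsert_cons, if_pos h'.le, List.countP_eq_zero.2, pow_zero, one_smul]
      · simp
      · intro c hc
        simp only [decide_eq_true_eq, not_lt]
        rcases List.mem_cons.1 hc with rfl | hc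
        · exact h'.le
        · exact h'.le.trans (hl.1 c hc)
    · rw [List.orderedInsert_cons, if_neg h'.not_ge, List.countP_cons_of_pos (by simpa using h'),
        List.map_cons, List.prod_cons, List.map_cons, List.prod_cons, ← mul_assoc, ht.1 _ _ h',
        smul_mul_assoc, mul_assoc, ih h.2 hl.2, mul_smul_comm, smul_smul, pow_succ, mul_comm]

lemma prod_sort {q : ℂ} {t : Fin k → E} (ht : QRel q t) (l : List (Fin k)) (h : l.Nodup) :
    (l.map t).prod = (-q⁻¹) ^ linv l • ((l.insertionSort (· ≤ ·)).map t).prod := by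
  induction l with
  | nil => simp [linv]
  | cons b l ih =>
    rw [List.nodup_cons] at h
    rw [List.map_cons, List.prod_cons, ih h.2, mul_smul_comm, mul_prod_sorted ht, smul_smul, linv,
      List.insertionSort_cons, (List.perm_insertionSort (· ≤ ·) l).countP_eq, ← pow_add, add_comm]
    · rw [(List.perm_insertionSort (· ≤ ·) l).mem_iff]; exact h.1
    · exact List.pairwise_insertionSort (· ≤ ·) l

lemma prod_sort_eq {q : ℂ} {t : Fin k → E} (ht : QRel q t) {l l' : List (Fin k)} (h : l.Nodup)
    (hl : l.Perm l') (h' : l'.Pairwise (· ≤ ·)) :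
    (l.map t).prod = (-q⁻¹) ^ linv l • (l'.map t).prod := by
  rw [prod_sort ht l h]
  have : l.insertionSort (· ≤ ·) = l' :=
    ((List.perm_insertionSort (· ≤ ·) l).trans hl).eq_of_pairwise
      (fun a b _ _ h1 h2 => le_antisymm h1 h2)
      (List.pairwise_insertionSort (· ≤ ·) l) h'
  rw [this]

/-- Number of inversions of a function. -/
def finv {r : ℕ} (g : Fin r → Fin k) : ℕ :=
  (univ.filter fun p : Fin r × Fin r => p.1 < p.2 ∧ g p.2 < g p.1).card

lemma linv_ofFn {r : ℕ} (g : Fin r → Fin k) : linv (List.ofFn g) = finv g := by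
  induction r with
  | zero => simp [linv, finv]
  | succ r ih =>
    rw [List.ofFn_succ, linv, ih]
    unfold finv
    rw [Finset.card_filter, Finset.card_filter, Fintype.sum_prod_type, Fintype.sum_prod_type,
      Fin.sum_univ_succ]
    congr 1
    · rw [Fin.sum_univ_succ]
      simp only [lt_irrefl, false_and, if_false, zero_add, Fin.succ_pos, true_and]
      rw [List.countP_eq_length_filter, ← Finset.card_filter, List.ofFn_eq_map, List.filter_map,
        List.length_map]
      rw [← List.toFinset_card_of_nodup ((List.nodup_finRange _).filter _)]
      congr 1
      ext x; simp
    · refine Finset.sum_congr rfl fun i _ => ?_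
      rw [Fin.sum_univ_succ]
      simp

lemma finv_perm {r : ℕ} (σ : Equiv.Perm (Fin r)) : finv (⇑σ) = invCount σ := rfl

/-- Ordered product of a finite family. -/
noncomputable def fprod {r : ℕ} (t : Fin r → E) : E := (List.ofFn t).prod

omit [Algebra ℂ E] in
lemma fprod_succ {r : ℕ} (t : Fin (r + 1) → E) :
    fprod t = t 0 * fprod (fun i => t i.succ) := by
  simp [fprod, List.ofFn_succ]

omit [Algebra ℂ E] in
lemma fprod_zero (t : Fin 0 → E) : fprod t = 1 := by simp [fprod]

omit [Algebra ℂ E] in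
lemma fprod_comp {r : ℕ} (t : Fin k → E) (g : Fin r → Fin k) :
    fprod (t ∘ g) = ((List.ofFn g).map t).prod := by
  rw [List.map_ofFn]; rfl

lemma fprod_not_injective {q : ℂ} (hq : q ≠ 0) {t : Fin k → E} (ht : QRel q t) {r : ℕ}
    {g : Fin r → Fin k} (hg : ¬ Function.Injective g) : fprod (t ∘ g) = 0 := by
  rw [fprod_comp]
  exact prod_not_nodup hq ht _ (by rwa [List.nodup_ofFn])

lemma fprod_perm {q : ℂ} {r : ℕ} {t : Fin r → E} (ht : QRel q t) (σ : Equiv.Perm (Fin r)) :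
    fprod (t ∘ σ) = (-q⁻¹) ^ invCount σ • fprod t := by
  rw [fprod_comp, prod_sort_eq ht (l' := List.ofFn id) (by rw [List.nodup_ofFn]; exact σ.injective),
    linv_ofFn, finv_perm, ← fprod_comp]
  · rfl
  · refine (List.perm_ext_iff_of_nodup ?_ ?_).2 fun a => ?_
    · rw [List.nodup_ofFn]; exact σ.injective
    · rw [List.nodup_ofFn]; exact Function.injective_id
    · simp only [List.mem_ofFn]; exact ⟨fun _ => ⟨a, rfl⟩, fun _ => σ.surjective a⟩
  · rw [List.pairwise_ofFn]; intro i j h; exact h.le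

lemma sum_injective_range {r : ℕ} {X : Type*} [AddCommMonoid X] (F : (Fin r → Fin k) → X)
    (u : Fin r → Fin k) (hu : Function.Injective u)
    (hF : ∀ g, ¬ (Function.Injective g ∧ ∀ i, g i ∈ Set.range u) → F g = 0) :
    ∑ g, F g = ∑ σ : Equiv.Perm (Fin r), F (u ∘ σ) := by
  symm
  refine Finset.sum_of_injOn (fun σ : Equiv.Perm (Fin r) => u ∘ σ) ?_ (by simp) ?_ (by simp)
  · intro σ _ τ _ h
    exact Equiv.ext fun i => hu (congrFun h i)
  · intro g _ hg
    refine hF g fun ⟨h1, h2⟩ => hg ?_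
    choose f hf using h2
    have hfi : Function.Injective f := fun a b h => h1 (by rw [← hf a, ← hf b, h])
    refine ⟨Equiv.ofBijective f (Finite.injective_iff_bijective.1 hfi), by simp, ?_⟩
    funext i; exact hf i

end Sorting

section Expand
variable {A : Type*} [Ring A] [Algebra ℂ A] {E : Type*} [Ring E] [Algebra ℂ E]
  {L : A →ₐ[ℂ] E}

omit [Algebra ℂ E] in
lemma fprod_comm {r : ℕ} {t : Fin r → E} {x : E} (h : ∀ i, x * t i = t i * x) :
    x * fprod t = fprod t * x := by
  refine (Commute.list_prod_right (List.ofFn t) x fun y hy => ?_ : Commute x (fprod t))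
  obtain ⟨i, rfl⟩ := (List.mem_ofFn' _ _).1 hy
  exact h i

/-- Expansion of a product of linear combinations, coefficients collected in order. -/
lemma fprod_expand {r k : ℕ} {t : Fin k → E} (ht : ∀ a i, L a * t i = t i * L a)
    (X : Fin k → Fin r → A) :
    fprod (fun j => ∑ a, t a * L (X a j)) =
      ∑ g : Fin r → Fin k, fprod (t ∘ g) * L (fprod fun j => X (g j) j) := by
  induction r with
  | zero => simp [fprod_zero]
  | succ r ih =>
    rw [fprod_succ, ih (fun a j => X a j.succ), ← (Fin.consEquiv fun _ => Fin k).sum_comp,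
      Fintype.sum_prod_type, Finset.sum_mul_sum]
    refine Finset.sum_congr rfl fun a _ => Finset.sum_congr rfl fun g _ => ?_
    rw [fprod_succ, fprod_succ, map_mul]
    simp only [Fin.consEquiv_apply, Function.comp, Fin.cons_zero, Fin.cons_succ]
    have := fprod_comm (x := L (X a 0)) (t := t ∘ g) (fun i => ht _ _)
    rw [mul_assoc, ← mul_assoc (L _), this]
    simp only [mul_assoc, Function.comp_def]

/-- Expansion of a product of linear combinations, coefficients collected in reverse order. -/
lemma fprod_expand_rev {r k : ℕ} {t : Fin k → E} {x : Fin r → E}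
    (hx : ∀ a i, L a * x i = x i * L a) (X : Fin k → Fin r → A)
    (hxt : ∀ j, x j = ∑ a, t a * L (X a j)) :
    fprod x = ∑ g : Fin r → Fin k,
      fprod (t ∘ g) * L (fprod fun j => MulOpposite.op (X (g j) j)).unop := by
  induction r with
  | zero => simp [fprod_zero]
  | succ r ih =>
    rw [fprod_succ, hxt 0, ← (Fin.consEquiv fun _ => Fin k).sum_comp,
      Fintype.sum_prod_type, Finset.sum_mul]
    refine Finset.sum_congr rfl fun a _ => ?_
    rw [mul_assoc, fprod_comm (fun i => hx _ i.succ),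
      ih (fun a i => hx a i.succ) (fun a j => X a j.succ) (fun j => hxt j.succ), Finset.sum_mul,
      Finset.mul_sum]
    refine Finset.sum_congr rfl fun g _ => ?_
    rw [fprod_succ, fprod_succ, MulOpposite.unop_mul, map_mul]
    simp only [Fin.consEquiv_apply, Function.comp_def, Fin.cons_zero, Fin.cons_succ,
      MulOpposite.unop_op, mul_assoc]

lemma detq_eq {q : ℂ} {r : ℕ} (G : Matrix (Fin r) (Fin r) A) :
    detq q G = ∑ σ : Equiv.Perm (Fin r), (-q⁻¹) ^ invCount σ • fprod fun i => G (σ i) i := by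
  unfold detq fprod
  refine Finset.sum_congr rfl fun σ _ => ?_
  congr 1
  rw [zpow_neg, zpow_natCast, ← inv_pow, neg_inv]

/-- The quantum determinant as a coefficient, in the presence of an absorbing factor. -/
lemma fprod_det_mul {q : ℂ} {r k : ℕ} {t : Fin k → E} (ht : ∀ a i, L a * t i = t i * L a)
    (hQ : QRel q t) (u : Fin r → Fin k) (hu : StrictMono u) (G : Matrix (Fin k) (Fin r) A) (T : E)
    (hT : ∀ a, L a * T = T * L a)
    (h0 : ∀ g : Fin r → Fin k, ¬ (Function.Injective g ∧ ∀ i, g i ∈ Set.range u) →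
      fprod (t ∘ g) * T = 0) :
    fprod (fun j => ∑ a, t a * L (G a j)) * T =
      fprod (t ∘ u) * T * L (detq q (G.submatrix u id)) := by
  rw [fprod_expand ht (fun a j => G a j), Finset.sum_mul, sum_injective_range _ u hu.injective, detq_eq, map_sum,
    Finset.mul_sum]
  · refine Finset.sum_congr rfl fun σ _ => ?_
    rw [map_smul, mul_assoc, hT, ← mul_assoc, ← Function.comp_assoc, fprod_perm (hQ.comp hu),
      smul_mul_assoc, smul_mul_assoc, mul_smul_comm]
    rfl
  · intro g hg
    rw [mul_assoc, hT, ← mul_assoc, h0 g hg, zero_mul]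

lemma fprod_det {q : ℂ} (hq : q ≠ 0) {r : ℕ} {t : Fin r → E} (ht : ∀ a i, L a * t i = t i * L a)
    (hQ : QRel q t) (G : Matrix (Fin r) (Fin r) A) :
    fprod (fun j => ∑ a, t a * L (G a j)) = fprod t * L (detq q G) := by
  have := fprod_det_mul ht hQ id strictMono_id G 1 (by simp) (fun g hg => by
    rw [mul_one]; refine fprod_not_injective hq hQ fun h => hg ⟨h, fun i => ⟨_, rfl⟩⟩)
  simpa using this

lemma fprod_det_rev {q : ℂ} (hq : q ≠ 0) {r : ℕ} {t x : Fin r → E}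
    (hx : ∀ a i, L a * x i = x i * L a)
    (hQ : QRel q t) (P : Matrix (Fin r) (Fin r) A)
    (hxt : ∀ j, x j = ∑ a, t a * L (P a j)) :
    fprod x = fprod t * L (detq q (P.map MulOpposite.op)).unop := by
  rw [fprod_expand_rev hx (fun a j => P a j) hxt, sum_injective_range _ id Function.injective_id, detq_eq,
    ← MulOpposite.coe_opLinearEquiv_symm ℂ, map_sum, map_sum, Finset.mul_sum]
  · refine Finset.sum_congr rfl fun σ _ => ?_
    rw [map_smul, map_smul, Function.id_comp, fprod_perm hQ, smul_mul_assoc, mul_smul_comm]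
    rfl
  · intro g hg
    rw [fprod_not_injective hq hQ fun h => hg ⟨h, fun i => ⟨_, rfl⟩⟩, zero_mul]

end Expand

section Ind
variable {N : ℕ} {p : Fin N → ℕ} {A : Type*} [Ring A] [Algebra ℂ A]

/-- The exponent of a square-free monomial. -/
def ind (s : Finset (Fin N)) : Mi p := ⟨fun i => if i ∈ s then 1 else 0, fun i _ => by
  beta_reduce; split_ifs <;> simp⟩

lemma ind_empty : (ind ∅ : Mi p) = zer := eq_zer fun i => by simp [ind]

lemma inc_ind {s : Finset (Fin N)} {i : Fin N} (h : i ∉ s) :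
    inc i (ind s : Mi p) = ind (insert i s) := by
  have hok : Ok i (ind s : Mi p) := fun _ => by simp [ind, h]
  apply Subtype.ext; funext j
  by_cases hj : j = i
  · subst hj; rw [inc_self hok]; simp [ind, h]
  · rw [inc_ne hj]; simp [ind, hj]

lemma prod_Tp_single {g : Fin N → Fin N → ℂ} (hg : ∀ i j, g i j ≠ 0) (l : List (Fin N))
    (hl : l.Nodup) : ∃ c : ℂ, c ≠ 0 ∧ ∀ a : A,
      (l.map fun i => (Tp A (g i) i : Module.End ℂ (Fk p A))).prod (Finsupp.single zer a) =
        c • Finsupp.single (ind l.toFinset) a := by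
  induction l with
  | nil => exact ⟨1, one_ne_zero, fun a => by simp [ind_empty]⟩
  | cons i l ih =>
    rw [List.nodup_cons] at hl
    obtain ⟨c, hc, h⟩ := ih hl.2
    have hi : i ∉ l.toFinset := by simpa using hl.1
    have hok : Ok i (ind l.toFinset : Mi p) := fun _ => by
      simp only [ind, if_neg hi]
    refine ⟨c * mon (g i) (ind l.toFinset : Mi p), mul_ne_zero hc (mon_ne_zero (hg i) _),
      fun a => ?_⟩
    rw [List.map_cons, List.prod_cons, Module.End.mul_apply, h, map_smul, Tp_single, wt,
      if_pos hok, inc_ind hi, smul_smul, List.toFinset_cons]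

lemma fprod_Tp_single {g : Fin N → Fin N → ℂ} (hg : ∀ i j, g i j ≠ 0) {r : ℕ} {u : Fin r → Fin N}
    (hu : Function.Injective u) : ∃ c : ℂ, c ≠ 0 ∧ ∀ a : A,
      fprod (fun j => (Tp A (g (u j)) (u j) : Module.End ℂ (Fk p A))) (Finsupp.single zer a) =
        c • Finsupp.single (ind (univ.image u)) a := by
  obtain ⟨c, hc, h⟩ := prod_Tp_single (p := p) (A := A) hg (List.ofFn u)
    (by rwa [List.nodup_ofFn])
  refine ⟨c, hc, fun a => ?_⟩
  have h1 := fprod_comp (fun i => (Tp A (g i) i : Module.End ℂ (Fk p A))) u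
  have h2 : (List.ofFn u).toFinset = univ.image u := by ext; simp [List.mem_ofFn]
  rw [← h2, ← h a, ← h1]; rfl

end Ind

section Cancel
variable {N : ℕ} {p : Fin N → ℕ} {A : Type*} [Ring A] [Algebra ℂ A]

lemma VX_mono {F : Type*} [AddCommGroup F] [Module ℂ F] (r : ℕ) (x : Fin N → Module.End ℂ F)
    {i j : ℕ} (h : i ≤ j) : VX p r x i ≤ VX p r x j :=
  biSup_mono fun _ ⟨h1, h2⟩ => ⟨h1, h2.trans_le h⟩

lemma VX_le {F : Type*} [AddCommGroup F] [Module ℂ F] (r : ℕ) (x : Fin N → Module.End ℂ F)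
    (i : ℕ) : VX p r x i ≤ VX p r x N :=
  biSup_mono fun o ⟨h1, _⟩ => ⟨h1, o.2⟩

variable (hp : ∀ i, p i = 0 ∨ p i = 1) {q : ℂ} (hq : q ≠ 0)
include hp hq

lemma star_peel {Nm U : Matrix (Fin N) (Fin N) A} (hN : Rel p q⁻¹ Nm) (hU : Rel p q U)
    (h1 : Nm * U = 1) (h2 : U * Nm = 1) {r : ℕ} (l : ℕ) (w : Fin r → Fin N) (hw : StrictMono w)
    (hw0 : ∀ i, p (w i) = 0) (hl : ∀ i, l ≤ (w i : ℕ)) (e : Fk p A)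
    (he : fprod (chi p q U ∘ w) e ∈ VX p 1 (Lo p q⁻¹ A) N ⊔ VX p 0 (chi p q U) l) :
    e ∈ VX p 1 (Lo p q⁻¹ A) N ⊔ VX p 0 (chi p q U) N := by
  induction r generalizing l with
  | zero =>
    rw [fprod_zero] at he
    exact (sup_le_sup le_rfl (VX_le (p := p) 0 (chi p q U) l) :
      VX p 1 (Lo p q⁻¹ A) N ⊔ _ ≤ _) he
  | succ r ih =>
    rw [fprod_succ, Module.End.mul_apply] at he
    refine ih ((w 0 : ℕ) + 1) (fun i => w i.succ) (hw.comp (Fin.strictMono_succ))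
      (fun i => hw0 _) (fun i => hw (Fin.succ_pos i)) ?_
    exact star_grid hp hq hN hU h1 h2 (w 0) (hw0 0) _
      ((sup_le_sup le_rfl (VX_mono (p := p) 0 (chi p q U) (hl 0)) :
        VX p 1 (Lo p q⁻¹ A) N ⊔ _ ≤ _) he)

lemma star_cancel {Nm U : Matrix (Fin N) (Fin N) A} (hN : Rel p q⁻¹ Nm) (hU : Rel p q U)
    (h1 : Nm * U = 1) (h2 : U * Nm = 1) {k : ℕ} (u : Fin k → Fin N) (hu : StrictMono u)
    (hup : ∀ i, p i = 0 ↔ ∃ a, u a = i) (v : A) (hv : detq q (U.submatrix u u) * v = 0) :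
    v = 0 := by
  have hq' := inv_ne_zero hq
  have hu0 : ∀ a, p (u a) = 0 := fun a => (hup _).2 ⟨a, rfl⟩
  set S := VX p 1 (Lo p q⁻¹ A) N with hS
  have hmemS : ∀ f, f ∈ S ↔ ∀ β : Mi p, (∀ i, p i = 1 → β.1 i = 0) → f β = 0 := by
    intro f
    refine (mem_iSup_range (fun i j => gL_ne (p := p) hq' i j) _ f).trans ?_
    refine forall_congr' fun β => imp_congr_left ?_
    exact ⟨fun h i hi => h i ⟨hi, i.2⟩, fun h i hi => h i hi.1⟩
  have hRodd : ∀ i, p i = 1 → ∀ f : Fk p A, Ro p q⁻¹ A i f ∈ S := by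
    intro i hi f
    rw [hmemS]
    intro β hβ
    exact Tp_apply_zero _ (hβ i hi) f
  have hχS : ∀ j, ∀ f ∈ S, chi p q U j f ∈ S := by
    intro j f hf
    have : S ≤ S.comap (chi p q U j) := by
      conv_lhs => rw [hS]
      refine iSup₂_le fun o ho => ?_
      rintro _ ⟨e, rfl⟩
      have h := LinearMap.congr_fun (chi_Lo (A := A) (p := p) (q := q) U o j) e
      rw [Submodule.mem_comap]
      change chi p q U j (Lo p q⁻¹ A o e) = (-1 : ℂ) ^ (p o * p j) •
        Lo p q⁻¹ A o (chi p q U j e) at h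
      rw [h]
      exact S.smul_mem _ (Submodule.mem_iSup_of_mem o (Submodule.mem_iSup_of_mem ho ⟨_, rfl⟩))
    exact this hf
  let x : Fin k → Module.End ℂ (Fk p A) := fun j =>
    ∑ a, (Ro p q⁻¹ A ∘ u) a * lam p A (U.submatrix u u a j)
  have hχx : ∀ j f, chi p q U (u j) f - x j f ∈ S := by
    intro j f
    have h1 : x j f = ∑ i ∈ univ.image u, Ro p q⁻¹ A i ((lam p A (U i (u j)) *
        Ka p A ^ (p i + p (u j))) f) := by
      rw [Finset.sum_image (fun a _ b _ h => hu.injective h)]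
      simp [x, LinearMap.sum_apply, hu0]
    have h2 : chi p q U (u j) f = ∑ i, Ro p q⁻¹ A i ((lam p A (U i (u j)) *
        Ka p A ^ (p i + p (u j))) f) := by
      rw [chi, psi_apply]
    rw [h1, h2, ← Finset.sum_add_sum_compl (univ.image u), add_sub_cancel_left]
    refine S.sum_mem fun i hi => hRodd i ((hp i).resolve_left fun h0 => ?_) _
    obtain ⟨a, ha⟩ := (hup i).1 h0
    simp [← ha] at hi
  have hprod : ∀ (r : ℕ) (w : Fin r → Fin k) f,
      fprod (fun j => chi p q U (u (w j))) f - fprod (fun j => x (w j)) f ∈ S := by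
    intro r
    induction r with
    | zero => intro w f; simp [fprod_zero]
    | succ r ih =>
      intro w f
      rw [fprod_succ, fprod_succ, Module.End.mul_apply, Module.End.mul_apply]
      have h1 := hχS (u (w 0)) _ (ih (fun j => w j.succ) f)
      have h2 := hχx (w 0) (fprod (fun j => x (w j.succ)) f)
      have h3 := S.add_mem h1 h2
      rw [map_sub] at h3
      simpa using h3
  have hQ : QRel q (Ro p q⁻¹ A ∘ u) := QRel.of_cst (Ro_Ro' hp hq) hu hu0
  have hdet := fprod_det (L := lam p A) hq (t := Ro p q⁻¹ A ∘ u) (fun a i => lam_Ro a (u i)) hQ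
    (U.submatrix u u)
  have hx0 : fprod (fun j => x j) (Finsupp.single zer v) = 0 := by
    rw [show (fun j => x j) = fun j => ∑ a, (Ro p q⁻¹ A ∘ u) a * lam p A (U.submatrix u u a j)
      from rfl, hdet, Module.End.mul_apply, lam_single, hv]
    simp
  have h0 := hprod k id (Finsupp.single zer v)
  simp only [id] at h0
  rw [hx0, sub_zero] at h0
  have hin := star_peel hp hq hN hU h1 h2 0 u hu hu0 (fun i => Nat.zero_le _) _
    (Submodule.mem_sup_left h0)
  have hz : S ⊔ VX p 0 (chi p q U) N ≤ LinearMap.ker (Finsupp.lapply (R := ℂ) (M := A) (zer : Mi p)) := by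
    refine sup_le (iSup₂_le fun o ho => ?_) (iSup₂_le fun b hb => ?_)
    · rintro _ ⟨e, rfl⟩
      exact Tp_apply_zero _ rfl e
    · rintro _ ⟨e, rfl⟩
      rw [LinearMap.mem_ker, Finsupp.lapply_apply, chi, psi_apply, Finsupp.finsetSum_apply]
      exact Finset.sum_eq_zero fun i _ => Tp_apply_zero _ rfl _
  simpa using hz hin

end Cancel

lemma eps_comp {k N : ℕ} {u : Fin k → Fin N} (hu : StrictMono u) (i j : Fin k) :
    eps (u i) (u j) = eps i j := by
  rcases lt_trichotomy i j with h | h | h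
  · rw [eps_of_lt h, eps_of_lt (hu h)]
  · rw [h, eps_self, eps_self]
  · rw [eps_of_gt h, eps_of_gt (hu h)]

lemma Rel.submatrix {B : Type*} [Ring B] [Algebra ℂ B] {N k : ℕ} {p : Fin N → ℕ} {q : ℂ}
    {M : Matrix (Fin N) (Fin N) B} (hM : Rel p q M) {u : Fin k → Fin N} (hu : StrictMono u) :
    Rel (fun i => p (u i)) q (M.submatrix u u) := by
  intro i j k l
  have := hM (u i) (u j) (u k) (u l)
  simpa only [eps_comp hu, Matrix.submatrix_apply] using this

lemma Rel.submatrix_even {B : Type*} [Ring B] [Algebra ℂ B] {N k : ℕ} {p : Fin N → ℕ} {q : ℂ}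
    {M : Matrix (Fin N) (Fin N) B} (hM : Rel p q M) {u : Fin k → Fin N} (hu : StrictMono u)
    (h0 : ∀ i, p (u i) = 0) : Rel (fun _ => 0) q (M.submatrix u u) := by
  have := hM.submatrix hu
  simpa only [h0] using this

section Even
variable {k : ℕ} {A : Type*} [Ring A] [Algebra ℂ A] {E : Type*} [Ring E] [Algebra ℂ E]
  {L : A →ₐ[ℂ] E} {q : ℂ}

lemma QRel.cst (hq : q ≠ 0) {t : Fin k → E} (ht : QRel q t) (i j : Fin k) :
    t i * t j = cst (fun _ => 0) q i j • (t j * t i) := by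
  unfold QSM.cst
  rcases lt_trichotomy i j with h | h | h
  · rw [ht.1 _ _ h, eps_of_gt h, smul_smul]
    simp [hq]
  · subst h; simp [ht.2]
  · rw [ht.1 _ _ h, eps_of_lt h]
    simp

/-- The coaction of a matrix on an exterior family. -/
noncomputable def co {r : ℕ} (L : A →ₐ[ℂ] E) (t : Fin r → E) (G : Matrix (Fin r) (Fin k) A)
    (j : Fin k) : E := ∑ a, t a * L (G a j)

lemma co_rel (hq : q ≠ 0) {t : Fin k → E} (ht : QRel q t) (hL : ∀ a i, L a * t i = t i * L a)
    {G : Matrix (Fin k) (Fin k) A} (hG : Rel (fun _ => 0) q G) : QRel q (co L t G) := by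
  have h := psi_rel (p := fun _ => 0) (L := L) (t := t) (κ := 1) (fun _ => Or.inl rfl) hq
    (ht.cst hq) hL (by simp) (by simp) hG
  have h1 : psi (fun _ => 0) L t 1 G = co L t G := by
    funext j; simp [psi, co]
  rw [h1] at h
  exact QRel.of_cst h strictMono_id (fun _ => rfl)

lemma co_inv {t : Fin k → E} {G P : Matrix (Fin k) (Fin k) A} (h : G * P = 1) (j : Fin k) :
    t j = ∑ b, co L t G b * L (P b j) := by
  simp only [co, Finset.sum_mul, mul_assoc, ← map_mul]
  rw [Finset.sum_comm]
  simp only [← Finset.mul_sum, ← map_sum]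
  have h1 : ∀ a, ∑ b, G a b * P b j = (1 : Matrix (Fin k) (Fin k) A) a j := fun a => by
    rw [← h, Matrix.mul_apply]
  simp [h1, Matrix.one_apply]

/-- A free exterior model: generators of the `q`-exterior algebra commuting with a copy of `A`,
with free top product. -/
structure IsModel (q : ℂ) (L : A →ₐ[ℂ] E) (t : Fin k → E) : Prop where
  rel : QRel q t
  comm : ∀ a i, L a * t i = t i * L a
  top : ∀ a, fprod t * L a = 0 → a = 0

lemma exists_model.{u} {A : Type u} [Ring A] [Algebra ℂ A] (k : ℕ) {q : ℂ} (hq : q ≠ 0) :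
    ∃ (E : Type u) (_ : Ring E) (_ : Algebra ℂ E) (L : A →ₐ[ℂ] E) (t : Fin k → E),
      IsModel q L t := by
  refine ⟨Module.End ℂ (Fk (fun _ : Fin k => 0) A), inferInstance, inferInstance,
    lam (fun _ => 0) A, Lo (fun _ => 0) q A, ?_, fun a i => lam_Lo a i, fun a h => ?_⟩
  · exact QRel.of_cst (E := Module.End ℂ (Fk (fun _ : Fin k => 0) A)) (p := fun _ : Fin k => 0)
      (Lo_Lo (p := fun _ : Fin k => 0) (A := A) (fun _ => Or.inl rfl) hq) strictMono_id (fun _ => rfl)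
  · obtain ⟨c, hc, h1⟩ := fprod_Tp_single (p := fun _ : Fin k => 0) (A := A)
      (g := gL (fun _ => 0) q) (fun i j => gL_ne hq i j) (u := id) Function.injective_id
    have h2 := LinearMap.congr_fun h (Finsupp.single zer 1)
    rw [Module.End.mul_apply, lam_single, mul_one] at h2
    have h3 := h1 a
    change fprod (Lo (fun _ : Fin k => 0) q A) (Finsupp.single zer a) = _ at h3
    rw [h2] at h3
    have h4 := (smul_eq_zero.1 h3.symm).resolve_left hc
    exact Finsupp.single_eq_zero.1 h4

lemma IsModel.top_eq {t : Fin k → E} (h : IsModel q L t) {a b : A}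
    (hab : fprod t * L a = fprod t * L b) : a = b := by
  rw [← sub_eq_zero]
  refine h.top _ ?_
  rw [map_sub, mul_sub, hab, sub_self]

lemma IsModel.co_top (hq : q ≠ 0) {t : Fin k → E} (h : IsModel q L t)
    (G : Matrix (Fin k) (Fin k) A) :
    fprod (co L t G) = fprod t * L (detq q G) :=
  fprod_det hq h.comm h.rel G

lemma IsModel.co_rel (hq : q ≠ 0) {t : Fin k → E} (h : IsModel q L t)
    {G : Matrix (Fin k) (Fin k) A} (hG : Rel (fun _ => 0) q G) : QRel q (co L t G) :=
  QSM.co_rel hq h.rel h.comm hG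

/-- The determinant of a right invertible matrix is right invertible. -/
lemma det_mul_det (hq : q ≠ 0) {G P : Matrix (Fin k) (Fin k) A} (hG : Rel (fun _ => 0) q G)
    (h : G * P = 1) : detq q G * (detq q (P.map MulOpposite.op)).unop = 1 := by
  obtain ⟨E, _, _, L, t, hm⟩ := exists_model (A := A) k hq
  have h1 := fprod_det_rev (L := L) hq (t := co L t G)
    (x := t) hm.comm (hm.co_rel hq hG) P (co_inv h)
  rw [hm.co_top hq, mul_assoc, ← map_mul] at h1
  refine hm.top_eq ?_
  rw [← h1, map_one, mul_one]

lemma finv_rev {r : ℕ} (σ : Equiv.Perm (Fin r)) :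
    invCount ((Fin.revPerm.trans σ).trans Fin.revPerm) = invCount σ := by
  unfold invCount
  refine Finset.card_bij (fun x _ => (Fin.rev x.2, Fin.rev x.1)) ?_ ?_ ?_
  · rintro ⟨a, b⟩ h
    simpa [Fin.rev_lt_rev] using h
  · rintro ⟨a, b⟩ _ ⟨c, d⟩ _ h
    simpa [and_comm] using h
  · rintro ⟨a, b⟩ h
    exact ⟨(Fin.rev b, Fin.rev a), by simpa [Fin.rev_lt_rev] using h, by simp⟩

lemma QRel.rev (hq : q ≠ 0) {t : Fin k → E} (ht : QRel q t) : QRel q⁻¹ (t ∘ Fin.rev) := by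
  refine ⟨fun i j h => ?_, fun i => ht.2 _⟩
  have := ht.1 _ _ (Fin.rev_lt_rev.2 h)
  simp only [Function.comp, inv_inv]
  rw [this, smul_smul]
  simp [hq]

lemma detq_rev (hq : q ≠ 0) {G : Matrix (Fin k) (Fin k) A} (hG : Rel (fun _ => 0) q G) :
    detq q⁻¹ (G.submatrix Fin.rev Fin.rev) = detq q G := by
  have hc : (-q⁻¹) ^ invCount (Fin.revPerm : Equiv.Perm (Fin k)) ≠ 0 :=
    pow_ne_zero _ (neg_ne_zero.2 (inv_ne_zero hq))
  obtain ⟨E, _, _, L, t, hm⟩ := exists_model (A := A) k hq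
  have h1 := fprod_det (L := L) (inv_ne_zero hq) (t := t ∘ Fin.rev)
    (fun a i => hm.comm a _) (hm.rel.rev hq) (G.submatrix Fin.rev Fin.rev)
  have h2 : (fun j => ∑ a, (t ∘ Fin.rev) a *
      L (G.submatrix Fin.rev Fin.rev a j)) =
      co L t G ∘ (Fin.revPerm : Equiv.Perm (Fin k)) := by
    funext j
    simp only [co, Function.comp, Matrix.submatrix_apply, Fin.revPerm_apply]
    exact Equiv.sum_comp Fin.revPerm fun a => t a * L (G a j.rev)
  rw [h2, fprod_perm (hm.co_rel hq hG), hm.co_top hq] at h1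
  have h3 := fprod_perm hm.rel Fin.revPerm
  have h4 : fprod (t ∘ Fin.rev) = fprod (t ∘ (Fin.revPerm : Equiv.Perm _)) := rfl
  rw [h4, h3, smul_mul_assoc] at h1
  exact (hm.top_eq (smul_right_injective _ hc h1)).symm

omit [Algebra ℂ A] in
lemma unop_fprod {r : ℕ} (f : Fin r → A) :
    (fprod fun i => MulOpposite.op (f i)).unop = fprod (f ∘ Fin.rev) := by
  unfold fprod
  rw [MulOpposite.unop_list_prod, List.map_ofFn]
  have : (List.ofFn (MulOpposite.unop ∘ fun i => MulOpposite.op (f i))).reverse =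
      List.ofFn (f ∘ Fin.rev) := by
    refine List.ext_getElem (by simp) fun i h1 h2 => ?_
    simp only [List.getElem_reverse, List.getElem_ofFn, Function.comp, MulOpposite.unop_op]
    congr 1
    ext
    simp [Fin.rev]
    omega
  rw [this]

lemma detq_op_rev (q : ℂ) (G : Matrix (Fin k) (Fin k) A) :
    (detq q (G.map MulOpposite.op)).unop = detq q (G.submatrix Fin.rev Fin.rev) := by
  rw [detq_eq, detq_eq, ← MulOpposite.coe_opLinearEquiv_symm ℂ, map_sum]
  let e : Equiv.Perm (Fin k) ≃ Equiv.Perm (Fin k) :=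
    { toFun := fun σ => (Fin.revPerm.trans σ).trans Fin.revPerm
      invFun := fun σ => (Fin.revPerm.trans σ).trans Fin.revPerm
      left_inv := fun σ => by ext; simp
      right_inv := fun σ => by ext; simp }
  refine Fintype.sum_equiv e _ _ fun σ => ?_
  rw [map_smul, MulOpposite.coe_opLinearEquiv_symm]
  change _ = (-q⁻¹) ^ invCount ((Fin.revPerm.trans σ).trans Fin.revPerm) • _
  rw [finv_rev]
  congr 1
  simp only [Matrix.map_apply]
  rw [unop_fprod]
  congr 1
  funext i
  simp [e]

lemma detq_op (hq : q ≠ 0) {G : Matrix (Fin k) (Fin k) A} (hG : Rel (fun _ => 0) q G) :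
    (detq q⁻¹ (G.map MulOpposite.op)).unop = detq q G := by
  rw [← detq_rev hq hG, detq_op_rev]

end Even

section Even
variable {k : ℕ} {A : Type*} [Ring A] [Algebra ℂ A] {E : Type*} [Ring E] [Algebra ℂ E]
  {L : A →ₐ[ℂ] E} {q : ℂ}
variable {G P : Matrix (Fin k) (Fin k) A}

/-- Freeness of the top product of the coaction. -/
lemma IsModel.co_list_top (hq : q ≠ 0) {t : Fin k → E} (hm : IsModel q L t) (hG : Rel (fun _ => 0) q G)
    (hc : ∀ v, detq q G * v = 0 → v = 0) (l : List (Fin k)) (hl : l.Nodup) (hl' : ∀ i, i ∈ l)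
    {x : A} (h : (l.map (co L t G)).prod * L x = 0) : x = 0 := by
  rw [prod_sort_eq (l' := List.ofFn id) (hm.co_rel hq hG) hl, smul_mul_assoc,
    ← fprod_comp, Function.comp_id, hm.co_top hq, mul_assoc, ← map_mul] at h
  · exact hc _ (hm.top _ ((smul_eq_zero.1 h).resolve_left
      (pow_ne_zero _ (neg_ne_zero.2 (inv_ne_zero hq)))))
  · refine (List.perm_ext_iff_of_nodup hl ?_).2 fun a => ?_
    · rw [List.nodup_ofFn]; exact Function.injective_id
    · simp only [List.mem_ofFn]; exact ⟨fun _ => ⟨a, rfl⟩, fun _ => hl' a⟩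
  · rw [List.pairwise_ofFn]; intro i j h; exact h.le

lemma rel_of_inv (hq : q ≠ 0) (hG : Rel (fun _ => 0) q G)
    (hc : ∀ v, detq q G * v = 0 → v = 0) (h : G * P = 1) : Rel (fun _ => 0) q⁻¹ P := by
  obtain ⟨E, _, _, L, t, hm⟩ := exists_model (A := A) k hq
  set ψ := co L t G with hψ
  have hψr : QRel q ψ := hm.co_rel hq hG
  have h2 : ∀ c d, t c * t d =
      ∑ a, ∑ b, ψ a * ψ b * L (P b d * P a c) := by
    intro c d
    conv_lhs => rw [co_inv (L := L) (t := t) h c]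
    rw [Finset.sum_mul]
    refine Finset.sum_congr rfl fun a _ => ?_
    rw [mul_assoc, hm.comm, co_inv (L := L) (t := t) h d, Finset.sum_mul,
      Finset.mul_sum]
    refine Finset.sum_congr rfl fun b _ => ?_
    rw [map_mul]; simp only [mul_assoc, hψ]
  have key : ∀ c d a b, a ≠ b → P b d * P a c - QSM.cst (fun _ => 0) q c d • (P b c * P a d) +
      QSM.cst (fun _ => 0) q b a • (P a d * P b c - QSM.cst (fun _ => 0) q c d • (P a c * P b d))
      = 0 := by
    intro c d a₀ b₀ hab
    set l := (List.finRange k).filter (fun i => i ≠ a₀ ∧ i ≠ b₀) with hl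
    have hmem : ∀ i, i ∈ l ↔ i ≠ a₀ ∧ i ≠ b₀ := fun i => by simp [hl]
    have hnd : l.Nodup := (List.nodup_finRange _).filter _
    have hz : ∀ a b, ¬ ((a = a₀ ∧ b = b₀) ∨ (a = b₀ ∧ b = a₀)) →
        (l.map ψ).prod * (ψ a * ψ b) = 0 := by
      intro a b hn
      have : (l.map ψ).prod * (ψ a * ψ b) = ((l ++ [a, b]).map ψ).prod := by simp
      rw [this]
      refine prod_not_nodup hq hψr _ fun hnd' => hn ?_
      rw [List.nodup_append'] at hnd'
      obtain ⟨-, h4, h5⟩ := hnd'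
      have ha : ¬ (a ≠ a₀ ∧ a ≠ b₀) := fun hh => h5 ((hmem a).2 hh) (by simp)
      have hb : ¬ (b ≠ a₀ ∧ b ≠ b₀) := fun hh => h5 ((hmem b).2 hh) (by simp)
      have hne : a ≠ b := by simpa using h4
      grind
    have hrel := hm.rel.cst hq c d
    rw [h2, h2, ← sub_eq_zero, Finset.smul_sum, ← Finset.sum_sub_distrib] at hrel
    set X : Fin k → Fin k → A := fun a b => P b d * P a c -
      QSM.cst (fun _ => 0) q c d • (P b c * P a d) with hX
    have hrel' : ∑ a, ∑ b, ψ a * ψ b * L (X a b) = 0 := by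
      rw [← hrel]
      refine Finset.sum_congr rfl fun a _ => ?_
      rw [Finset.smul_sum, ← Finset.sum_sub_distrib]
      refine Finset.sum_congr rfl fun b _ => ?_
      rw [hX, map_sub, map_smul, mul_sub, mul_smul_comm]
    have h3 := congrArg (fun y => (l.map ψ).prod * y) hrel'
    simp only [mul_zero, Finset.mul_sum, ← mul_assoc] at h3
    rw [← Fintype.sum_prod_type' (f := fun a b => (l.map ψ).prod * ψ a * ψ b * L (X a b)),
      ← Finset.sum_subset (Finset.subset_univ {(a₀, b₀), (b₀, a₀)}), Finset.sum_pair] at h3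
    · refine hm.co_list_top hq hG hc (l ++ [a₀, b₀]) ?_ ?_ ?_
      · rw [List.nodup_append']
        refine ⟨hnd, by simpa using hab, fun x hx hx' => ?_⟩
        have := (hmem x).1 hx
        simp at hx'; tauto
      · intro i; rw [List.mem_append, hmem]; simp; tauto
      · rw [List.map_append, List.prod_append, ← hψ]
        have h4 := hψr.cst hq b₀ a₀
        simp only [mul_assoc] at h3
        simp only [List.map_cons, List.map_nil, List.prod_cons, List.prod_nil, mul_one]
        rw [← mul_assoc (ψ b₀), h4, smul_mul_assoc] at h3
        rw [map_add, map_smul]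
        change (l.map ψ).prod * (ψ a₀ * ψ b₀) * (L (X a₀ b₀) +
          QSM.cst (fun _ => 0) q b₀ a₀ • L (X b₀ a₀)) = 0
        rw [← h3]
        simp only [mul_add, mul_smul_comm, mul_assoc]
    · simp [hab]
    · rintro ⟨a, b⟩ _ hn
      rw [mul_assoc (l.map ψ).prod, hz a b, zero_mul]
      simpa [Prod.ext_iff] using hn
  intro i j k' l
  simp only [mul_zero, add_zero, pow_zero, mul_one, inv_zpow', zpow_neg]
  by_cases hik : i = k'
  · subst hik; simp [eps_self]
  · have := key l j k' i (Ne.symm hik)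
    unfold QSM.cst at this
    rw [eps_neg i k', eps_neg l j, ← zpow_neg, ← zpow_neg, ← zpow_neg]
    simp only [neg_neg, neg_add_rev, mul_zero, pow_zero, one_mul] at this ⊢
    rw [zpow_add₀ hq]
    rw [← sub_eq_zero, ← this]
    module


end Even

section Even
variable {k : ℕ} {A : Type*} [Ring A] [Algebra ℂ A] {E : Type*} [Ring E] [Algebra ℂ E]
  {L : A →ₐ[ℂ] E} {q : ℂ}
variable {G P : Matrix (Fin k) (Fin k) A}

lemma col_cancel (hq : q ≠ 0) (hG : Rel (fun _ => 0) q G)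
    (hc : ∀ v, detq q G * v = 0 → v = 0) (h : G * P = 1) (z : Fin k → A)
    (hz : ∀ b, ∑ a, G a b * z a = 0) : z = 0 := by
  obtain _ | r := k
  · exact Subsingleton.elim _ _
  obtain ⟨E, _, _, L, t, hm⟩ := exists_model (A := A) (r + 1) hq
  set ψ := co L t G with hψ
  have hψr : QRel q ψ := hm.co_rel hq hG
  have hmc : ∀ a, ∃ c : ℂ, c ≠ 0 ∧ ∀ t : Fin (r + 1) → E,
      QRel q t → t a * fprod (t ∘ a.succAbove) = c • fprod t := by
    intro a
    refine ⟨(-q⁻¹) ^ linv (a :: List.ofFn a.succAbove),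
      pow_ne_zero _ (neg_ne_zero.2 (inv_ne_zero hq)), fun t ht => ?_⟩
    have hnd : (a :: List.ofFn a.succAbove).Nodup := by
      rw [List.nodup_cons, List.nodup_ofFn, List.mem_ofFn]
      exact ⟨fun ⟨i, hi⟩ => Fin.succAbove_ne a i hi, Fin.succAbove_right_injective⟩
    rw [fprod_comp, ← List.prod_cons, ← List.map_cons,
      prod_sort_eq ht (l' := List.ofFn id) hnd, ← fprod_comp, Function.comp_id]
    · refine (List.perm_ext_iff_of_nodup hnd ?_).2 fun b => ?_
      · rw [List.nodup_ofFn]; exact Function.injective_id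
      · simp only [List.mem_cons, List.mem_ofFn]
        refine ⟨fun _ => ⟨b, rfl⟩, fun _ => ?_⟩
        by_cases hb : b = a
        · exact Or.inl hb
        · exact Or.inr (Fin.exists_succAbove_eq hb)
    · rw [List.pairwise_ofFn]; intro i j h; exact h.le
  choose c hc0 hcm using hmc
  set e : E :=
    ∑ a, (c a)⁻¹ • (fprod (t ∘ a.succAbove) * L (z a)) with he
  have hmix : ∀ a b, b ≠ a → ∀ t : Fin (r + 1) → E,
      QRel q t → t b * fprod (t ∘ a.succAbove) = 0 := by
    intro a b hb t ht
    rw [fprod_comp]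
    refine mul_prod_mem hq ht _ _ ?_
    rw [List.mem_ofFn]; exact Fin.exists_succAbove_eq hb
  have hLe : ∀ a, t a * e = fprod (t) * L (z a) := by
    intro a
    rw [he, Finset.mul_sum, Finset.sum_eq_single a]
    · rw [mul_smul_comm, ← mul_assoc, hcm a _ hm.rel, smul_mul_assoc, smul_smul,
        inv_mul_cancel₀ (hc0 a), one_smul]
    · intro b _ hb
      rw [mul_smul_comm, ← mul_assoc, hmix b a hb.symm _ hm.rel, zero_mul, smul_zero]
    · simp
  have hψe : ∀ b, ψ b * e = 0 := by
    intro b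
    have h1 : ∀ a, t a * L (G a b) * e =
        fprod (t) * L (G a b * z a) := by
      intro a
      rw [← hm.comm, mul_assoc, hLe, ← mul_assoc, fprod_comm (fun i => hm.comm _ i), mul_assoc,
        map_mul]
    rw [hψ, co, Finset.sum_mul, Finset.sum_congr rfl fun a _ => h1 a, ← Finset.mul_sum, ← map_sum,
      hz, map_zero, mul_zero]
  have hW : ∃ w : Fin (r + 1) → A, e = ∑ b, fprod (ψ ∘ b.succAbove) * L (w b) := by
    let W : Submodule ℂ (E) :=
      { carrier := {x | ∃ w : Fin (r + 1) → A, x = ∑ b, fprod (ψ ∘ b.succAbove) * L (w b)}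
        zero_mem' := ⟨0, by simp⟩
        add_mem' := by
          rintro _ _ ⟨v, rfl⟩ ⟨w, rfl⟩
          exact ⟨v + w, by simp [mul_add, Finset.sum_add_distrib]⟩
        smul_mem' := by
          rintro s _ ⟨v, rfl⟩
          exact ⟨s • v, by simp [Finset.smul_sum]⟩ }
    change e ∈ W
    rw [he]
    refine W.sum_mem fun a _ => W.smul_mem _ ?_
    rw [fprod_expand_rev (t := ψ) (x := t ∘ a.succAbove) (L := L)
      (fun a i => hm.comm a _) (fun b j => P b (a.succAbove j)) (fun j => co_inv h _),
      Finset.sum_mul]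
    refine W.sum_mem fun g _ => ?_
    rw [mul_assoc, ← map_mul]
    by_cases hg : Function.Injective g
    · obtain ⟨b, hb⟩ : ∃ b, ∀ i, g i ≠ b := by
        by_contra hcon
        push Not at hcon
        have := Fintype.card_le_of_surjective g hcon
        simp at this
      have hnd : (List.ofFn g).Nodup := by rwa [List.nodup_ofFn]
      rw [fprod_comp, prod_sort_eq hψr (l' := List.ofFn b.succAbove) hnd, ← fprod_comp,
        smul_mul_assoc]
      · refine W.smul_mem _ ((fun x => ⟨Pi.single b x, ?_⟩ :
          ∀ x, fprod (ψ ∘ b.succAbove) * L x ∈ W) _)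
        rw [Finset.sum_eq_single b]
        · rw [Pi.single_eq_same]
        · intro b' _ hb'; rw [Pi.single_eq_of_ne hb']; simp
        · simp
      · refine (List.subperm_of_subset hnd fun x hx => ?_).perm_of_length_le (by simp)
        rw [List.mem_ofFn] at hx ⊢
        obtain ⟨i, rfl⟩ := hx
        exact Fin.exists_succAbove_eq (hb i)
      · rw [List.pairwise_ofFn]; intro i j hij
        exact ((Fin.strictMono_succAbove b) hij).le
    · rw [fprod_not_injective hq hψr hg, zero_mul]
      exact W.zero_mem
  obtain ⟨w, hw⟩ := hW
  have hw0 : ∀ b, w b = 0 := by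
    intro b
    have h1 := hψe b
    rw [hw, Finset.mul_sum, Finset.sum_eq_single b] at h1
    · rw [← mul_assoc, hcm b _ hψr, smul_mul_assoc, hψ, hm.co_top hq, mul_assoc, ← map_mul] at h1
      exact hc _ (hm.top _ ((smul_eq_zero.1 h1).resolve_left (hc0 b)))
    · intro b' _ hb'
      rw [← mul_assoc, hmix b' b hb'.symm _ hψr, zero_mul]
    · simp
  have he0 : e = 0 := by rw [hw]; simp [hw0]
  funext a
  refine hm.top _ ?_
  rw [← hLe, he0, mul_zero]

end Even

section Even
variable {k : ℕ} {A : Type*} [Ring A] [Algebra ℂ A] {E : Type*} [Ring E] [Algebra ℂ E]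
  {L : A →ₐ[ℂ] E} {q : ℂ}

/-- The reversed quantum determinant as a coefficient, in the presence of an absorbing factor. -/
lemma mul_fprod_det_rev {r : ℕ} {t : Fin k → E} {x : Fin r → E}
    (hx : ∀ a i, L a * x i = x i * L a) (hQ : QRel q t) (v : Fin r → Fin k) (hv : StrictMono v)
    (P : Matrix (Fin k) (Fin r) A) (hxt : ∀ j, x j = ∑ a, t a * L (P a j)) (T : E)
    (h0 : ∀ g : Fin r → Fin k, ¬ (Function.Injective g ∧ ∀ i, g i ∈ Set.range v) →
      T * fprod (t ∘ g) = 0) :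
    T * fprod x =
      T * fprod (t ∘ v) * L (detq q ((P.submatrix v id).map MulOpposite.op)).unop := by
  rw [fprod_expand_rev hx (fun a j => P a j) hxt, Finset.mul_sum,
    sum_injective_range _ v hv.injective, detq_eq,
    ← MulOpposite.coe_opLinearEquiv_symm ℂ, map_sum, map_sum, Finset.mul_sum]
  · refine Finset.sum_congr rfl fun σ _ => ?_
    rw [map_smul, map_smul, ← Function.comp_assoc, fprod_perm (hQ.comp hv), smul_mul_assoc,
      mul_smul_comm, mul_smul_comm, mul_assoc]
    rfl
  · intro g hg
    rw [← mul_assoc, h0 g hg, zero_mul]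

/-- Expansion of a product of left linear combinations. -/
lemma fprod_expand_left {r k : ℕ} {t : Fin k → E} {x : Fin r → E}
    (hx : ∀ a i, L a * x i = x i * L a) (X : Fin r → Fin k → A)
    (hxt : ∀ j, x j = ∑ a, L (X j a) * t a) :
    fprod x = ∑ g : Fin r → Fin k,
      L (fprod fun j => MulOpposite.op (X j (g j))).unop * fprod (t ∘ g) := by
  induction r with
  | zero => simp [fprod_zero]
  | succ r ih =>
    rw [fprod_succ, ih (fun a i => hx a i.succ) (fun j a => X j.succ a) (fun j => hxt j.succ),
      Finset.mul_sum, ← (Fin.consEquiv fun _ => Fin k).sum_comp,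
      Fintype.sum_prod_type, Finset.sum_comm]
    refine Finset.sum_congr rfl fun g _ => ?_
    rw [← mul_assoc, ← hx, mul_assoc, hxt 0, Finset.sum_mul, Finset.mul_sum]
    refine Finset.sum_congr rfl fun a _ => ?_
    rw [fprod_succ, fprod_succ, MulOpposite.unop_mul, map_mul]
    simp only [Fin.consEquiv_apply, Function.comp_def, Fin.cons_zero, Fin.cons_succ,
      MulOpposite.unop_op, mul_assoc]

/-- Merging two complementary ordered products into the full one. -/
lemma exists_merge (hq : q ≠ 0) {r s : ℕ} {u : Fin r → Fin k} {v : Fin s → Fin k}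
    (hu : Function.Injective u) (hv : Function.Injective v) (huv : ∀ a b, u a ≠ v b)
    (hc : ∀ i, (∃ a, u a = i) ∨ ∃ b, v b = i) :
    ∃ c : ℂ, c ≠ 0 ∧ ∀ t : Fin k → E, QRel q t → fprod (t ∘ u) * fprod (t ∘ v) = c • fprod t := by
  refine ⟨(-q⁻¹) ^ linv (List.ofFn u ++ List.ofFn v),
    pow_ne_zero _ (neg_ne_zero.2 (inv_ne_zero hq)), fun t ht => ?_⟩
  have hnd : (List.ofFn u ++ List.ofFn v).Nodup := by
    rw [List.nodup_append', List.nodup_ofFn, List.nodup_ofFn]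
    refine ⟨hu, hv, fun x h1 h2 => ?_⟩
    rw [List.mem_ofFn] at h1 h2
    obtain ⟨a, rfl⟩ := h1
    obtain ⟨b, hb⟩ := h2
    exact huv a b hb.symm
  rw [fprod_comp, fprod_comp, ← List.prod_append, ← List.map_append,
    prod_sort_eq ht (l' := List.ofFn id) hnd, ← fprod_comp, Function.comp_id]
  · refine (List.perm_ext_iff_of_nodup hnd ?_).2 fun b => ?_
    · rw [List.nodup_ofFn]; exact Function.injective_id
    · simp only [List.mem_append, List.mem_ofFn]
      exact ⟨fun _ => ⟨b, rfl⟩, fun _ => hc b⟩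
  · rw [List.pairwise_ofFn]; intro i j h; exact h.le

lemma fprod_mul_eq_zero (hq : q ≠ 0) {t : Fin k → E} (ht : QRel q t) {r s : ℕ}
    {u : Fin r → Fin k} {v : Fin s → Fin k}
    (hc : ∀ i, (∃ a, u a = i) ∨ ∃ b, v b = i) (g : Fin s → Fin k)
    (hg : ¬ (Function.Injective g ∧ ∀ i, g i ∈ Set.range v)) :
    fprod (t ∘ u) * fprod (t ∘ g) = 0 ∧ fprod (t ∘ g) * fprod (t ∘ u) = 0 := by
  rw [fprod_comp, fprod_comp, ← List.prod_append, ← List.map_append, ← List.prod_append,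
    ← List.map_append]
  have key : ¬ ((List.ofFn u).Nodup ∧ (List.ofFn g).Nodup ∧
      List.Disjoint (List.ofFn u) (List.ofFn g)) := by
    rintro ⟨-, h1, h2⟩
    refine hg ⟨List.nodup_ofFn.1 h1, fun i => ?_⟩
    rcases hc (g i) with ⟨a, ha⟩ | ⟨b, hb⟩
    · exact absurd ((List.mem_ofFn' _ _).2 ⟨i, rfl⟩ : g i ∈ List.ofFn g)
        (h2 ((List.mem_ofFn' _ _).2 ⟨a, ha⟩))
    · exact ⟨b, hb⟩
  constructor
  · refine prod_not_nodup hq ht _ fun h => key ?_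
    rwa [List.nodup_append'] at h
  · refine prod_not_nodup hq ht _ fun h => key ?_
    rw [List.nodup_append'] at h
    exact ⟨h.2.1, h.1, h.2.2.symm⟩

/-- Jacobi's identity for a complementary minor of the inverse. -/
lemma det_minor (hq : q ≠ 0) {G P : Matrix (Fin k) (Fin k) A} (hG : Rel (fun _ => 0) q G)
    (h : G * P = 1) {r s : ℕ} {u : Fin r → Fin k} {v : Fin s → Fin k}
    (hu : StrictMono u) (hv : StrictMono v) (huv : ∀ a b, u a ≠ v b)
    (hc : ∀ i, (∃ a, u a = i) ∨ ∃ b, v b = i) :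
    detq q (G.submatrix u u) =
      detq q G * (detq q ((P.submatrix v v).map MulOpposite.op)).unop := by
  obtain ⟨E, _, _, L, t, hm⟩ := exists_model (A := A) k hq
  obtain ⟨c, hc0, hcm⟩ := exists_merge (E := E) hq hu.injective hv.injective huv hc
  have hψ := hm.co_rel hq hG
  have h1 := fprod_det_mul hm.comm hm.rel u hu (G.submatrix id u) (fprod (t ∘ v))
    (fun a => fprod_comm fun i => hm.comm _ _)
    (fun g hg => (fprod_mul_eq_zero hq hm.rel (fun i => (hc i).symm) g hg).2)
  have h2 := mul_fprod_det_rev (L := L) (q := q) (t := co L t G) (x := t ∘ v)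
    (fun a i => hm.comm a _) hψ v hv (P.submatrix id v) (fun j => co_inv h _)
    (fprod (co L t G ∘ u)) (fun g hg => (fprod_mul_eq_zero hq hψ hc g hg).1)
  have h3 : (fun j => ∑ a, t a * L (G.submatrix id u a j)) = co L t G ∘ u := rfl
  rw [h3, h2, hcm _ hψ, hcm _ hm.rel, hm.co_top hq, smul_mul_assoc, smul_mul_assoc, mul_assoc,
    ← map_mul] at h1
  exact (hm.top_eq (smul_right_injective _ hc0 h1)).symm

/-- The determinant of a left inverse of a transpose. -/
lemma det_transpose_inv (hq : q ≠ 0) {P T : Matrix (Fin k) (Fin k) A}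
    (hP : Rel (fun _ => 0) q P) (hT : ∀ j l, ∑ c, T j c * P l c = if j = l then 1 else 0) :
    (detq q (T.transpose.map MulOpposite.op)).unop * detq q P
      = 1 := by
  obtain ⟨E, _, _, L, t, hm⟩ := exists_model (A := A) k hq
  have hp := hm.co_rel hq hP
  have h1 : ∀ j, t j = ∑ a, L (T j a) * co L t P a := by
    intro j
    simp only [co, Finset.mul_sum, ← mul_assoc, hm.comm]
    simp only [mul_assoc, ← map_mul]
    rw [Finset.sum_comm]
    simp only [← Finset.mul_sum, ← map_sum, hT]
    simp
  have h2 := fprod_expand_left hm.comm (fun j a => T j a) h1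
  rw [sum_injective_range _ id Function.injective_id] at h2
  · have h3 : fprod t = L (detq q (T.transpose.map MulOpposite.op)).unop * fprod (co L t P) := by
      rw [h2, detq_eq, ← MulOpposite.coe_opLinearEquiv_symm ℂ, map_sum, map_sum, Finset.sum_mul]
      refine Finset.sum_congr rfl fun σ _ => ?_
      rw [map_smul, map_smul, Function.id_comp, fprod_perm hp, smul_mul_assoc, mul_smul_comm]
      rfl
    rw [hm.co_top hq, ← mul_assoc, fprod_comm (fun i => hm.comm _ i), mul_assoc, ← map_mul] at h3
    refine hm.top_eq ?_
    rw [← h3, map_one, mul_one]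
  · intro g hg
    rw [fprod_not_injective hq hp fun h => hg ⟨h, fun i => ⟨_, rfl⟩⟩, mul_zero]

/-- Jacobi's ratio theorem in the even case. -/
lemma det_ratio (hq : q ≠ 0) {G P : Matrix (Fin k) (Fin k) A} (hG : Rel (fun _ => 0) q G)
    (hcan : ∀ v, detq q G * v = 0 → v = 0) (h : G * P = 1) {r s : ℕ} {u : Fin r → Fin k}
    {v : Fin s → Fin k} (hu : StrictMono u) (hv : StrictMono v) (huv : ∀ a b, u a ≠ v b)
    (hc : ∀ i, (∃ a, u a = i) ∨ ∃ b, v b = i) {W : Matrix (Fin r) (Fin r) A}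
    (hW : G.submatrix u u * W = 1) {T : Matrix (Fin s) (Fin s) A}
    (hT : ∀ j l, ∑ c, T j c * P (v l) (v c) = if j = l then 1 else 0) :
    detq q G = detq q (G.submatrix u u) *
      (detq q⁻¹ (T.transpose.map MulOpposite.op)).unop := by
  have hP := (rel_of_inv hq hG hcan h).submatrix hv
  have h1 := det_minor hq hG h hu hv huv hc
  have h2 := det_transpose_inv (inv_ne_zero hq) hP hT
  have h3 := detq_op (inv_ne_zero hq) hP
  have h4 := det_mul_det hq (hG.submatrix hu) hW
  rw [inv_inv] at h3
  rw [h3] at h1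
  set d := detq q⁻¹ (P.submatrix v v)
  set w := (detq q (W.map MulOpposite.op)).unop
  set R := (detq q⁻¹ (T.transpose.map MulOpposite.op)).unop
  have h5 : d * w * detq q G = 1 := by
    rw [← sub_eq_zero]
    refine hcan _ ?_
    rw [mul_sub, mul_one, ← mul_assoc, ← mul_assoc, ← h1, h4, one_mul, sub_self]
  have h6 : R = w * detq q G := by
    calc R = R * (d * w * detq q G) := by rw [h5, mul_one]
      _ = R * d * (w * detq q G) := by simp only [mul_assoc]
      _ = w * detq q G := by rw [h2, one_mul]
  rw [h6, ← mul_assoc, h4, one_mul]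

end Even

section Products
variable {E : Type*} [Ring E] [Algebra ℂ E]

lemma fprod_smul_comm {r : ℕ} {t : Fin r → E} {x : E} {c : ℂ} (h : ∀ i, t i * x = c • (x * t i)) :
    fprod t * x = c ^ r • (x * fprod t) := by
  induction r with
  | zero => simp [fprod_zero]
  | succ r ih =>
    rw [fprod_succ, mul_assoc, ih fun i => h i.succ, mul_smul_comm, ← mul_assoc, h 0,
      smul_mul_assoc, smul_smul, mul_assoc, pow_succ]

lemma mul_fprod_eq_zero {k : ℕ} {q : ℂ} (hq : q ≠ 0) {t : Fin k → E} (ht : QRel q t) (a : Fin k) :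
    t a * fprod t = 0 := by
  have := mul_prod_mem hq ht a (List.ofFn id) (by simp [List.mem_ofFn'])
  rwa [List.map_ofFn] at this

lemma fprod_congr_mod {F : Type*} [AddCommGroup F] [Module ℂ F] (W₀ W₁ : Submodule ℂ F) {r : ℕ}
    {X Y : Fin r → Module.End ℂ F} (hY : ∀ o, ∀ f ∈ W₀, Y o f ∈ W₀)
    (hX : ∀ o, ∀ f ∈ W₁, X o f ∈ W₁) (hXY : ∀ o, ∀ f ∈ W₀, X o f - Y o f ∈ W₁) (f : F)
    (hf : f ∈ W₀) : fprod Y f ∈ W₀ ∧ fprod X f - fprod Y f ∈ W₁ := by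
  induction r with
  | zero => simp [fprod_zero, hf]
  | succ r ih =>
    obtain ⟨h1, h2⟩ := ih (fun o => hY o.succ) (fun o => hX o.succ) (fun o => hXY o.succ)
    simp only [fprod_succ, Module.End.mul_apply]
    refine ⟨hY 0 _ h1, ?_⟩
    have := W₁.add_mem (hX 0 _ h2) (hXY 0 _ h1)
    rwa [map_sub, sub_add_sub_cancel] at this

end Products

section Boson
variable {N : ℕ} {p : Fin N → ℕ} {A : Type*} [Ring A] [Algebra ℂ A]

/-- Degree in the odd directions. -/
def bd (α : Mi p) : ℕ := ∑ i, p i * α.1 i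

lemma bd_inc {i : Fin N} {α : Mi p} (h : Ok i α) : bd (inc i α) = bd α + p i := by
  unfold bd
  rw [← Finset.add_sum_erase _ _ (mem_univ i),
    ← Finset.add_sum_erase univ (fun j => p j * α.1 j) (mem_univ i), inc_self h,
    Finset.sum_congr rfl (fun j hj => by rw [inc_ne (α := α) (Finset.ne_of_mem_erase hj)])]
  ring

/-- Elements without components of odd-direction degree less than `d`. -/
def SB (p : Fin N → ℕ) (A : Type*) [Ring A] [Algebra ℂ A] (d : ℕ) : Submodule ℂ (Fk p A) where
  carrier := {f | ∀ β, bd β < d → f β = 0}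
  zero_mem' := fun _ _ => rfl
  add_mem' := fun hf hg β h => by rw [Finsupp.add_apply, hf β h, hg β h, add_zero]
  smul_mem' := fun c f hf β h => by rw [Finsupp.smul_apply, hf β h, smul_zero]

lemma Tp_SB {d : ℕ} {f : Fk p A} (h : f ∈ SB p A d) (g : Fin N → ℂ) (i : Fin N) :
    Tp A g i f ∈ SB p A (d + p i) := by
  intro β hβ
  by_cases hi : β.1 i = 0
  · exact Tp_apply_zero g hi f
  · rw [← inc_dec hi, Tp_apply_inc g (ok_dec β), h, smul_zero]
    rw [← inc_dec hi, bd_inc (ok_dec β)] at hβ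
    omega

lemma hat_SB {d : ℕ} {f : Fk p A} (h : f ∈ SB p A d) (a : A) (n : ℕ) :
    (lam p A a * Ka p A ^ n) f ∈ SB p A d := by
  intro β hβ
  rw [hat_apply, h β hβ]; simp

lemma SB_mono {d e : ℕ} (h : d ≤ e) : SB p A e ≤ SB p A d := fun _ hf β hβ => hf β (hβ.trans_le h)

lemma single_zer_mem (a : A) : Finsupp.single (zer : Mi p) a ∈ SB p A 0 := fun β h => by simp at h

/-- Right multiplication of the coefficients. -/
noncomputable def rmul (p : Fin N → ℕ) (A : Type*) [Ring A] [Algebra ℂ A] (z : A) :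
    Module.End ℂ (Fk p A) := Finsupp.mapRange.linearMap (LinearMap.mulRight ℂ z)

lemma rmul_apply (z : A) (f : Fk p A) (α : Mi p) : rmul p A z f α = f α * z := by
  simp [rmul]

lemma rmul_single (z a : A) (α : Mi p) :
    rmul p A z (Finsupp.single α a) = Finsupp.single α (a * z) := by
  simp [rmul]

lemma rmul_Tp (z : A) (g : Fin N → ℂ) (i : Fin N) :
    rmul p A z * Tp A g i = Tp A g i * rmul p A z := by
  apply end_ext; intro α a
  simp only [Module.End.mul_apply, Tp_single, map_smul, rmul_single]

lemma rmul_Ka (z : A) : rmul p A z * Ka p A = Ka p A * rmul p A z := by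
  apply end_ext; intro α a
  simp only [Module.End.mul_apply, Ka, Dg_single, map_smul, rmul_single]

lemma rmul_lam (z a : A) : rmul p A z * lam p A a = lam p A a * rmul p A z := by
  apply end_ext; intro α b
  simp only [Module.End.mul_apply, lam_single, rmul_single, mul_assoc]

lemma rmul_psi (z : A) (g : Fin N → Fin N → ℂ) (Z : Matrix (Fin N) (Fin N) A) (j : Fin N) :
    rmul p A z * psi p (lam p A) (fun i => Tp A (g i) i) (Ka p A) Z j =
      psi p (lam p A) (fun i => Tp A (g i) i) (Ka p A) Z j * rmul p A z := by
  refine (Commute.sum_right _ _ _ fun i _ => ?_ : Commute (rmul p A z) _)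
  exact (show Commute _ _ from rmul_Tp z (g i) i).mul_right
    ((show Commute _ _ from rmul_lam z _).mul_right
      ((show Commute _ _ from rmul_Ka z).pow_right _))

variable (hp : ∀ i, p i = 0 ∨ p i = 1) {q : ℂ} (hq : q ≠ 0)
include hp hq

/-- The coefficient functionals of the top exterior product acting on one bosonic excitation. -/
lemma exists_boson_functional {Z : Matrix (Fin N) (Fin N) A} (hZ : Rel p q Z)
    {r : ℕ} {u : Fin r → Fin N} (hu : StrictMono u) (hup : ∀ i, p i = 0 ↔ ∃ a, u a = i)
    (hsep : ∀ j a, p j = 1 → j < u a) (M : Matrix (Fin N) (Fin N) A)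
    (hMZ : ∀ a, ∑ b, (lam p A (M a b) * Ka p A ^ (p a + p b)) *
      psi p (lam p A) (Lo p q A) (Ka p A) Z b = Lo p q A a) (l : Fin N) (hl : p l = 1) :
    ∃ ν : Fin N → A,
      (∀ i, p i = 1 → ν i = if i = l then detq q (Z.submatrix u u) else 0) ∧
      (∀ a, ∑ i, ν i * Z i (u a) = 0) ∧
      ∀ a, p a = 1 → ∑ b, (if p b = 1 then M a b * ∑ i, ν i * Z i b else 0) =
        if a = l then detq q (Z.submatrix u u) else 0 := by
  set Φ : Fin N → Module.End ℂ (Fk p A) := psi p (lam p A) (Lo p q A) (Ka p A) Z with hΦ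
  set δ := detq q (Z.submatrix u u) with hδ
  have hu0 : ∀ a, p (u a) = 0 := fun a => (hup _).2 ⟨a, rfl⟩
  have hLL := Lo_Lo (A := A) hp hq
  have hΦΦ : ∀ i j, Φ i * Φ j = cst p q i j • (Φ j * Φ i) :=
    psi_rel (E := Module.End ℂ (Fk p A)) hp hq hLL (fun a i => lam_Lo a i) lam_Ka Ka_Lo hZ
  set c : ℂ := -q⁻¹ with hc
  have hc0 : c ≠ 0 := neg_ne_zero.2 (inv_ne_zero hq)
  have hcst : ∀ j a, p j = 1 → cst p q (u a) j = c := fun j a hj => by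
    rw [cst, hu0, eps_of_lt (hsep j a hj)]; simp [hc]
  have hΦQ : QRel q (Φ ∘ u) := QRel.of_cst hΦΦ hu hu0
  have hLQ : QRel q (Lo p q A ∘ u) := QRel.of_cst hLL hu hu0
  obtain ⟨c0, hc0', hvac⟩ := fprod_Tp_single (p := p) (A := A) (gL_ne (p := p) hq) hu.injective
  set y : Mi p := ind (univ.image u) with hy
  have hy0 : ∀ i, p i = 1 → y.1 i = 0 := fun i h => if_neg fun hi => by
    obtain ⟨a, -, rfl⟩ := Finset.mem_image.1 hi
    rw [hu0] at h; omega
  have hbdy : bd y = 0 := by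
    refine Finset.sum_eq_zero fun i _ => ?_
    rcases hp i with h | h
    · rw [h, zero_mul]
    · rw [hy0 i h, mul_zero]
  have hok : ∀ i, p i = 1 → Ok i y := fun i h h' => by omega
  -- reduction of the deformed exterior product modulo higher bosonic degree
  set φ : Fin r → Module.End ℂ (Fk p A) :=
    fun o => ∑ a, (Lo p q A ∘ u) a * lam p A (Z.submatrix u u a o) with hφ
  have hφd : fprod φ = fprod (Lo p q A ∘ u) * lam p A δ :=
    fprod_det hq (fun a i => lam_Lo a (u i)) hLQ (Z.submatrix u u)
  have hΦSB : ∀ d o, ∀ f ∈ SB p A d, Φ o f ∈ SB p A d := by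
    intro d o f hf
    rw [hΦ, psi_apply]
    refine Submodule.sum_mem _ fun i _ => SB_mono (Nat.le_add_right d (p i)) (Tp_SB (hat_SB hf _ _) _ _)
  have hφSB : ∀ d o, ∀ f ∈ SB p A d, φ o f ∈ SB p A d := by
    intro d o f hf
    rw [hφ, LinearMap.sum_apply]
    refine Submodule.sum_mem _ fun i _ => SB_mono (Nat.le_add_right d (p (u i))) (Tp_SB ?_ _ _)
    have := hat_SB hf (Z.submatrix u u i o) 0
    rwa [pow_zero, mul_one] at this
  have hsub : ∀ d o, ∀ f ∈ SB p A d, (Φ ∘ u) o f - φ o f ∈ SB p A (d + 1) := by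
    intro d o f hf
    have e : φ o f = ∑ i ∈ univ.image u, Lo p q A i ((lam p A (Z i (u o)) * Ka p A ^ (p i + p (u o))) f) := by
      rw [Finset.sum_image hu.injective.injOn, hφ, LinearMap.sum_apply]
      refine Finset.sum_congr rfl fun a _ => ?_
      rw [hu0, hu0, pow_zero, mul_one]; rfl
    rw [e, Function.comp_apply, hΦ, psi_apply, ← Finset.sum_sdiff (Finset.subset_univ (univ.image u)),
      add_sub_cancel_right]
    refine Submodule.sum_mem _ fun i hi => ?_
    have hi1 : p i = 1 := by
      refine (hp i).resolve_left fun h => ?_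
      obtain ⟨a, rfl⟩ := (hup i).1 h
      simp at hi
    have := Tp_SB (hat_SB hf (Z i (u o)) (p i + p (u o))) (gL p q i) i
    rwa [hi1] at this ⊢
  have hred : ∀ d, ∀ f ∈ SB p A d, fprod (Φ ∘ u) f - fprod φ f ∈ SB p A (d + 1) := fun d f hf =>
    (fprod_congr_mod (SB p A d) (SB p A (d + 1)) (fun o => hφSB d o) (fun o => hΦSB _ (u o))
      (hsub d) f hf).2
  set m : ℂ := c0 * mon (gL p q l) y with hm
  have hm0 : m ≠ 0 := mul_ne_zero hc0' (mon_ne_zero (gL_ne hq l) y)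
  have hev : ∀ f ∈ SB p A 2, f (inc l y) = 0 := fun f hf => hf _ (by
    rw [bd_inc (hok l hl), hbdy, hl]; norm_num)
  have hLy : ∀ i a, p i = 1 → (Lo p q A i (fprod (Lo p q A ∘ u) (Finsupp.single zer a))) (inc l y) =
      if i = l then m • a else 0 := by
    intro i a hi
    change (Lo p q A i (fprod (fun j => Tp A (gL p q (u j)) (u j)) _)) _ = _
    rw [hvac, map_smul, Finsupp.smul_apply]
    by_cases hil : i = l
    · subst hil
      rw [Lo, Tp_apply_inc _ (hok i hi), if_pos rfl, Finsupp.single_eq_same, smul_smul]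
    · rw [if_neg hil, Lo, Tp_apply_zero, smul_zero]
      rw [inc_ne hil]
      exact hy0 i hi
  have hΦvac : ∀ i, p i = 1 → ∀ a, (fprod (Φ ∘ u) (Lo p q A i (Finsupp.single zer a))) (inc l y) =
      if i = l then (c ^ r * m) • (δ * a) else 0 := by
    intro i hi a
    have h1 : Lo p q A i (Finsupp.single zer a) ∈ SB p A 1 := by
      have := Tp_SB (single_zer_mem (p := p) a) (gL p q i) i
      rwa [hi] at this
    have h2 := hev _ (hred 1 _ h1)
    rw [Finsupp.sub_apply, sub_eq_zero] at h2
    rw [h2, hφd]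
    have h3 : fprod (Lo p q A ∘ u) * Lo p q A i = c ^ r • (Lo p q A i * fprod (Lo p q A ∘ u)) :=
      fprod_smul_comm fun a => by rw [Function.comp_apply, hLL, hcst i a hi]
    have h4 : (fprod (Lo p q A ∘ u) * lam p A δ) (Lo p q A i (Finsupp.single zer a)) =
        c ^ r • Lo p q A i (fprod (Lo p q A ∘ u) (Finsupp.single zer (δ * a))) := by
      have h5 := LinearMap.congr_fun (lam_Lo (p := p) (q := q) δ i) (Finsupp.single zer a)
      rw [Module.End.mul_apply, Module.End.mul_apply, lam_single] at h5
      rw [Module.End.mul_apply, h5]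
      exact LinearMap.congr_fun h3 _
    rw [h4, Finsupp.smul_apply, hLy i _ hi]
    split_ifs
    · rw [smul_smul]
    · rw [smul_zero]
  set ν : Fin N → A := fun i =>
    (c ^ r * m)⁻¹ • (fprod (Φ ∘ u) (Lo p q A i (Finsupp.single zer 1))) (inc l y) with hν
  have hcm : c ^ r * m ≠ 0 := mul_ne_zero (pow_ne_zero _ hc0) hm0
  have hνr : ∀ i a, (fprod (Φ ∘ u) (Lo p q A i (Finsupp.single zer a))) (inc l y) =
      (c ^ r * m) • (ν i * a) := by
    intro i a
    have h1 : rmul p A a * (fprod (Φ ∘ u) * Lo p q A i) = (fprod (Φ ∘ u) * Lo p q A i) * rmul p A a := by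
      refine (Commute.mul_right (?_ : Commute (rmul p A a) (fprod (Φ ∘ u))) (rmul_Tp a _ i))
      exact fprod_comm fun o => rmul_psi a (gL p q) Z (u o)
    have h2 := LinearMap.congr_fun h1 (Finsupp.single zer 1)
    simp only [Module.End.mul_apply] at h2
    rw [rmul_single, one_mul] at h2
    rw [← h2, rmul_apply, hν]
    simp only [smul_mul_assoc, smul_smul, mul_inv_cancel₀ hcm, one_smul]
  have hνZ : ∀ b, (fprod (Φ ∘ u) (Φ b (Finsupp.single zer 1))) (inc l y) =
      (c ^ r * m) • ∑ i, ν i * Z i b := by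
    intro b
    rw [hΦ, psi_apply, ← hΦ, map_sum, Finsupp.finsetSum_apply, Finset.smul_sum]
    refine Finset.sum_congr rfl fun i _ => ?_
    rw [hat_zer, mul_one, hνr]
  refine ⟨ν, fun i hi => ?_, fun a => ?_, fun a ha => ?_⟩
  · simp only [hν]
    rw [hΦvac i hi]
    split_ifs
    · rw [smul_smul, inv_mul_cancel₀ hcm, one_smul, mul_one]
    · rw [smul_zero]
  · have h1 : fprod (Φ ∘ u) * Φ (u a) = 0 := by
      have h2 : ∀ i, (Φ ∘ u) i * Φ (u a) = cst p q (u i) (u a) • (Φ (u a) * (Φ ∘ u) i) := fun i => hΦΦ _ _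
      have := prod_not_nodup hq hΦQ (List.ofFn id ++ [a]) (by
        intro h
        have := List.nodup_append.1 h
        simp [List.mem_ofFn'] at this)
      rw [List.map_append, List.prod_append, List.map_ofFn] at this
      simpa [fprod] using this
    have h2 := hνZ (u a)
    rw [← Module.End.mul_apply, h1] at h2
    exact (smul_eq_zero.1 h2.symm).resolve_left hcm
  · have h1 := congrArg (fun T : Module.End ℂ (Fk p A) =>
      (T (fprod (Φ ∘ u) (Finsupp.single zer 1))) (inc l y)) (hMZ a)
    simp only [LinearMap.sum_apply, Finsupp.finsetSum_apply] at h1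
    have h3 : (Lo p q A a (fprod (Φ ∘ u) (Finsupp.single zer 1))) (inc l y) =
        if a = l then m • δ else 0 := by
      have h4 := Tp_SB (hred 0 _ (single_zer_mem (p := p) (1 : A))) (gL p q a) a
      rw [ha, map_sub] at h4
      have h5 := hev _ h4
      rw [Finsupp.sub_apply, sub_eq_zero] at h5
      refine h5.trans ?_
      rw [hφd, Module.End.mul_apply, lam_single, mul_one]
      exact hLy a δ ha
    rw [h3] at h1
    have h6 : ∀ b, ((lam p A (M a b) * Ka p A ^ (p a + p b) * Φ b)
        (fprod (Φ ∘ u) (Finsupp.single zer 1))) (inc l y) =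
        m • (if p b = 1 then M a b * ∑ i, ν i * Z i b else 0) := by
      intro b
      rcases hp b with hb | hb
      · obtain ⟨o, rfl⟩ := (hup b).1 hb
        have h7 : Φ (u o) * fprod (Φ ∘ u) = 0 := mul_fprod_eq_zero hq hΦQ o
        rw [Module.End.mul_apply, ← Module.End.mul_apply (Φ (u o)), h7, hb]
        simp
      · rw [if_pos hb, ha, hb, show (1 + 1 : ℕ) = 2 from rfl, pow_two, Ka_sq, mul_one]
        have h7 : fprod (Φ ∘ u) * Φ b = c ^ r • (Φ b * fprod (Φ ∘ u)) :=
          fprod_smul_comm fun a => by rw [Function.comp_apply, hΦΦ, hcst b a hb]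
        have h8 := hνZ b
        rw [← Module.End.mul_apply, h7, mul_smul, LinearMap.smul_apply, Finsupp.smul_apply] at h8
        have h9 := smul_right_injective A (pow_ne_zero r hc0) h8
        rw [Module.End.mul_apply, lam_apply, ← Module.End.mul_apply, h9, mul_smul_comm]
    simp only [h6, ← Finset.smul_sum] at h1
    apply smul_right_injective A hm0
    simp only
    rw [h1]; split_ifs <;> simp

omit hp hq in
/-- The inverse matrix recovers the generators from the coaction. -/
lemma hat_psi_inv (hp : ∀ i, p i = 0 ∨ p i = 1) {M Nv Z : Matrix (Fin N) (Fin N) A} (h : M * Nv = 1)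
    (hZ : ∀ i b, Z i b = (-1 : ℂ) ^ (p i * (p i + p b)) • Nv b i) (a : Fin N) :
    ∑ b, (lam p A (M a b) * Ka p A ^ (p a + p b)) *
      psi p (lam p A) (Lo p q A) (Ka p A) Z b = Lo p q A a := by
  have key : ∀ b i, (lam p A (M a b) * Ka p A ^ (p a + p b)) *
      (Lo p q A i * (lam p A (Z i b) * Ka p A ^ (p i + p b))) =
      ((-1 : ℂ) ^ (p i * (p a + p i))) • (Lo p q A i * (lam p A (M a b * Nv b i) * Ka p A ^ (p a + p i))) := by
    intro b i
    rw [← mul_assoc, hat_comm (L := lam p A) (E := Module.End ℂ (Fk p A)) (t := Lo p q A i) (κ := Ka p A) (r := p i)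
      (fun a => lam_Lo a i) (Ka_Lo i), smul_mul_assoc, mul_assoc, hZ, map_smul, smul_mul_assoc,
      mul_smul_comm, mul_smul_comm, smul_smul]
    have e1 : (-1 : ℂ) ^ ((p a + p b) * p i) * (-1 : ℂ) ^ (p i * (p i + p b)) =
        (-1 : ℂ) ^ (p i * (p a + p i)) := by
      rcases hp a with ha | ha <;> rcases hp b with hb | hb <;> rcases hp i with hi | hi <;>
        simp [ha, hb, hi]
    rw [e1]
    congr 2
    have h2 := kpow_comm (L := lam p A) (κ := Ka p A) lam_Ka (Nv b i) (p a + p b)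
    calc _ = lam p A (M a b) * (Ka p A ^ (p a + p b) * lam p A (Nv b i)) * Ka p A ^ (p i + p b) := by
          simp only [mul_assoc]
      _ = lam p A (M a b * Nv b i) * (Ka p A ^ (p a + p b) * Ka p A ^ (p i + p b)) := by
          rw [← h2, map_mul]; simp only [mul_assoc]
      _ = _ := by
          rw [← pow_add, show p a + p b + (p i + p b) = (p a + p i) + 2 * p b by ring,
            pow_add _ (p a + p i), pow_mul, pow_two, Ka_sq, one_pow, mul_one]
  unfold psi
  simp only [Finset.mul_sum, key]
  rw [Finset.sum_comm]
  simp only [← Finset.smul_sum, ← Finset.mul_sum, ← Finset.sum_mul, ← map_sum]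
  have h1 : ∀ i, ∑ b, M a b * Nv b i = (1 : Matrix (Fin N) (Fin N) A) a i := fun i => by
    rw [← h, Matrix.mul_apply]
  simp only [h1]
  rw [Finset.sum_eq_single a]
  · rw [Matrix.one_apply_eq, map_one, one_mul, ← two_mul, pow_mul (Ka p A), pow_two (Ka p A), Ka_sq,
      one_pow, mul_one]
    rcases hp a with ha | ha <;> simp [ha]
  · intro i _ hi
    rw [Matrix.one_apply_ne hi.symm]; simp
  · simp

end Boson

section Transport
variable {B : Type*} [Ring B] [Algebra ℂ B] {N : ℕ} {p p' : Fin N → ℕ}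

lemma Rel.op_transpose (hp : ∀ i, p i = 0 ∧ p' i = 1 ∨ p i = 1 ∧ p' i = 0) {q : ℂ} (hq : q ≠ 0)
    {M : Matrix (Fin N) (Fin N) B} (hM : Rel p q M) :
    Rel p' q (M.transpose.map MulOpposite.op) := by
  intro i j k l
  have h := congrArg MulOpposite.op (hM l k j i)
  simp only [MulOpposite.op_sub, MulOpposite.op_smul, MulOpposite.op_mul] at h
  simp only [Matrix.map_apply, Matrix.transpose_apply]
  rw [zpow_add₀ hq] at h ⊢
  rcases hp i with ⟨hi, hi'⟩ | ⟨hi, hi'⟩ <;> rcases hp j with ⟨hj, hj'⟩ | ⟨hj, hj'⟩ <;>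
    rcases hp k with ⟨hk, hk'⟩ | ⟨hk, hk'⟩ <;> rcases hp l with ⟨hl, hl'⟩ | ⟨hl, hl'⟩ <;>
    · simp only [hi, hj, hk, hl, hi', hj', hk', hl'] at h ⊢
      norm_num at h ⊢
      first
        | exact h
        | (refine sub_eq_zero.1 (Eq.trans ?_ (sub_eq_zero.2 h)); module)

lemma Rel.superTranspose (hp : ∀ i, p i = 0 ∧ p' i = 1 ∨ p i = 1 ∧ p' i = 0) {q : ℂ} (hq : q ≠ 0)
    {M Z : Matrix (Fin N) (Fin N) B} (hM : Rel p q⁻¹ M)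
    (hZ : ∀ i b, Z i b = (-1 : ℂ) ^ (p' i * (p' i + p' b)) • M b i) :
    Rel p' q Z := by
  intro i j k l
  have h := hM j i l k
  simp only [hZ]
  rw [zpow_add₀ hq]
  rw [zpow_add₀ (inv_ne_zero hq), eps_neg j l, eps_neg k i] at h
  simp only [inv_zpow, zpow_neg, inv_inv] at h
  rcases hp i with ⟨hi, hi'⟩ | ⟨hi, hi'⟩ <;> rcases hp j with ⟨hj, hj'⟩ | ⟨hj, hj'⟩ <;>
    rcases hp k with ⟨hk, hk'⟩ | ⟨hk, hk'⟩ <;> rcases hp l with ⟨hl, hl'⟩ | ⟨hl, hl'⟩ <;>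
    · simp only [hi, hj, hk, hl, hi', hj', hk', hl'] at h ⊢
      norm_num at h ⊢
      first
        | exact h
        | (refine sub_eq_zero.1 (Eq.trans ?_ (sub_eq_zero.2 h)); module)
        | (refine sub_eq_zero.1 (Eq.trans ?_ (neg_eq_zero.2 (sub_eq_zero.2 h))); module)

end Transport

section Conj
variable {A B : Type*} [Ring A] [Algebra ℂ A] [Ring B] [Algebra ℂ B]

lemma map_fprod (f : A →ₐ[ℂ] B) {r : ℕ} (t : Fin r → A) : f (fprod t) = fprod fun i => f (t i) := by
  simp only [fprod, map_list_prod, List.map_ofFn]; rfl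

lemma map_detq (f : A →ₐ[ℂ] B) (q : ℂ) {r : ℕ} (G : Matrix (Fin r) (Fin r) A) :
    f (detq q G) = detq q (G.map f) := by
  rw [detq_eq, detq_eq, map_sum]
  refine Finset.sum_congr rfl fun σ _ => ?_
  rw [map_smul, map_fprod]; rfl

/-- Conjugation by an invertible element. -/
noncomputable def conjHom (d d' : A) (h : d * d' = 1) (h' : d' * d = 1) : A →ₐ[ℂ] A :=
  AlgHom.ofLinearMap (LinearMap.mulLeft ℂ d ∘ₗ LinearMap.mulRight ℂ d') (by simp [h]) (by
    intro x y
    change d * (x * y * d') = d * (x * d') * (d * (y * d'))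
    calc d * (x * y * d') = d * x * 1 * y * d' := by simp only [mul_one, mul_assoc]
      _ = _ := by rw [← h']; simp only [mul_assoc])

lemma conjHom_apply (d d' : A) (h : d * d' = 1) (h' : d' * d = 1) (x : A) :
    conjHom d d' h h' x = d * x * d' := (mul_assoc _ _ _).symm

lemma detq_op_conj (d d' : A) (h : d * d' = 1) (h' : d' * d = 1) (q : ℂ) {s : ℕ}
    (S : Matrix (Fin s) (Fin s) A) :
    (detq q ((Matrix.of fun i j => d * S i j * d').transpose.map MulOpposite.op)).unop =
      d * (detq q (S.transpose.map MulOpposite.op)).unop * d' := by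
  have h1 := map_detq (AlgHom.op (conjHom d d' h h')) q (S.transpose.map MulOpposite.op)
  have h2 : (S.transpose.map MulOpposite.op).map (AlgHom.op (conjHom d d' h h')) =
      (Matrix.of fun i j => d * S i j * d').transpose.map MulOpposite.op := by
    ext i j
    simp [conjHom_apply]
  rw [← h2, ← h1]
  simp [conjHom_apply]

end Conj

section EvenCase
variable {A : Type*} [Ring A] [Algebra ℂ A] {K : ℕ} {p p' : Fin K → ℕ}

lemma detq_isUnit_aux (hp : ∀ i, p i = 0 ∨ p i = 1) {q : ℂ} (hq : q ≠ 0)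
    {Nm U : Matrix (Fin K) (Fin K) A} (hN : Rel p q⁻¹ Nm) (hU : Rel p q U)
    (h1 : Nm * U = 1) (h2 : U * Nm = 1) {k : ℕ} {u : Fin k → Fin K} (hu : StrictMono u)
    (hup : ∀ i, p i = 0 ↔ ∃ a, u a = i) :
    ∃ d', detq q (U.submatrix u u) * d' = 1 ∧ d' * detq q (U.submatrix u u) = 1 := by
  obtain ⟨P, hP⟩ := star_right_inv hp hq hN hU h1 h2 u hu.injective hup
  have h3 := det_mul_det hq (hU.submatrix_even hu fun a => (hup _).2 ⟨a, rfl⟩) hP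
  refine ⟨_, h3, ?_⟩
  rw [← sub_eq_zero]
  refine star_cancel hp hq hN hU h1 h2 u hu hup _ ?_
  rw [mul_sub, ← mul_assoc, h3]; simp

variable (hp : ∀ i, p i = 0 ∧ p' i = 1 ∨ p i = 1 ∧ p' i = 0) {q : ℂ} (hq : q ≠ 0)
  {M Nv Z : Matrix (Fin K) (Fin K) A} (hM : Rel p q M) (hN : Rel p q⁻¹ Nv)
  (h1 : M * Nv = 1) (h2 : Nv * M = 1)
  (hZ : ∀ i b, Z i b = (-1 : ℂ) ^ (p' i * (p' i + p' b)) • Nv b i)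
  {n : ℕ} {o : Fin n → Fin K} (ho : StrictMono o) (hop : ∀ i, p' i = 0 ↔ ∃ a, o a = i)
include hp hq hM hN h1 h2 hZ hop

lemma odd_block_op : Rel p' q⁻¹ (Nv.transpose.map MulOpposite.op) ∧
    Rel p' (q⁻¹)⁻¹ (M.transpose.map MulOpposite.op) ∧
    M.transpose.map MulOpposite.op * Nv.transpose.map MulOpposite.op = 1 ∧
    Nv.transpose.map MulOpposite.op * M.transpose.map MulOpposite.op = 1 ∧
    (Nv.transpose.map MulOpposite.op).submatrix o o = (Z.submatrix o o).map MulOpposite.op := by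
  refine ⟨hN.op_transpose hp (inv_ne_zero hq), ?_, ?_, ?_, ?_⟩
  · rw [inv_inv]; exact hM.op_transpose hp hq
  · ext i j
    have := congrFun (congrFun h2 j) i
    rw [Matrix.mul_apply] at this
    simp only [Matrix.mul_apply, Matrix.map_apply, Matrix.transpose_apply, ← MulOpposite.op_mul,
      ← Finset.op_sum]
    rw [this, Matrix.one_apply, Matrix.one_apply]
    simp only [eq_comm]; split_ifs <;> rfl
  · ext i j
    have := congrFun (congrFun h1 j) i
    rw [Matrix.mul_apply] at this
    simp only [Matrix.mul_apply, Matrix.map_apply, Matrix.transpose_apply, ← MulOpposite.op_mul,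
      ← Finset.op_sum]
    rw [this, Matrix.one_apply, Matrix.one_apply]
    simp only [eq_comm]; split_ifs <;> rfl
  · ext i j
    simp [hZ, (hop (o i)).2 ⟨i, rfl⟩]

include ho in
/-- The ratio theorem when all removed indices are even. -/
lemma ratio_even (hsep : ∀ j a, p' j = 1 → j < o a) {m : ℕ} {e : Fin m → Fin K}
    (he : StrictMono e) (hep : ∀ i, p i = 0 ↔ ∃ a, e a = i) {r s : ℕ} {u : Fin r → Fin m}
    {v : Fin s → Fin m} (hu : StrictMono u) (hv : StrictMono v) (huv : ∀ a b, u a ≠ v b)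
    (hc : ∀ i, (∃ a, u a = i) ∨ ∃ b, v b = i) {W : Matrix (Fin r) (Fin r) A}
    (hW : (M.submatrix e e).submatrix u u * W = 1) (S : Matrix (Fin s) (Fin s) A)
    (V : Matrix (Fin s) (Fin n) A)
    (hS1 : ∀ j l, ∑ c, S j c * Z (e (v c)) (e (v l)) + ∑ a, V j a * Z (o a) (e (v l)) =
      if j = l then 1 else 0)
    (hS2 : ∀ j b, ∑ c, S j c * Z (e (v c)) (o b) + ∑ a, V j a * Z (o a) (o b) = 0) :
    detq q (M.submatrix e e) * detq q (Z.submatrix o o) =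
      detq q ((M.submatrix e e).submatrix u u) * (detq q (Z.submatrix o o) *
        (detq q⁻¹ (S.transpose.map MulOpposite.op)).unop) := by
  have hp0 : ∀ i, p i = 0 ∨ p i = 1 := fun i => by rcases hp i with h | h <;> simp [h]
  have hp1 : ∀ i, p' i = 0 ∨ p' i = 1 := fun i => by rcases hp i with h | h <;> simp [h]
  have he1 : ∀ a, p' (e a) = 1 := fun a => by
    have := (hep _).2 ⟨a, rfl⟩
    rcases hp (e a) with h | h <;> omega
  have ho0 : ∀ a, p' (o a) = 0 := fun a => (hop _).2 ⟨a, rfl⟩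
  obtain ⟨hNo, hMo, hMN, hNM, hoo⟩ := odd_block_op hp hq hM hN h1 h2 hZ hop
  have hq' := inv_ne_zero hq
  have hZr : Rel p' q Z := hN.superTranspose hp hq hZ
  have hZo : Rel (fun _ => 0) q (Z.submatrix o o) := hZr.submatrix_even ho ho0
  set δ := detq q (Z.submatrix o o) with hδ
  obtain ⟨d', hd1, hd2⟩ : ∃ d', δ * d' = 1 ∧ d' * δ = 1 := by
    obtain ⟨x, hx1, hx2⟩ := detq_isUnit_aux hp1 hq' hMo hNo hMN hNM ho hop
    have h3 := detq_op hq hZo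
    rw [hoo] at hx1 hx2
    refine ⟨x.unop, ?_, ?_⟩
    · have := congrArg MulOpposite.unop hx2
      rwa [MulOpposite.unop_mul, h3] at this
    · have := congrArg MulOpposite.unop hx1
      rwa [MulOpposite.unop_mul, h3] at this
  choose! ν hν1 hν2 hν3 using exists_boson_functional hp1 hq hZr ho hop hsep M
    (hat_psi_inv hp1 h1 hZ)
  have hνZ : ∀ a b, ∑ i, ν (e a) i * Z i b =
      δ * Z (e a) b + ∑ c, ν (e a) (o c) * Z (o c) b := by
    intro a b
    rw [← Finset.sum_filter_add_sum_filter_not univ (fun i => p' i = 1)]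
    congr 1
    · rw [Finset.sum_eq_single (e a)]
      · rw [hν1 _ (he1 a) _ (he1 a), if_pos rfl]
      · intro i hi hia
        rw [hν1 _ (he1 a) _ (Finset.mem_filter.1 hi).2, if_neg hia, zero_mul]
      · intro h; simp [he1] at h
    · rw [show univ.filter (fun i => ¬ p' i = 1) = univ.image o by
        ext i
        simp only [Finset.mem_filter, Finset.mem_univ, true_and, Finset.mem_image]
        rw [← hop]
        rcases hp1 i with h | h <;> omega, Finset.sum_image ho.injective.injOn]
  set G := M.submatrix e e with hG
  have hGr : Rel (fun _ => 0) q G := hM.submatrix_even he fun a => (hep _).2 ⟨a, rfl⟩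
  set P : Matrix (Fin m) (Fin m) A := Matrix.of fun b l => (∑ i, ν (e l) i * Z i (e b)) * d' with hP
  have hGP : G * P = 1 := by
    ext a l
    have h3 := hν3 (e l) (he1 l) (e a) (he1 a)
    rw [← Finset.sum_filter, show univ.filter (fun i => p' i = 1) = univ.image e by
        ext i
        simp only [Finset.mem_filter, Finset.mem_univ, true_and, Finset.mem_image]
        rw [← hep]
        rcases hp i with h | h <;> omega, Finset.sum_image he.injective.injOn] at h3
    rw [Matrix.mul_apply, Matrix.one_apply]
    simp only [hP, Matrix.of_apply, ← mul_assoc, ← Finset.sum_mul]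
    rw [hG]
    simp only [Matrix.submatrix_apply]
    rw [h3]
    simp only [he.injective.eq_iff]
    split_ifs
    · exact hd1
    · exact zero_mul _
  have hcan : ∀ w, detq q G * w = 0 → w = 0 := star_cancel hp0 hq hN hM h2 h1 e he hep
  have hz : ∀ j, (fun a => ∑ c, S j c * d' * ν (e (v c)) (o a)) = V j := by
    intro j
    have h3 : (fun a => MulOpposite.op (∑ c, S j c * d' * ν (e (v c)) (o a) - V j a)) = 0 := by
      obtain ⟨P', hP'⟩ := star_right_inv hp1 hq' hMo hNo hMN hNM o ho.injective hop
      refine col_cancel hq' (hNo.submatrix_even ho ho0)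
        (star_cancel hp1 hq' hMo hNo hMN hNM o ho hop) hP' _ fun b => ?_
      rw [hoo]
      simp only [Matrix.map_apply, Matrix.submatrix_apply, ← MulOpposite.op_mul,
        ← Finset.op_sum]
      rw [MulOpposite.op_eq_zero_iff]
      have h4 : ∀ c, δ * Z (e (v c)) (o b) + ∑ a, ν (e (v c)) (o a) * Z (o a) (o b) = 0 := fun c => by
        rw [← hνZ]; exact hν2 _ (he1 _) b
      have h5 : ∑ a, (∑ c, S j c * d' * ν (e (v c)) (o a)) * Z (o a) (o b) =
          -∑ c, S j c * Z (e (v c)) (o b) := by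
        simp only [Finset.sum_mul]
        rw [Finset.sum_comm, ← Finset.sum_neg_distrib]
        refine Finset.sum_congr rfl fun c _ => ?_
        simp only [mul_assoc, ← Finset.mul_sum]
        rw [← neg_eq_iff_add_eq_zero.2 (h4 c), mul_neg, mul_neg, ← mul_assoc d', hd2, one_mul]
      simp only [sub_mul, Finset.sum_sub_distrib]
      rw [h5, ← neg_add', neg_eq_zero]; exact hS2 j b
    funext a
    have h6 := congrFun h3 a
    exact sub_eq_zero.1 ((MulOpposite.op_eq_zero_iff _).1 h6)
  have hT : ∀ j l, ∑ c, (Matrix.of fun i j => δ * S i j * d') j c * P (v l) (v c) =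
      if j = l then 1 else 0 := by
    intro j l
    have h7 : ∑ c, S j c * d' * ∑ i, ν (e (v c)) i * Z i (e (v l)) = if j = l then 1 else 0 := by
      rw [← hS1 j l, ← hz j]
      simp only [hνZ, mul_add, Finset.sum_add_distrib]
      congr 1
      · refine Finset.sum_congr rfl fun c _ => ?_
        rw [mul_assoc, ← mul_assoc d', hd2, one_mul]
      · simp only [Finset.sum_mul, Finset.mul_sum]
        rw [Finset.sum_comm]
        simp only [mul_assoc]
    have h8 : ∀ c, (Matrix.of fun i j => δ * S i j * d') j c * P (v l) (v c) =
        δ * (S j c * d' * ∑ i, ν (e (v c)) i * Z i (e (v l))) * d' := fun c => by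
      simp only [hP, Matrix.of_apply, mul_assoc]
    simp only [h8, ← Finset.sum_mul, ← Finset.mul_sum]
    rw [h7]
    split_ifs
    · rw [mul_one, hd1]
    · simp
  rw [det_ratio hq hGr hcan hGP hu hv huv hc hW hT, detq_op_conj δ d' hd1 hd2]
  simp only [mul_assoc, hd2, mul_one]

end EvenCase

section Schur
variable {k : ℕ} {A : Type*} [Ring A] [Algebra ℂ A]

/-- The quantum determinant of a matrix with a complementary block and a Schur-type complement. -/
lemma det_schur {q : ℂ} (hq : q ≠ 0) {Y : Matrix (Fin k) (Fin k) A}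
    (hY : Rel (fun _ => 0) q Y) {r s : ℕ} {u : Fin r → Fin k} {v : Fin s → Fin k}
    (hu : StrictMono u) (hv : StrictMono v) (huv : ∀ a b, u a ≠ v b)
    (hc : ∀ i, (∃ a, u a = i) ∨ ∃ b, v b = i) (W : Matrix (Fin r) (Fin r) A)
    (V : Matrix (Fin r) (Fin s) A)
    (hW : ∀ l j, Y l (u j) = (∑ a, if u a = l then W j a else 0) + ∑ b, V j b * Y l (v b)) :
    detq q Y = detq q W.transpose * detq q (Y.submatrix v v) := by
  obtain ⟨E, _, _, L, t, hm⟩ := exists_model (A := A) k hq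
  obtain ⟨c, hc0, hcm⟩ := exists_merge (E := E) hq hu.injective hv.injective huv hc
  have hψ := hm.co_rel hq hY
  set ψ := co L t Y with hψd
  have hx : ∀ j, ψ (u j) = ∑ a, (t ∘ u) a * L (W.transpose a j) + ∑ b, L (V j b) * ψ (v b) := by
    intro j
    have h1 : ∀ l, t l * L (Y l (u j)) =
        (∑ a, if u a = l then t l * L (W j a) else 0) + ∑ b, L (V j b) * (t l * L (Y l (v b))) := by
      intro l
      rw [hW, map_add, mul_add, map_sum, map_sum, Finset.mul_sum, Finset.mul_sum]
      congr 1
      · refine Finset.sum_congr rfl fun a _ => ?_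
        split_ifs <;> simp
      · refine Finset.sum_congr rfl fun b _ => ?_
        rw [map_mul, ← mul_assoc, ← hm.comm, mul_assoc]
    have h2 : ∀ b, ∑ l, L (V j b) * (t l * L (Y l (v b))) = L (V j b) * ψ (v b) := fun b => by
      rw [← Finset.mul_sum]; rfl
    change ∑ l, t l * L (Y l (u j)) = _
    simp only [h1]
    rw [Finset.sum_add_distrib, Finset.sum_comm, Finset.sum_comm (f := fun l b => _ * (t l * _))]
    simp only [h2, Finset.sum_ite_eq, Finset.mem_univ, if_true]
    rfl
  have h0 : ∀ (r' : ℕ) (g : Fin r' → Fin r) (b : Fin s),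
      ψ (v b) * (fprod (ψ ∘ u ∘ g) * fprod (ψ ∘ v)) = 0 := by
    intro r' g b
    rw [fprod_comp, fprod_comp, ← List.prod_append, ← List.map_append, ← List.prod_cons,
      ← List.map_cons]
    refine prod_not_nodup hq hψ _ fun h => ?_
    exact (List.nodup_cons.1 h).1 (List.mem_append_right _ ((List.mem_ofFn' _ _).2 ⟨b, rfl⟩))
  have h3 : ∀ (r' : ℕ) (g : Fin r' → Fin r), fprod (ψ ∘ u ∘ g) * fprod (ψ ∘ v) =
      fprod (fun i => ∑ a, (t ∘ u) a * L (W.transpose a (g i))) * fprod (ψ ∘ v) := by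
    intro r'
    induction r' with
    | zero => intro g; simp [fprod_zero]
    | succ r' ih =>
      intro g
      rw [fprod_succ, fprod_succ, mul_assoc, mul_assoc, ← ih (fun i => g i.succ)]
      change ψ (u (g 0)) * (fprod (ψ ∘ u ∘ fun i => g i.succ) * _) = _
      have h7 : (∑ b, L (V (g 0) b) * ψ (v b)) *
          (fprod (ψ ∘ u ∘ fun i => g i.succ) * fprod (ψ ∘ v)) = 0 := by
        rw [Finset.sum_mul]
        exact Finset.sum_eq_zero fun b _ => by rw [mul_assoc, h0, mul_zero]
      rw [hx, add_mul, h7, add_zero]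
  have h4 := h3 r id
  simp only [Function.comp_id, id] at h4
  rw [hcm _ hψ, hm.co_top hq, fprod_det (t := t ∘ u) hq (fun a i => hm.comm a _) (hm.rel.comp hu)] at h4
  have h5 : fprod (t ∘ u) * fprod (ψ ∘ v) =
      fprod (t ∘ u) * fprod (t ∘ v) * L (detq q (Y.submatrix v v)) := by
    have h6 : fprod (ψ ∘ v) = _ := fprod_expand hm.comm (fun a j => Y a (v j))
    rw [h6, Finset.mul_sum, sum_injective_range _ v hv.injective, detq_eq, map_sum, Finset.mul_sum]
    · refine Finset.sum_congr rfl fun σ _ => ?_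
      rw [map_smul, ← Function.comp_assoc, fprod_perm (hm.rel.comp hv)]
      simp only [smul_mul_assoc, mul_smul_comm, mul_assoc]
      rfl
    · intro g hg
      rw [← mul_assoc, (fprod_mul_eq_zero hq hm.rel hc g hg).1, zero_mul]
  rw [← fprod_comm (t := t ∘ u) (fun i => hm.comm _ _), mul_assoc, h5, hcm _ hm.rel, smul_mul_assoc,
    mul_smul_comm, ← mul_assoc, fprod_comm (fun i => hm.comm _ i), mul_assoc, ← map_mul] at h4
  exact hm.top_eq (smul_right_injective _ hc0 h4)

end Schur

section Assembly
variable {A : Type*} [Ring A] [Algebra ℂ A]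

lemma Ber_eq (q : ℂ) (r s : ℕ) (X Y : Matrix (Fin (r + s)) (Fin (r + s)) A) :
    Ber q r s X Y = detq q (X.submatrix (Fin.castAdd s) (Fin.castAdd s)) *
      detq q (Y.submatrix (Fin.natAdd r) (Fin.natAdd r)).transpose := rfl

lemma detq_zero (q : ℂ) (X : Matrix (Fin 0) (Fin 0) A) : detq q X = 1 := by
  simp [detq, invCount]

lemma strictMono_lt_iff {N k m r : ℕ} {f : Fin k → Fin N} (hf : StrictMono f)
    (h : (univ.filter fun i => (f i : ℕ) < m).card = r) (i : Fin k) :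
    (f i : ℕ) < m ↔ (i : ℕ) < r := by
  constructor
  · intro hi
    by_contra hr
    have h1 : Finset.Iic i ⊆ univ.filter fun i => (f i : ℕ) < m := fun j hj => by
      have := hf.monotone (Finset.mem_Iic.1 hj)
      simp only [Finset.mem_filter, Finset.mem_univ, true_and]
      exact lt_of_le_of_lt this hi
    have := Finset.card_le_card h1
    rw [Fin.card_Iic] at this
    omega
  · intro hi
    by_contra hm
    have h1 : (univ.filter fun i => (f i : ℕ) < m) ⊆ Finset.Iio i := fun j hj => by
      rw [Finset.mem_Iio]
      by_contra hij
      have h2 : (f i : ℕ) ≤ f j := hf.monotone (not_lt.1 hij)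
      have := (Finset.mem_filter.1 hj).2
      omega
    have := Finset.card_le_card h1
    rw [Fin.card_Iio] at this
    omega

lemma exists_split {m n r s : ℕ} {f : Fin (r + s) → Fin (m + n)} (hf : StrictMono f)
    (h : ∀ i, (f i : ℕ) < m ↔ (i : ℕ) < r) :
    ∃ (u : Fin r → Fin m) (w : Fin s → Fin n), StrictMono u ∧ StrictMono w ∧
      (∀ a, f (Fin.castAdd s a) = Fin.castAdd n (u a)) ∧
      ∀ b, f (Fin.natAdd r b) = Fin.natAdd m (w b) := by
  have h1 : ∀ a : Fin r, (f (Fin.castAdd s a) : ℕ) < m := fun a => (h _).2 (by simp)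
  have h2 : ∀ b : Fin s, m ≤ (f (Fin.natAdd r b) : ℕ) := fun b => by
    by_contra hb
    have := (h _).1 (not_le.1 hb)
    simp at this
  refine ⟨fun a => ⟨f (Fin.castAdd s a), h1 a⟩, fun b => ⟨f (Fin.natAdd r b) - m, ?_⟩, ?_, ?_, ?_, ?_⟩
  · have := (f (Fin.natAdd r b)).isLt
    have := h2 b
    omega
  · intro a b hab
    exact hf (show Fin.castAdd s a < Fin.castAdd s b from hab)
  · intro a b hab
    have h3 : (f (Fin.natAdd r a) : ℕ) < f (Fin.natAdd r b) :=
      hf (show Fin.natAdd r a < Fin.natAdd r b by simpa using hab)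
    have := h2 a
    rw [Fin.lt_def]
    change (f (Fin.natAdd r a) : ℕ) - m < f (Fin.natAdd r b) - m
    omega
  · intro a; ext; rfl
  · intro b
    ext
    have := h2 b
    simp only [Fin.val_natAdd]
    omega

lemma strictMono_eq_id {k : ℕ} {f : Fin k → Fin k} (hf : StrictMono f) : f = id :=
  (hf.range_inj strictMono_id).1 (by
    rw [(Finite.injective_iff_surjective.1 hf.injective).range_eq, Set.range_id])

/-- The parity opposite to `pa m`. -/
def paOpp (m : ℕ) {N : ℕ} (i : Fin N) : ℕ := if (i : ℕ) < m then 1 else 0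

lemma pa_paOpp (m : ℕ) {N : ℕ} (i : Fin N) :
    pa m i = 0 ∧ paOpp m i = 1 ∨ pa m i = 1 ∧ paOpp m i = 0 := by
  unfold pa paOpp; split_ifs <;> simp

lemma pa_eq_zero {m n : ℕ} (i : Fin (m + n)) : pa m i = 0 ↔ ∃ a : Fin m, Fin.castAdd n a = i := by
  unfold pa
  constructor
  · intro h
    split_ifs at h with h1
    exact ⟨⟨i, h1⟩, rfl⟩
  · rintro ⟨a, rfl⟩; simp

lemma paOpp_eq_zero {m n : ℕ} (i : Fin (m + n)) :
    paOpp m i = 0 ↔ ∃ a : Fin n, Fin.natAdd m a = i := by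
  unfold paOpp
  constructor
  · intro h
    split_ifs at h with h1
    exact ⟨⟨i - m, by omega⟩, by ext; simp; omega⟩
  · rintro ⟨a, rfl⟩; simp

/-- The supertranspose with respect to the opposite parity. -/
noncomputable def superT (m : ℕ) {N : ℕ} (X : Matrix (Fin N) (Fin N) A) :
    Matrix (Fin N) (Fin N) A :=
  Matrix.of fun i b => (-1 : ℂ) ^ (paOpp m i * (paOpp m i + paOpp m b)) • X b i

lemma superT_natAdd {m n : ℕ} (X : Matrix (Fin (m + n)) (Fin (m + n)) A) :
    (superT m X).submatrix (Fin.natAdd m) (Fin.natAdd m) =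
      (X.submatrix (Fin.natAdd m) (Fin.natAdd m)).transpose := by
  ext i j
  simp [superT, paOpp]

lemma PiSt_apply {m N r' s' : ℕ} {g : Fin (r' + s') → Fin N}
    (hg : ∀ i, (g i : ℕ) < m ↔ (i : ℕ) < r') (X : Matrix (Fin N) (Fin N) A)
    (i j : Fin (s' + r')) :
    PiSt r' s' (X.submatrix g g) i j =
      superT m X (g (Fin.rev (Fin.cast (Nat.add_comm s' r') i)))
        (g (Fin.rev (Fin.cast (Nat.add_comm s' r') j))) := by
  have h : ∀ i, paOpp m (g (Fin.rev (Fin.cast (Nat.add_comm s' r') i))) = pa s' i := by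
    intro i
    unfold paOpp pa
    simp only [hg, Fin.val_rev, Fin.val_cast]
    split_ifs <;> omega
  simp only [superT, PiSt, Matrix.of_apply, h, Matrix.submatrix_apply]

lemma rev_cast_castAdd {r' s' : ℕ} (i : Fin s') :
    Fin.rev (Fin.cast (Nat.add_comm s' r') (Fin.castAdd r' i)) = Fin.natAdd r' (Fin.rev i) := by
  ext; simp; omega

lemma sum_complement {N k l : ℕ} {f : Fin k → Fin N} {g : Fin l → Fin N}
    (hf : Function.Injective f) (hg : Function.Injective g) (hfg : ∀ a b, f a ≠ g b)
    (hc : ∀ i, (∃ a, f a = i) ∨ ∃ b, g b = i) {X : Type*} [AddCommMonoid X] (F : Fin N → X) :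
    ∑ i, F i = ∑ a, F (f a) + ∑ b, F (g b) := by
  have h : Function.Bijective (Sum.elim f g) := by
    constructor
    · exact hf.sumElim hg hfg
    · intro i
      rcases hc i with ⟨a, ha⟩ | ⟨b, hb⟩
      · exact ⟨Sum.inl a, ha⟩
      · exact ⟨Sum.inr b, hb⟩
  rw [← (Equiv.ofBijective _ h).sum_comp, Fintype.sum_sum_type]
  rfl

variable {m n r s r' s' : ℕ} {q : ℂ} (hq : q ≠ 0)
  {M Minv : Matrix (Fin (m + n)) (Fin (m + n)) A}
  (hM : Rel (pa m) q M) (hMinv : Rel (pa m) q⁻¹ Minv)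
  (h1 : M * Minv = 1) (h2 : Minv * M = 1)
  {f : Fin (r + s) → Fin (m + n)} {g : Fin (r' + s') → Fin (m + n)}
  (hf : StrictMono f) (hg : StrictMono g) (hfg : ∀ a b, f a ≠ g b)
  (hc : ∀ i, (∃ a, f a = i) ∨ ∃ b, g b = i)
  (hfm : ∀ i, (f i : ℕ) < m ↔ (i : ℕ) < r) (hgm : ∀ i, (g i : ℕ) < m ↔ (i : ℕ) < r')
include hfg hc in
lemma split_complement {u : Fin r → Fin m} {w : Fin s → Fin n} {u' : Fin r' → Fin m}
    {w' : Fin s' → Fin n} (hu : ∀ a, f (Fin.castAdd s a) = Fin.castAdd n (u a))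
    (hw : ∀ b, f (Fin.natAdd r b) = Fin.natAdd m (w b))
    (hu' : ∀ a, g (Fin.castAdd s' a) = Fin.castAdd n (u' a))
    (hw' : ∀ b, g (Fin.natAdd r' b) = Fin.natAdd m (w' b)) :
    ((∀ a b, u a ≠ u' b) ∧ ∀ i, (∃ a, u a = i) ∨ ∃ b, u' b = i) ∧
      ((∀ a b, w a ≠ w' b) ∧ ∀ i, (∃ a, w a = i) ∨ ∃ b, w' b = i) := by
  have hne : ∀ (i : Fin m) (j : Fin n), Fin.castAdd n i ≠ Fin.natAdd m j := fun i j h => by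
    have := congrArg Fin.val h
    simp at this
    omega
  refine ⟨⟨fun a b h => ?_, fun i => ?_⟩, ⟨fun a b h => ?_, fun i => ?_⟩⟩
  · exact hfg (Fin.castAdd s a) (Fin.castAdd s' b) (by rw [hu, hu', h])
  · rcases hc (Fin.castAdd n i) with ⟨a, ha⟩ | ⟨b, hb⟩
    · left
      induction a using Fin.addCases with
      | left a => exact ⟨a, Fin.castAdd_injective _ _ ((hu a).symm.trans ha)⟩
      | right a => exact absurd (ha.symm.trans (hw a)) (hne _ _)
    · right
      induction b using Fin.addCases with
      | left a => exact ⟨a, Fin.castAdd_injective _ _ ((hu' a).symm.trans hb)⟩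
      | right a => exact absurd (hb.symm.trans (hw' a)) (hne _ _)
  · exact hfg (Fin.natAdd r a) (Fin.natAdd r' b) (by rw [hw, hw', h])
  · rcases hc (Fin.natAdd m i) with ⟨a, ha⟩ | ⟨b, hb⟩
    · left
      induction a using Fin.addCases with
      | left a => exact absurd ((hu a).symm.trans ha) (hne _ _)
      | right a => exact ⟨a, Fin.natAdd_injective _ _ ((hw a).symm.trans ha)⟩
    · right
      induction b using Fin.addCases with
      | left a => exact absurd ((hu' a).symm.trans hb) (hne _ _)
      | right a => exact ⟨a, Fin.natAdd_injective _ _ ((hw' a).symm.trans hb)⟩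

lemma superT_rel (hq : q ≠ 0) (hMinv : Rel (pa m) q⁻¹ Minv) :
    Rel (paOpp m) q (superT m Minv) :=
  hMinv.superTranspose (pa_paOpp m) hq fun _ _ => rfl

lemma superT_natAdd_rel (hq : q ≠ 0) (hMinv : Rel (pa m) q⁻¹ Minv) :
    Rel (fun _ => 0) q ((superT m Minv).submatrix (Fin.natAdd m) (Fin.natAdd m)) :=
  (superT_rel hq hMinv).submatrix_even (Fin.strictMono_natAdd m) fun a =>
    (paOpp_eq_zero _).2 ⟨a, rfl⟩

lemma PiSt_castAdd {w' : Fin s' → Fin n} (hgm : ∀ i, (g i : ℕ) < m ↔ (i : ℕ) < r')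
    (hw' : ∀ b, g (Fin.natAdd r' b) = Fin.natAdd m (w' b)) :
    (PiSt r' s' (Minv.submatrix g g)).submatrix (Fin.castAdd r') (Fin.castAdd r') =
      ((((superT m Minv).submatrix (Fin.natAdd m) (Fin.natAdd m)).submatrix w' w').submatrix
        Fin.rev Fin.rev) := by
  ext i j
  simp only [Matrix.submatrix_apply, PiSt_apply hgm, rev_cast_castAdd, hw']

include hq hM hMinv h1 h2 hf hg hfg hc hfm hgm in
/-- The ratio theorem when only even indices are selected. -/
lemma ratio_of_even (hs : s = 0) {W1 : Matrix (Fin (r + s)) (Fin (r + s)) A}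
    (hW1 : M.submatrix f f * W1 = 1) {W2 : Matrix (Fin (s' + r')) (Fin (s' + r')) A}
    (hW2 : W2 * PiSt r' s' (Minv.submatrix g g) = 1) :
    Ber q m n M Minv = Ber q r s (M.submatrix f f) W1 *
      Ber q⁻¹ s' r' (PiSt r' s' (Minv.submatrix g g)) W2 := by
  subst hs
  obtain ⟨u, w, hu, hw, hfu, hfw⟩ := exists_split hf hfm
  obtain ⟨u', w', hu', hw', hgu, hgw⟩ := exists_split hg hgm
  obtain ⟨⟨huu, hcu⟩, hww, hcw⟩ := split_complement hfg hc hfu hfw hgu hgw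
  obtain rfl : s' = n := by
    have : Function.Bijective w' := ⟨hw'.injective, fun i => by
      rcases hcw i with ⟨a, -⟩ | h
      · exact a.elim0
      · exact h⟩
    simpa using Fintype.card_of_bijective this
  obtain rfl := strictMono_eq_id hw'
  have hT := detq_op_rev q⁻¹
    (Matrix.of fun a b => W2 (Fin.cast (Nat.add_comm r' s') (Fin.rev (Fin.castAdd s' a)))
      (Fin.cast (Nat.add_comm r' s') (Fin.rev (Fin.castAdd s' b)))).transpose
  set S : Matrix (Fin r') (Fin r') A := Matrix.of fun a b =>
    W2 (Fin.cast (Nat.add_comm r' s') (Fin.rev (Fin.castAdd s' a)))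
      (Fin.cast (Nat.add_comm r' s') (Fin.rev (Fin.castAdd s' b))) with hS
  have hsum : ∀ (j : Fin r') (d : Fin (r' + s')),
      ∑ c, S j c * superT m Minv (g (Fin.castAdd s' c)) (g d) +
        ∑ a, W2 (Fin.cast (Nat.add_comm r' s') (Fin.rev (Fin.castAdd s' j)))
            (Fin.cast (Nat.add_comm r' s') (Fin.rev (Fin.natAdd r' a))) *
          superT m Minv (g (Fin.natAdd r' a)) (g d) = if Fin.castAdd s' j = d then 1 else 0 := by
    intro j d
    have h3 := congrFun (congrFun hW2 (Fin.cast (Nat.add_comm r' s') (Fin.rev (Fin.castAdd s' j))))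
      (Fin.cast (Nat.add_comm r' s') (Fin.rev d))
    let ε : Fin (r' + s') ≃ Fin (s' + r') := Fin.revPerm.trans (finCongr (Nat.add_comm r' s'))
    rw [Matrix.mul_apply, Matrix.one_apply, ← ε.sum_comp, Fin.sum_univ_add] at h3
    have h4 : ∀ c, Fin.rev (Fin.cast (Nat.add_comm s' r') (Fin.cast (Nat.add_comm r' s')
      (Fin.rev c))) = c := fun c => by simp
    have h5 : ∀ c, ε c = Fin.cast (Nat.add_comm r' s') (Fin.rev c) := fun c => rfl
    simp only [h5, PiSt_apply hgm, h4, (Fin.cast_injective (Nat.add_comm r' s')).eq_iff,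
      Fin.rev_inj] at h3
    exact h3
  have key := ratio_even (pa_paOpp m) hq hM hMinv h1 h2 (Z := superT m Minv) (fun _ _ => rfl)
    (Fin.strictMono_natAdd m) paOpp_eq_zero (fun j a h => by
      unfold paOpp at h
      split_ifs at h with h3
      rw [Fin.lt_def, Fin.val_natAdd]
      omega) (Fin.strictMono_castAdd s') pa_eq_zero hu hu' huu hcu
    (W := W1) (by
      rw [Matrix.submatrix_submatrix]
      rw [← hW1]
      congr 1
      ext a b
      simp only [Matrix.submatrix_apply, Function.comp, ← hfu]
      rfl) S (Matrix.of fun j a =>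
        W2 (Fin.cast (Nat.add_comm r' s') (Fin.rev (Fin.castAdd s' j)))
            (Fin.cast (Nat.add_comm r' s') (Fin.rev (Fin.natAdd r' a))))
    (fun j l => by
      have := hsum j (Fin.castAdd s' l)
      simpa only [hgu, hgw, Matrix.of_apply, (Fin.castAdd_injective r' s').eq_iff, id] using this)
    (fun j b => by
      have := hsum j (Fin.natAdd r' b)
      rw [if_neg (by intro h; have := congrArg Fin.val h; simp at this; omega)] at this
      simpa only [hgu, hgw, Matrix.of_apply, id] using this)
  rw [Ber_eq, Ber_eq, Ber_eq, ← superT_natAdd, key, PiSt_castAdd hgm hgw, Matrix.submatrix_id_id,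
    detq_rev hq (superT_natAdd_rel hq hMinv), hT, detq_zero q
      (W1.submatrix (Fin.natAdd r) (Fin.natAdd r)).transpose, mul_one]
  congr 2
  · ext a b
    simp only [Matrix.submatrix_apply, hfu]
  · congr 1
    ext a b
    simp only [hS, Matrix.submatrix_apply, Matrix.transpose_apply, Matrix.of_apply]
    congr 1 <;> ext <;> simp <;> omega

include hq hMinv h1 hf hg hfg hc hfm hgm in
/-- The ratio theorem when all even indices are selected. -/
lemma ratio_of_even_subset (hr : r' = 0) {W1 : Matrix (Fin (r + s)) (Fin (r + s)) A}
    (hW1 : W1 * M.submatrix f f = 1) (W2 : Matrix (Fin (s' + r')) (Fin (s' + r')) A) :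
    Ber q m n M Minv = Ber q r s (M.submatrix f f) W1 *
      Ber q⁻¹ s' r' (PiSt r' s' (Minv.submatrix g g)) W2 := by
  subst hr
  obtain ⟨u, w, hu, hw, hfu, hfw⟩ := exists_split hf hfm
  obtain ⟨u', w', hu', hw', hgu, hgw⟩ := exists_split hg hgm
  obtain ⟨⟨huu, hcu⟩, hww, hcw⟩ := split_complement hfg hc hfu hfw hgu hgw
  obtain rfl : r = m := by
    have : Function.Bijective u := ⟨hu.injective, fun i => by
      rcases hcu i with h | ⟨a, -⟩
      · exact h
      · exact a.elim0⟩
    simpa using Fintype.card_of_bijective this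
  obtain rfl := strictMono_eq_id hu
  have hrow : ∀ i l, Minv (f i) l = ∑ a, W1 i a * (if f a = l then 1 else 0) -
      ∑ b, (∑ a, W1 i a * M (f a) (g b)) * Minv (g b) l := by
    intro i l
    have h3 : ∀ a, ∑ c, M (f a) (f c) * Minv (f c) l + ∑ b, M (f a) (g b) * Minv (g b) l =
        if f a = l then 1 else 0 := fun a => by
      rw [← Matrix.one_apply, ← h1, Matrix.mul_apply,
        sum_complement hf.injective hg.injective hfg hc]
    have h4 : ∀ c, ∑ a, W1 i a * M (f a) (f c) = if i = c then 1 else 0 := fun c => by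
      rw [← Matrix.one_apply, ← hW1, Matrix.mul_apply]; rfl
    simp only [← h3, mul_add, Finset.sum_add_distrib, Finset.mul_sum, Finset.sum_mul]
    rw [Finset.sum_comm, Finset.sum_comm (s := univ (α := Fin (0 + s'))), eq_sub_iff_add_eq]
    simp only [← mul_assoc, ← Finset.sum_mul, h4]
    simp
  have key := det_schur hq (superT_natAdd_rel hq hMinv) hw hw' hww hcw
    (W1.submatrix (Fin.natAdd r) (Fin.natAdd r))
    (Matrix.of fun j b => -∑ a, W1 (Fin.natAdd r j) a * M (f a) (g (Fin.natAdd 0 b)))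
    (fun l j => by
      rw [superT_natAdd]
      simp only [Matrix.transpose_apply, Matrix.submatrix_apply, ← hfw, Matrix.of_apply]
      rw [hrow, Fin.sum_univ_add, sub_eq_add_neg, ← Finset.sum_neg_distrib]
      congr 1
      · rw [Finset.sum_eq_zero, zero_add]
        · refine Finset.sum_congr rfl fun a _ => ?_
          simp only [hfw, (Fin.natAdd_injective _ _).eq_iff]
          split_ifs <;> simp
        · intro a _
          rw [hfu, if_neg, mul_zero]
          intro h
          have := congrArg Fin.val h
          simp at this
          omega
      · rw [Fin.sum_univ_add]
        simp only [Finset.univ_eq_empty, Finset.sum_empty, zero_add, neg_mul, hgw])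
  rw [Ber_eq, Ber_eq, Ber_eq, ← superT_natAdd, key, PiSt_castAdd hgm hgw,
    detq_rev hq ((superT_natAdd_rel hq hMinv).submatrix hw'), detq_zero q⁻¹
      (W2.submatrix (Fin.natAdd s') (Fin.natAdd s')).transpose, mul_one, mul_assoc]
  congr 2
  ext a b
  simp only [Matrix.submatrix_apply, hfu, id]

end Assembly

lemma orderIso_strictMono {N k : ℕ} (I : Finset (Fin N)) (h : I.card = k) :
    StrictMono fun i => (I.orderIsoOfFin h i : Fin N) :=
  fun _ _ hab => (I.orderIsoOfFin h).strictMono hab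

lemma exists_orderIso_eq {N k : ℕ} (I : Finset (Fin N)) (h : I.card = k) (i : Fin N) :
    (∃ a, (I.orderIsoOfFin h a : Fin N) = i) ↔ i ∈ I := by
  constructor
  · rintro ⟨a, rfl⟩; exact (I.orderIsoOfFin h a).2
  · intro hi
    obtain ⟨a, ha⟩ := (I.orderIsoOfFin h).surjective ⟨i, hi⟩
    exact ⟨a, congrArg Subtype.val ha⟩

lemma mem_filter_lt {N m : ℕ} (I : Finset (Fin N)) (x : ℕ) :
    (x ∈ I.filter fun t => (t : ℕ) < m) ↔ (∃ t ∈ I, (t : ℕ) = x) ∧ x < m := by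
  rw [Finset.mem_filter, bind_pure_comp, Finset.fmap_def, @Finset.mem_image _ _ (_)]

lemma orderIso_lt_iff {N k m r : ℕ} (I : Finset (Fin N)) (h : I.card = k)
    (hr : (I.filter fun t => (t : ℕ) < m).card = r) (i : Fin k) :
    ((I.orderIsoOfFin h i : Fin N) : ℕ) < m ↔ (i : ℕ) < r := by
  refine strictMono_lt_iff (f := fun i => (I.orderIsoOfFin h i : Fin N))
    (orderIso_strictMono I h) ?_ i
  rw [← hr, ← Finset.card_image_of_injective _
    (Fin.val_injective.comp (orderIso_strictMono I h).injective)]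
  congr 1
  ext x
  rw [mem_filter_lt]
  simp only [Finset.mem_image, Finset.mem_filter, Finset.mem_univ, true_and, Function.comp]
  simp only [← exists_orderIso_eq I h]
  constructor
  · rintro ⟨a, ha, rfl⟩; exact ⟨⟨_, ⟨a, rfl⟩, rfl⟩, ha⟩
  · rintro ⟨⟨_, ⟨a, rfl⟩, rfl⟩, ha⟩; exact ⟨a, ha, rfl⟩

/-- Jacobi's ratio theorem for quantum Berezinians. -/
theorem stmt17 (m n r s r' s' : ℕ) (q : ℂ) (hq : q ≠ 0) (A : Type*) [Ring A] [Algebra ℂ A]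
    (M Minv : Matrix (Fin (m + n)) (Fin (m + n)) A)
    (hM : ManinRel q m M) (hMinv : ManinRel q⁻¹ m Minv)
    (h1 : M * Minv = 1) (h2 : Minv * M = 1)
    (I : Finset (Fin (m + n)))
    (hI : (∀ t ∈ I, (t : ℕ) < m) ∨ (∀ t : Fin (m + n), (t : ℕ) < m → t ∈ I))
    (hrs : I.card = r + s) (hr : (I.filter fun t => (t : ℕ) < m).card = r)
    (hcs : Iᶜ.card = r' + s') (hr' : (Iᶜ.filter fun t => (t : ℕ) < m).card = r')
    (W1 : Matrix (Fin (r + s)) (Fin (r + s)) A)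
    (hW1 :
      M.submatrix (fun i => (I.orderIsoOfFin hrs i : Fin (m + n)))
          (fun i => (I.orderIsoOfFin hrs i : Fin (m + n))) * W1 = 1 ∧
      W1 * M.submatrix (fun i => (I.orderIsoOfFin hrs i : Fin (m + n)))
          (fun i => (I.orderIsoOfFin hrs i : Fin (m + n))) = 1)
    (W2 : Matrix (Fin (s' + r')) (Fin (s' + r')) A)
    (hW2 :
      PiSt r' s' (Minv.submatrix (fun i => (Iᶜ.orderIsoOfFin hcs i : Fin (m + n)))
          (fun i => (Iᶜ.orderIsoOfFin hcs i : Fin (m + n)))) * W2 = 1 ∧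
      W2 * PiSt r' s' (Minv.submatrix (fun i => (Iᶜ.orderIsoOfFin hcs i : Fin (m + n)))
          (fun i => (Iᶜ.orderIsoOfFin hcs i : Fin (m + n)))) = 1) :
    Ber q m n M Minv =
      Ber q r s
        (M.submatrix (fun i => (I.orderIsoOfFin hrs i : Fin (m + n)))
          (fun i => (I.orderIsoOfFin hrs i : Fin (m + n)))) W1 *
      Ber q⁻¹ s' r'
        (PiSt r' s' (Minv.submatrix (fun i => (Iᶜ.orderIsoOfFin hcs i : Fin (m + n)))
          (fun i => (Iᶜ.orderIsoOfFin hcs i : Fin (m + n))))) W2 := by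
  have hne : ∀ a b, (I.orderIsoOfFin hrs a : Fin (m + n)) ≠ Iᶜ.orderIsoOfFin hcs b := by
    intro a b h
    have h3 := (Iᶜ.orderIsoOfFin hcs b).2
    rw [← h, Finset.mem_compl] at h3
    exact h3 (I.orderIsoOfFin hrs a).2
  have hcov : ∀ i, (∃ a, (I.orderIsoOfFin hrs a : Fin (m + n)) = i) ∨
      ∃ b, (Iᶜ.orderIsoOfFin hcs b : Fin (m + n)) = i := by
    intro i
    rw [exists_orderIso_eq, exists_orderIso_eq, Finset.mem_compl]
    exact em _
  rcases hI with hI | hI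
  · refine ratio_of_even hq hM.2.2.2 hMinv.2.2.2 h1 h2 (orderIso_strictMono I hrs)
      (orderIso_strictMono Iᶜ hcs) hne hcov (orderIso_lt_iff I hrs hr)
      (orderIso_lt_iff Iᶜ hcs hr') ?_ hW1.1 hW2.2
    have h3 := fun i => (orderIso_lt_iff I hrs hr i).1 (hI _ (I.orderIsoOfFin hrs i).2)
    by_contra hs
    have h4 := h3 ⟨r, by omega⟩
    simp at h4
  · refine ratio_of_even_subset hq hMinv.2.2.2 h1 (orderIso_strictMono I hrs)
      (orderIso_strictMono Iᶜ hcs) hne hcov (orderIso_lt_iff I hrs hr)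
      (orderIso_lt_iff Iᶜ hcs hr') ?_ hW1.2 W2
    by_contra hr0
    refine Finset.mem_compl.1 (Iᶜ.orderIsoOfFin hcs ⟨0, by omega⟩).2
      (hI _ ((orderIso_lt_iff Iᶜ hcs hr' _).2 ?_))
    exact Nat.pos_of_ne_zero hr0

end QSM
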